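/- Let n ≥ 1 and let u : ℝⁿ → ℝ be a smooth solution of (−Δ)³u = |u|^{p−1}u that is stable outside some compact set Θ ⊂ ℝⁿ, where 1 < p and, in the case n ≥ 15, additionally p < p_c(n). Then there exist constants C > 0 and R₀ > 0 such that for all x ∈ ℝⁿ with |x| ≥ R₀, ∑_{k=0}^{5} |x|^{6/(p−1)+k} ‖D^k u(x)‖ ≤ C, where D^k u(x) is the k-th iterated total derivative of u at x. -/

import Mathlib

open MeasureTheory Filter

noncomputable section

/-- The Euclidean Laplacian of `u` at `x`. -/
def laplacian {n : ℕ} (u : EuclideanSpace ℝ (Fin n) → ℝ) (x : EuclideanSpace ℝ (Fin n)) : ℝ :=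
  ∑ i : Fin n, iteratedFDeriv ℝ 2 u x ![EuclideanSpace.single i 1, EuclideanSpace.single i 1]

def dd1 (n : ℝ) : ℝ :=
  -108*n^6 + 1296*n^5 - 3024*n^4 - 10368*n^3 + 103104*n^2 + 20736*n - 94976

def dd2 (n : ℝ) : ℝ :=
  9*n^12 - 216*n^11 + 1800*n^10 - 4320*n^9 - 30864*n^8 + 251136*n^7 - 690432*n^6
    - 1936384*n^5 + 6915840*n^4 + 4818944*n^3 - 16644096*n^2 - 3039232*n + 6131712

/-- `d₀(n)`, the real cube root of `-(d₁(n) + 36√(d₂(n)))`. -/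
def dd0 (n : ℝ) : ℝ := (-(dd1 n + 36 * Real.sqrt (dd2 n))) ^ ((1 : ℝ)/3)

def dfn (n : ℝ) : ℝ :=
  (1/6) * Real.sqrt (9*n^2 + 96 - (1536 + 1152*n^2) / dd0 n - (3/2) * dd0 n)

/-- The Joseph–Lundgren exponent `p_c(n)` (for `n ≥ 15`; `p_c(n) = +∞` for `n ≤ 14`,
which is encoded by imposing the bound `p < pc n` only when `15 ≤ n`). -/
def pc (n : ℝ) : ℝ := (n + 4 - 2 * dfn n) / (n - 8 - 2 * dfn n)

namespace TH

abbrev Eu (n : ℕ) := EuclideanSpace ℝ (Fin n)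

abbrev Smooth {n : ℕ} (f : Eu n → ℝ) : Prop := ContDiff ℝ (⊤ : ℕ∞) f

/-- derivative of `f` along the vector field `F` -/
def vf {n : ℕ} (F : Eu n → Eu n) (f : Eu n → ℝ) : Eu n → ℝ := fun x => fderiv ℝ f x (F x)

/-- basis vector -/
def ee {n : ℕ} (i : Fin n) : Eu n := EuclideanSpace.single i 1

lemma ee_apply {n : ℕ} (i k : Fin n) : (ee i : Eu n) k = if k = i then 1 else 0 := by
  simp [ee]

/-- rotation generator -/
def rotA {n : ℕ} (i j : Fin n) : Eu n →L[ℝ] Eu n :=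
  (EuclideanSpace.proj i : Eu n →L[ℝ] ℝ).smulRight (ee j)
   - (EuclideanSpace.proj j : Eu n →L[ℝ] ℝ).smulRight (ee i)

lemma rotA_apply {n : ℕ} (i j : Fin n) (x : Eu n) : rotA i j x = x i • ee j - x j • ee i := by
  simp [rotA]

def XX {n : ℕ} (f : Eu n → ℝ) : Eu n → ℝ := vf (fun x => x) f
def RR {n : ℕ} (i j : Fin n) (f : Eu n → ℝ) : Eu n → ℝ := vf (fun x => rotA i j x) f

lemma vf_smooth {n : ℕ} {F : Eu n → Eu n} {f : Eu n → ℝ} (hF : ContDiff ℝ (⊤ : ℕ∞) F)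
    (hf : Smooth f) : Smooth (vf F f) := by
  unfold vf
  have h1 : ContDiff ℝ (⊤ : ℕ∞) (fderiv ℝ f) := hf.fderiv_right (by simp)
  exact h1.clm_apply hF

lemma XX_smooth {n : ℕ} {f : Eu n → ℝ} (hf : Smooth f) : Smooth (XX f) :=
  vf_smooth contDiff_id hf

lemma RR_smooth {n : ℕ} {i j : Fin n} {f : Eu n → ℝ} (hf : Smooth f) : Smooth (RR i j f) :=
  vf_smooth (rotA i j).contDiff hf

lemma Smooth.diff {n : ℕ} {f : Eu n → ℝ} (hf : Smooth f) : Differentiable ℝ f :=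
  hf.differentiable (by simp)

lemma vf_add {n : ℕ} {F : Eu n → Eu n} {f g : Eu n → ℝ} {x : Eu n} (hf : DifferentiableAt ℝ f x)
    (hg : DifferentiableAt ℝ g x) : vf F (f + g) x = vf F f x + vf F g x := by
  simp [vf, fderiv_add hf hg]

lemma vf_smul {n : ℕ} {F : Eu n → Eu n} {f : Eu n → ℝ} {x : Eu n} (c : ℝ)
    (hf : DifferentiableAt ℝ f x) : vf F (c • f) x = c * vf F f x := by
  simp [vf, fderiv_const_smul hf c]

lemma vf_mul {n : ℕ} {F : Eu n → Eu n} {f g : Eu n → ℝ} {x : Eu n} (hf : DifferentiableAt ℝ f x)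
    (hg : DifferentiableAt ℝ g x) : vf F (f * g) x = f x * vf F g x + vf F f x * g x := by
  simp [vf, fderiv_mul hf hg, mul_comm]

lemma vf_congr {n : ℕ} {F : Eu n → Eu n} {f g : Eu n → ℝ} {x : Eu n}
    (h : f =ᶠ[nhds x] g) : vf F f x = vf F g x := by
  simp [vf, h.fderiv_eq]

abbrev SmAt {n : ℕ} (f : Eu n → ℝ) (x : Eu n) : Prop := ContDiffAt ℝ (⊤ : ℕ∞) f x

lemma SmAt.diffAt {n : ℕ} {f : Eu n → ℝ} {x : Eu n} (hf : SmAt f x) : DifferentiableAt ℝ f x :=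
  hf.differentiableAt (by simp)

lemma SmAt.fderiv {n : ℕ} {f : Eu n → ℝ} {x : Eu n} (hf : SmAt f x) :
    ContDiffAt ℝ (⊤ : ℕ∞) (fderiv ℝ f) x := hf.fderiv_right (by simp)

lemma SmAt.vf {n : ℕ} {F : Eu n → Eu n} {f : Eu n → ℝ} {x : Eu n}
    (hF : ContDiffAt ℝ (⊤ : ℕ∞) F x)
    (hf : SmAt f x) : SmAt (vf F f) x := by
  unfold TH.vf
  exact hf.fderiv.clm_apply hF

lemma SmAt.XX {n : ℕ} {f : Eu n → ℝ} {x : Eu n} (hf : SmAt f x) : SmAt (XX f) x :=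
  SmAt.vf contDiffAt_id hf

lemma SmAt.RR {n : ℕ} {i j : Fin n} {f : Eu n → ℝ} {x : Eu n} (hf : SmAt f x) :
    SmAt (RR i j f) x :=
  SmAt.vf (rotA i j).contDiff.contDiffAt hf

lemma vf_vf {n : ℕ} {F : Eu n → Eu n} {A : Eu n →L[ℝ] Eu n} {f : Eu n → ℝ}
    {x : Eu n} (hf : SmAt f x) :
    vf F (vf (fun x => A x) f) x = fderiv ℝ (fderiv ℝ f) x (F x) (A x)
      + fderiv ℝ f x (A (F x)) := by
  have h2 : DifferentiableAt ℝ (fderiv ℝ f) x := hf.fderiv.differentiableAt (by simp)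
  unfold vf
  rw [fderiv_clm_apply h2 A.differentiableAt]
  simp [add_comm]

lemma D2_symm {n : ℕ} {f : Eu n → ℝ} {x : Eu n} (hf : SmAt f x) (v w : Eu n) :
    fderiv ℝ (fderiv ℝ f) x v w = fderiv ℝ (fderiv ℝ f) x w v := by
  have := hf.isSymmSndFDerivAt (by
    simp only [minSmoothness_of_isRCLikeNormedField]
    exact WithTop.coe_le_coe.2 le_top)
  exact this v w

lemma laplacian_eq {n : ℕ} (f : Eu n → ℝ) (x : Eu n) :
    laplacian f x = ∑ i, fderiv ℝ (fderiv ℝ f) x (ee i) (ee i) := by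
  unfold laplacian
  refine Finset.sum_congr rfl fun i _ => ?_
  rw [iteratedFDeriv_two_apply]; rfl

lemma laplacian_smooth {n : ℕ} {f : Eu n → ℝ} (hf : Smooth f) : Smooth (laplacian f) := by
  have : laplacian f = fun x => ∑ i, fderiv ℝ (fderiv ℝ f) x (ee i) (ee i) :=
    funext (laplacian_eq f)
  rw [this]
  have h1 : ContDiff ℝ (⊤ : ℕ∞) (fderiv ℝ f) := hf.fderiv_right (by simp)
  have h2 : ContDiff ℝ (⊤ : ℕ∞) (fderiv ℝ (fderiv ℝ f)) := h1.fderiv_right (by simp)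
  exact ContDiff.sum fun i _ => (h2.clm_apply contDiff_const).clm_apply contDiff_const

lemma laplacian_congr {n : ℕ} {f g : Eu n → ℝ} {x : Eu n} (h : f =ᶠ[nhds x] g) :
    laplacian f =ᶠ[nhds x] laplacian g := by
  have h2 : fderiv ℝ (fderiv ℝ f) =ᶠ[nhds x] fderiv ℝ (fderiv ℝ g) := h.fderiv.fderiv
  filter_upwards [h2] with y hy
  rw [laplacian_eq, laplacian_eq, hy]

lemma sum_ee {n : ℕ} (x : Eu n) : ∑ i, x i • ee i = x := by
  ext k
  simp [ee_apply]

lemma rotA_rotA_sum {n : ℕ} (x : Eu n) :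
    ∑ i, ∑ j, rotA i j (rotA i j x) = (2 - 2 * (n : ℝ)) • x := by
  ext k
  simp only [rotA_apply, PiLp.sub_apply, PiLp.smul_apply, ee_apply,
    smul_eq_mul, WithLp.ofLp_sum, Finset.sum_apply]
  have : ∀ i j : Fin n, ((x i * if i = j then 1 else 0) - x j * if i = i then 1 else 0)
      * (if k = j then 1 else 0) - ((x i * if j = j then 1 else 0) - x j * if j = i then 1 else 0)
      * (if k = i then (1:ℝ) else 0) =
      (if i = j then (if k = j then x i else 0) else 0)
      + (if j = i then (if k = i then x j else 0) else 0)
      - (if k = j then x j else 0) - (if k = i then x i else 0) := by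
    intro i j
    by_cases h1 : i = j <;> by_cases h2 : k = j <;> by_cases h3 : k = i <;>
      simp_all
  simp only [this, Finset.sum_add_distrib, Finset.sum_sub_distrib]
  simp
  ring

lemma rsq_laplacian {n : ℕ} {f : Eu n → ℝ} {x : Eu n} (hf : SmAt f x) :
    ‖x‖ ^ 2 * laplacian f x = XX (XX f) x + ((n : ℝ) - 2) * XX f x
      + (1 / 2) * ∑ i, ∑ j, RR i j (RR i j f) x := by
  have hX : XX (XX f) x = fderiv ℝ (fderiv ℝ f) x x x + fderiv ℝ f x x := by
    have := vf_vf (F := fun x => x) (A := ContinuousLinearMap.id ℝ (Eu n)) hf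
    simpa [XX] using this
  have hR : ∀ i j, RR i j (RR i j f) x
      = (x i ^ 2 * fderiv ℝ (fderiv ℝ f) x (ee j) (ee j)
        + x j ^ 2 * fderiv ℝ (fderiv ℝ f) x (ee i) (ee i)
        - 2 * (x i * x j * fderiv ℝ (fderiv ℝ f) x (ee i) (ee j)))
        + fderiv ℝ f x (rotA i j (rotA i j x)) := by
    intro i j
    unfold RR
    rw [vf_vf hf]
    congr 1
    rw [rotA_apply]
    simp only [map_sub, map_smul, sub_apply, smul_apply,
      smul_eq_mul]
    rw [D2_symm hf (ee j) (ee i)]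
    ring
  have h3 : ∑ i, ∑ j, x i * x j * fderiv ℝ (fderiv ℝ f) x (ee i) (ee j)
      = fderiv ℝ (fderiv ℝ f) x x x := by
    conv_rhs => rw [← sum_ee x]
    simp only [map_sum, map_smul, sum_apply, smul_apply,
      smul_eq_mul, Finset.mul_sum]
    rw [sum_ee x]
    rw [Finset.sum_comm]
    refine Finset.sum_congr rfl fun i _ => Finset.sum_congr rfl fun j _ => ?_
    ring
  have h4 : ∑ i, ∑ j, fderiv ℝ f x (rotA i j (rotA i j x))
      = (2 - 2 * (n : ℝ)) * fderiv ℝ f x x := by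
    rw [← smul_eq_mul, ← map_smul, ← rotA_rotA_sum]
    simp
  have h5 : ∑ i, x i ^ 2 = ‖x‖ ^ 2 := by
    rw [EuclideanSpace.real_norm_sq_eq]
  simp only [hR, Finset.sum_add_distrib, Finset.sum_sub_distrib, h4, ← Finset.mul_sum, h3]
  rw [hX, laplacian_eq]
  have hXf : XX f x = fderiv ℝ f x x := rfl
  rw [hXf]
  simp only [← Finset.sum_mul, h5, ← Finset.mul_sum]
  ring

/-! ### commutation -/

lemma XX_RR {n : ℕ} {f : Eu n → ℝ} {x : Eu n} (hf : SmAt f x) (i j : Fin n) :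
    XX (RR i j f) x = RR i j (XX f) x := by
  have h1 := vf_vf (F := fun x => x) (A := rotA i j) hf
  have h2 := vf_vf (F := fun x => rotA i j x) (A := ContinuousLinearMap.id ℝ (Eu n)) hf
  simp only [ContinuousLinearMap.id_apply] at h2
  unfold XX RR
  rw [h1, h2, D2_symm hf]

/-! ### integration by parts -/

lemma integral_pd_zero {n : ℕ} {f : Eu n → ℝ} (hf : ContDiff ℝ 1 f) (hc : HasCompactSupport f)
    (v : Eu n) : ∫ x, fderiv ℝ f x v = 0 := by
  have hcont : Continuous fun x => fderiv ℝ f x v :=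
    (hf.continuous_fderiv (by simp)).clm_apply continuous_const
  have hcs : HasCompactSupport fun x => fderiv ℝ f x v := hc.fderiv_apply (𝕜 := ℝ) v
  have := integral_mul_fderiv_eq_neg_fderiv_mul_of_integrable (μ := volume) (f := fun _ : Eu n => (1:ℝ))
    (g := f) (v := v) (by simp) (by simpa using hcont.integrable_of_hasCompactSupport hcs)
    (by simpa using hf.continuous.integrable_of_hasCompactSupport hc)
    (by intros; fun_prop) (fun x _ => hf.differentiable (by simp) x)
  simpa using this

lemma integral_vf {n : ℕ} (A : Eu n →L[ℝ] Eu n) {f : Eu n → ℝ} (hf : ContDiff ℝ 1 f)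
    (hc : HasCompactSupport f) :
    ∫ x, vf (fun x => A x) f x = -(∑ k, A (ee k) k) * ∫ x, f x := by
  have hd : Differentiable ℝ f := hf.differentiable (by simp)
  have key : ∀ k : Fin n, ∀ x, fderiv ℝ (fun x => (A x) k * f x) x (ee k)
      = (A x) k * fderiv ℝ f x (ee k) + A (ee k) k * f x := by
    intro k x
    have h1 : HasFDerivAt (fun x => (A x) k)
      ((EuclideanSpace.proj k : Eu n →L[ℝ] ℝ).comp A) x :=
      ((EuclideanSpace.proj k : Eu n →L[ℝ] ℝ).comp A).hasFDerivAt
    have h2 := (h1.mul (hd x).hasFDerivAt).fderiv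
    have h3 : ((fun x => (A x) k) * f) = fun x => (A x) k * f x := rfl
    rw [h3] at h2
    rw [h2]
    simp
    ring
  have hcd : ∀ k : Fin n, ContDiff ℝ 1 (fun x => (A x) k * f x) := by
    intro k
    exact ((EuclideanSpace.proj k : Eu n →L[ℝ] ℝ).comp A).contDiff.mul hf
  have hcs : ∀ k : Fin n, HasCompactSupport (fun x => (A x) k * f x) := fun k => hc.mul_left
  have h0 : ∀ k : Fin n, ∫ x, fderiv ℝ (fun x => (A x) k * f x) x (ee k) = 0 := fun k =>
    integral_pd_zero (hcd k) (hcs k) _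
  have hi : ∀ k : Fin n, Integrable (fun x => fderiv ℝ (fun x => (A x) k * f x) x (ee k)) := by
    intro k
    exact ((hcd k).continuous_fderiv (by simp)).clm_apply continuous_const
      |>.integrable_of_hasCompactSupport ((hcs k).fderiv_apply (𝕜 := ℝ) _)
  have h1 : ∀ x, vf (fun x => A x) f x
      = ∑ k, fderiv ℝ (fun x => (A x) k * f x) x (ee k) - (∑ k, A (ee k) k) * f x := by
    intro x
    simp only [key, Finset.sum_add_distrib, ← Finset.sum_mul, add_sub_cancel_right]
    show fderiv ℝ f x (A x) = _
    conv_lhs => rw [← sum_ee (A x)]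
    simp
  simp_rw [h1]
  rw [integral_sub (integrable_finsetSum _ fun k _ => hi k)
    ((hf.continuous.integrable_of_hasCompactSupport hc).const_mul _),
    integral_finsetSum _ fun k _ => hi k]
  simp only [h0, integral_const_mul]
  simp

lemma integral_XX {n : ℕ} {f : Eu n → ℝ} (hf : ContDiff ℝ 1 f)
    (hc : HasCompactSupport f) : ∫ x, XX f x = -(n : ℝ) * ∫ x, f x := by
  have := integral_vf (ContinuousLinearMap.id ℝ (Eu n)) hf hc
  simpa [XX, ee_apply] using this

lemma integral_RR {n : ℕ} (i j : Fin n) {f : Eu n → ℝ} (hf : ContDiff ℝ 1 f)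
    (hc : HasCompactSupport f) : ∫ x, RR i j f x = 0 := by
  have := integral_vf (rotA i j) hf hc
  have h2 : ∑ k, rotA i j (ee k) k = 0 := by
    simp only [rotA_apply, PiLp.sub_apply, PiLp.smul_apply, ee_apply,
      smul_eq_mul, Finset.sum_sub_distrib]
    rw [sub_eq_zero]
    exact Finset.sum_congr rfl fun k _ => by
      simp only [eq_comm (a := i), eq_comm (a := j)]; ring
  unfold RR
  rw [this, h2]; simp

end TH

namespace TH

/-- functions smooth off the origin (and vanishing at the origin) -/
def SS (n : ℕ) : NonUnitalSubalgebra ℝ (Eu n → ℝ) where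
  carrier := {f | f 0 = 0 ∧ ∀ x, x ≠ 0 → SmAt f x}
  add_mem' := fun {a b} ha hb => ⟨by simp [ha.1, hb.1], fun x hx => (ha.2 x hx).add (hb.2 x hx)⟩
  zero_mem' := ⟨rfl, fun x _ => contDiffAt_const⟩
  mul_mem' := fun {a b} ha hb => ⟨by simp [ha.1], fun x hx => (ha.2 x hx).mul (hb.2 x hx)⟩
  smul_mem' := fun c a ha => ⟨by simp [ha.1], fun x hx => contDiffAt_const.smul (ha.2 x hx)⟩

/-- test weights -/
def Wc : NonUnitalSubalgebra ℝ (ℝ → ℝ) where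
  carrier := {f | ContDiff ℝ (⊤ : ℕ∞) f ∧ HasCompactSupport f}
  add_mem' := fun {_ _} ha hb => ⟨ha.1.add hb.1, ha.2.add hb.2⟩
  zero_mem' := ⟨contDiff_const, HasCompactSupport.zero⟩
  mul_mem' := fun {_ _} ha hb => ⟨ha.1.mul hb.1, ha.2.mul_right⟩
  smul_mem' := fun c _ ha => ⟨contDiff_const.smul ha.1, ha.2.smul_left (f := fun _ => c)⟩

instance (n : ℕ) : CoeFun (SS n) (fun _ => Eu n → ℝ) := ⟨fun f => f.1⟩
instance : CoeFun Wc (fun _ => ℝ → ℝ) := ⟨fun f => f.1⟩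

variable {n : ℕ}

lemma SS.zero (f : SS n) : f.1 0 = 0 := f.2.1
lemma SS.sm (f : SS n) {x : Eu n} (hx : x ≠ 0) : SmAt f.1 x := f.2.2 x hx

lemma SS.ext' {f g : SS n} (h : ∀ x, x ≠ 0 → f.1 x = g.1 x) : f = g := by
  apply Subtype.ext; funext x
  by_cases hx : x = 0
  · rw [hx, SS.zero f, SS.zero g]
  · exact h x hx

@[simp] lemma SS.add_ap (f g : SS n) (x : Eu n) : (f + g).1 x = f.1 x + g.1 x := rfl
@[simp] lemma SS.sub_ap (f g : SS n) (x : Eu n) : (f - g).1 x = f.1 x - g.1 x := rfl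
@[simp] lemma SS.mul_ap (f g : SS n) (x : Eu n) : (f * g).1 x = f.1 x * g.1 x := rfl
@[simp] lemma SS.smul_ap (c : ℝ) (f : SS n) (x : Eu n) : (c • f).1 x = c * f.1 x := rfl
@[simp] lemma SS.neg_ap (f : SS n) (x : Eu n) : (-f).1 x = - f.1 x := rfl
@[simp] lemma SS.zero_ap (x : Eu n) : (0 : SS n).1 x = 0 := rfl
@[simp] lemma Wc.add_ap (f g : Wc) (x : ℝ) : (f + g).1 x = f.1 x + g.1 x := rfl
@[simp] lemma Wc.sub_ap (f g : Wc) (x : ℝ) : (f - g).1 x = f.1 x - g.1 x := rfl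
@[simp] lemma Wc.mul_ap (f g : Wc) (x : ℝ) : (f * g).1 x = f.1 x * g.1 x := rfl
@[simp] lemma Wc.smul_ap (c : ℝ) (f : Wc) (x : ℝ) : (c • f).1 x = c * f.1 x := rfl

lemma SS.sum_ap {ι : Type*} (s : Finset ι) (f : ι → SS n) (x : Eu n) :
    (∑ i ∈ s, f i).1 x = ∑ i ∈ s, (f i).1 x := by
  have : (∑ i ∈ s, f i).1 = ∑ i ∈ s, (f i).1 := by
    simp
  rw [this, Finset.sum_apply]

lemma sub_smooth_ne {x : Eu n} (hx : x ≠ 0) : ∀ᶠ y in nhds x, y ≠ 0 := isOpen_ne.mem_nhds hx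

/-- derivative on weights -/
def dW : Wc →ₗ[ℝ] Wc where
  toFun := fun ζ => ⟨deriv ζ.1, (contDiff_infty_iff_deriv.1 ζ.2.1).2, ζ.2.2.deriv⟩
  map_add' := fun a b => by
    apply Subtype.ext; funext x
    exact deriv_add (a.2.1.differentiable (by simp) x) (b.2.1.differentiable (by simp) x)
  map_smul' := fun c a => by
    apply Subtype.ext; funext x
    exact deriv_const_smul c (a.2.1.differentiable (by simp) x)

lemma dW_ap (ζ : Wc) (t : ℝ) : (dW ζ).1 t = deriv ζ.1 t := rfl

lemma dW_mul (a b : Wc) : dW (a * b) = dW a * b + a * dW b := by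
  apply Subtype.ext; funext x
  exact deriv_mul (a.2.1.differentiable (by simp) x) (b.2.1.differentiable (by simp) x)

def vfS (A : Eu n →L[ℝ] Eu n) : SS n →ₗ[ℝ] SS n where
  toFun := fun f => ⟨vf (fun x => A x) f.1, by simp [vf], fun x hx =>
    SmAt.vf A.contDiff.contDiffAt (SS.sm f hx)⟩
  map_add' := fun f g => SS.ext' fun x hx => vf_add (SS.sm f hx).diffAt (SS.sm g hx).diffAt
  map_smul' := fun c f => SS.ext' fun x hx => vf_smul c (SS.sm f hx).diffAt

lemma vfS_mul (A : Eu n →L[ℝ] Eu n) (f g : SS n) : vfS A (f * g) = f * vfS A g + vfS A f * g :=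
  SS.ext' fun x hx => vf_mul (SS.sm f hx).diffAt (SS.sm g hx).diffAt

def Xo : SS n →ₗ[ℝ] SS n := vfS (ContinuousLinearMap.id ℝ (Eu n))
def Ro (i j : Fin n) : SS n →ₗ[ℝ] SS n := vfS (rotA i j)

lemma Xo_ap (f : SS n) (x : Eu n) : (Xo f).1 x = XX f.1 x := rfl
lemma Ro_ap (i j : Fin n) (f : SS n) (x : Eu n) : (Ro i j f).1 x = RR i j f.1 x := rfl

lemma Xo_Ro (i j : Fin n) (f : SS n) : Xo (Ro i j f) = Ro i j (Xo f) :=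
  SS.ext' fun x hx => XX_RR (SS.sm f hx) i j

/-- radial multiplier -/
def rm (ζ : ℝ → ℝ) (hζ : ContDiff ℝ (⊤ : ℕ∞) ζ) : SS n →ₗ[ℝ] SS n where
  toFun := fun f => ⟨fun x => ζ (Real.log ‖x‖) * f.1 x, by simp [SS.zero f], fun x hx =>
    (ContDiffAt.comp x hζ.contDiffAt ((contDiffAt_norm ℝ hx).log (by simpa using hx))).mul
      (SS.sm f hx)⟩
  map_add' := fun f g => SS.ext' fun x hx => by simp; ring
  map_smul' := fun c f => SS.ext' fun x hx => by simp; ring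

lemma rm_ap (ζ : ℝ → ℝ) (hζ : ContDiff ℝ (⊤ : ℕ∞) ζ) (f : SS n) (x : Eu n) :
    (rm ζ hζ f).1 x = ζ (Real.log ‖x‖) * f.1 x := rfl

lemma fderiv_radial {ζ : ℝ → ℝ} (hζ : ContDiff ℝ (⊤ : ℕ∞) ζ) {x : Eu n} (hx : x ≠ 0) (v : Eu n) :
    fderiv ℝ (fun x : Eu n => ζ (Real.log ‖x‖)) x v
      = deriv ζ (Real.log ‖x‖) * (inner ℝ x v / ‖x‖ ^ 2) := by
  have hx2 : ‖x‖ ^ 2 ≠ 0 := by simpa using hx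
  have h0 : (fun x : Eu n => ζ (Real.log ‖x‖)) = fun x : Eu n => ζ (1/2 * Real.log (‖x‖ ^ 2)) := by
    funext y; rw [Real.log_pow]; congr 1; push_cast; ring
  have h1 : HasFDerivAt (fun x : Eu n => ‖x‖ ^ 2) (2 • (innerSL ℝ x)) x :=
    (hasStrictFDerivAt_norm_sq x).hasFDerivAt
  have h2 := (h1.log hx2).const_mul (1/2)
  have hd : HasDerivAt ζ (deriv ζ (1/2 * Real.log (‖x‖ ^ 2))) (1/2 * Real.log (‖x‖ ^ 2)) :=
    (hζ.differentiable (by simp) _).hasDerivAt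
  have h3 := hd.comp_hasFDerivAt x h2
  rw [h0]
  have h4 := h3.fderiv
  have h5 : (ζ ∘ fun y : Eu n => 1/2 * Real.log (‖y‖ ^ 2)) = fun x : Eu n => ζ (1/2 * Real.log (‖x‖ ^ 2)) := rfl
  rw [h5] at h4
  rw [h4]
  have h6 : 1/2 * Real.log (‖x‖ ^ 2) = Real.log ‖x‖ := by rw [Real.log_pow]; push_cast; ring
  rw [h6]
  simp
  left
  field_simp

lemma inner_rotA (i j : Fin n) (x : Eu n) : inner ℝ x (rotA i j x) = 0 := by
  rw [rotA_apply, inner_sub_right, inner_smul_right, inner_smul_right]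
  simp [ee, EuclideanSpace.inner_single_right]
  ring

lemma diff_radial {ζ : ℝ → ℝ} (hζ : ContDiff ℝ (⊤ : ℕ∞) ζ) {x : Eu n} (hx : x ≠ 0) :
    SmAt (fun x : Eu n => ζ (Real.log ‖x‖)) x :=
  ContDiffAt.comp x hζ.contDiffAt ((contDiffAt_norm ℝ hx).log (by simpa using hx))

lemma Xo_rm {ζ : ℝ → ℝ} (hζ : ContDiff ℝ (⊤ : ℕ∞) ζ) (hζ' : ContDiff ℝ (⊤ : ℕ∞) (deriv ζ))
    (f : SS n) : Xo (rm ζ hζ f) = rm (deriv ζ) hζ' f + rm ζ hζ (Xo f) := SS.ext' fun x hx => by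
  have h1 := vf_mul (F := fun x => x) (diff_radial hζ hx).diffAt (SS.sm f hx).diffAt
  have hx2 : ‖x‖ ^ 2 ≠ 0 := by simpa using hx
  have h2 : vf (fun x => x) (fun x : Eu n => ζ (Real.log ‖x‖)) x = deriv ζ (Real.log ‖x‖) := by
    unfold vf
    rw [fderiv_radial hζ hx, real_inner_self_eq_norm_sq, div_self hx2, mul_one]
  rw [h2] at h1
  show vf (fun x => x) ((fun x : Eu n => ζ (Real.log ‖x‖)) * f.1) x = _
  rw [h1, add_comm]; rfl

lemma Ro_rm {ζ : ℝ → ℝ} (hζ : ContDiff ℝ (⊤ : ℕ∞) ζ) (i j : Fin n)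
    (f : SS n) : Ro i j (rm ζ hζ f) = rm ζ hζ (Ro i j f) := SS.ext' fun x hx => by
  have h1 := vf_mul (F := fun x => rotA i j x) (diff_radial hζ hx).diffAt (SS.sm f hx).diffAt
  have h2 : vf (fun x => rotA i j x) (fun x : Eu n => ζ (Real.log ‖x‖)) x = 0 := by
    unfold vf
    rw [fderiv_radial hζ hx, inner_rotA]; simp
  rw [h2] at h1
  show vf (fun x => rotA i j x) ((fun x : Eu n => ζ (Real.log ‖x‖)) * f.1) x = _
  rw [h1, zero_mul, add_zero]; rfl

/-- the operator `D = X + n/2` -/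
def Do : SS n →ₗ[ℝ] SS n := Xo + ((n : ℝ) / 2) • LinearMap.id

/-- `Mu = - 1/2 ∑ R_ij²` -/
def Mu : SS n →ₗ[ℝ] SS n := (-(1/2 : ℝ)) • ∑ i, ∑ j, (Ro i j) ∘ₗ (Ro i j)

lemma Mu_eq (f : SS n) : Mu f = (-(1/2 : ℝ)) • ∑ i, ∑ j, Ro i j (Ro i j f) := by
  simp [Mu, LinearMap.sum_apply]

lemma Do_eq (f : SS n) : Do f = Xo f + ((n : ℝ) / 2) • f := rfl

lemma Do_Ro (i j : Fin n) (f : SS n) : Do (Ro i j f) = Ro i j (Do f) := by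
  simp [Do_eq, Xo_Ro]

lemma Do_Mu (f : SS n) : Do (Mu f) = Mu (Do f) := by
  simp only [Mu_eq, map_smul, map_sum, Do_Ro]

lemma Mu_rm {ζ : ℝ → ℝ} (hζ : ContDiff ℝ (⊤ : ℕ∞) ζ) (f : SS n) :
    Mu (rm ζ hζ f) = rm ζ hζ (Mu f) := by
  simp only [Mu_eq, map_smul, map_sum, Ro_rm]

lemma Do_rm {ζ : ℝ → ℝ} (hζ : ContDiff ℝ (⊤ : ℕ∞) ζ) (hζ' : ContDiff ℝ (⊤ : ℕ∞) (deriv ζ))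
    (f : SS n) : Do (rm ζ hζ f) = rm (deriv ζ) hζ' f + rm ζ hζ (Do f) := by
  simp [Do_eq, Xo_rm hζ hζ', add_assoc]

def rmW (ζ : Wc) : SS n →ₗ[ℝ] SS n := rm ζ.1 ζ.2.1

lemma rmW_ap (ζ : Wc) (f : SS n) (x : Eu n) :
    (rmW ζ f).1 x = ζ.1 (Real.log ‖x‖) * f.1 x := rfl

lemma Do_rmW (ζ : Wc) (f : SS n) : Do (rmW ζ f) = rmW (dW ζ) f + rmW ζ (Do f) :=
  Do_rm _ _ f
lemma Mu_rmW (ζ : Wc) (f : SS n) : Mu (rmW ζ f) = rmW ζ (Mu f) := Mu_rm _ _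
lemma rmW_mul (ζ ξ : Wc) (f g : SS n) : rmW ζ f * rmW ξ g = rmW (ζ * ξ) (f * g) :=
  SS.ext' fun x _ => by simp [rmW_ap]; ring

/-- powers of `r` -/
def rp (c : ℝ) : SS n →ₗ[ℝ] SS n := rm (fun t => Real.exp (c * t)) (by fun_prop)

lemma rp_ap (c : ℝ) (f : SS n) {x : Eu n} (hx : x ≠ 0) : (rp c f).1 x = ‖x‖ ^ c * f.1 x := by
  have : 0 < ‖x‖ := norm_pos_iff.2 hx
  rw [Real.rpow_def_of_pos this, mul_comm (Real.log _)]; rfl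

lemma rp_rp (c d : ℝ) (f : SS n) : rp c (rp d f) = rp (c + d) f := SS.ext' fun x hx => by
  have : 0 < ‖x‖ := norm_pos_iff.2 hx
  rw [rp_ap _ _ hx, rp_ap _ _ hx, rp_ap _ _ hx, Real.rpow_add this, mul_assoc]

lemma rp_zero (f : SS n) : rp 0 f = f := SS.ext' fun x hx => by
  rw [rp_ap _ _ hx]; simp

lemma Do_rp (c : ℝ) (f : SS n) : Do (rp c f) = rp c (c • f + Do f) := by
  have hd : deriv (fun t => Real.exp (c * t)) = fun t => c * Real.exp (c * t) := by
    funext t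
    rw [deriv_exp (by fun_prop), deriv_const_mul _ (by fun_prop)]; simp [mul_comm]
  have h1 : ContDiff ℝ (⊤ : ℕ∞) (deriv (fun t => Real.exp (c * t))) := by
    rw [hd]; fun_prop
  have := Do_rm (ζ := fun t => Real.exp (c * t)) (by fun_prop) h1 f
  rw [rp, this, map_add]
  congr 1
  refine SS.ext' fun x hx => ?_
  rw [rm_ap, rm_ap, hd]
  simp; ring

lemma Mu_rp (c : ℝ) (f : SS n) : Mu (rp c f) = rp c (Mu f) := Mu_rm _ _

lemma rp_rmW (c : ℝ) (ζ : Wc) (f : SS n) : rp c (rmW ζ f) = rmW ζ (rp c f) :=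
  SS.ext' fun x hx => by simp only [rp_ap _ _ hx, rmW_ap]; ring

/-- the Laplacian on SS -/
def Lo : SS n →ₗ[ℝ] SS n := rp (-2) ∘ₗ (Xo ∘ₗ Xo + ((n : ℝ) - 2) • Xo - Mu)

lemma Lo_eq (f : SS n) : Lo f = rp (-2) (Xo (Xo f) + ((n : ℝ) - 2) • Xo f - Mu f) := rfl

lemma Lo_ap (f : SS n) {x : Eu n} (hx : x ≠ 0) : (Lo f).1 x = laplacian f.1 x := by
  have hx2 : 0 < ‖x‖ := norm_pos_iff.2 hx
  have h := rsq_laplacian (SS.sm f hx)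
  rw [Lo_eq, rp_ap _ _ hx]
  have h3 : (Xo (Xo f) + ((n : ℝ) - 2) • Xo f - Mu f).1 x = ‖x‖ ^ 2 * laplacian f.1 x := by
    rw [h, Mu_eq]
    simp only [SS.add_ap, SS.sub_ap, SS.smul_ap, SS.sum_ap]
    simp only [Xo_ap, Ro_ap]
    have h4 : XX (Xo f).1 x = XX (XX f.1) x := rfl
    have h5 : ∀ i j : Fin n, RR i j (Ro i j f).1 x = RR i j (RR i j f.1) x := fun i j => rfl
    simp only [h4, h5]
    ring
  rw [h3, Real.rpow_neg hx2.le]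
  have : ‖x‖ ^ (2:ℝ) = ‖x‖ ^ 2 := by norm_cast
  rw [this, ← mul_assoc, inv_mul_cancel₀ (by positivity), one_mul]

/-- `B - (D + c - 1)²` -/
def Bop (c : ℝ) (f : SS n) : SS n :=
  ((n : ℝ) / 2 - 1) ^ 2 • f + Mu f - (Do (Do f) + (2 * (c - 1)) • Do f + (c - 1) ^ 2 • f)

lemma Lo_rp (c : ℝ) (f : SS n) : Lo (rp c f) = - rp (c - 2) (Bop c f) := by
  have hX : ∀ g : SS n, Xo g = Do g - ((n : ℝ) / 2) • g := fun g => by rw [Do_eq]; module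
  have h0 : Lo (rp c f) = rp (-2) (rp c (-Bop c f)) := by
    rw [Lo_eq]
    congr 1
    simp only [hX, map_sub, map_smul, Do_rp, Mu_rp, map_add, Bop, map_neg]
    module
  rw [h0, rp_rp, map_neg]
  congr 3; ring

lemma Lo3_rp (c : ℝ) (f : SS n) :
    Lo (Lo (Lo (rp c f))) = - rp (c - 6) (Bop (c - 4) (Bop (c - 2) (Bop c f))) := by
  rw [Lo_rp, map_neg, Lo_rp, neg_neg, Lo_rp]
  rw [show c - 2 - 2 - 2 = c - 6 by ring, show c - 2 - 2 = c - 4 by ring]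

end TH

namespace TH
variable {n : ℕ}
set_option maxHeartbeats 4000000 in
lemma Tform (h A : ℝ) (hA : A = (n : ℝ) / 2 - 1) (f : SS n) :
    Bop (h + 3 - 4) (Bop (h + 3 - 2) (Bop (h + 3) f)) =
      (Mu (Mu (Mu f)) + (3*A^2 - 8 - 3*h^2) • Mu (Mu f)
        + (3*A^4 - 16*A^2 + 16 - 6*A^2*h^2 + 3*h^4) • Mu f
        + (A^2*(A^2-4)^2 - (3*A^4+16)*h^2 + (3*A^2+8)*h^4 - h^6) • f)
      + ((-6*h) • Mu (Mu (Do f)) + (-12*A^2*h + 12*h^3) • Mu (Do f)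
        + (-2*(3*A^4+16)*h + 4*(3*A^2+8)*h^3 - 6*h^5) • Do f)
      + ((-3 : ℝ) • Mu (Mu (Do (Do f))) + (-6*A^2 + 18*h^2) • Mu (Do (Do f))
        + (-(3*A^4+16) + 6*(3*A^2+8)*h^2 - 15*h^4) • Do (Do f))
      + ((12*h) • Mu (Do (Do (Do f))) + (4*(3*A^2+8)*h - 20*h^3) • Do (Do (Do f)))
      + ((3:ℝ) • Mu (Do (Do (Do (Do f)))) + (3*A^2+8 - 15*h^2) • Do (Do (Do (Do f))))
      + (-6*h) • Do (Do (Do (Do (Do f)))) - Do (Do (Do (Do (Do (Do f))))) := by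
  unfold Bop
  rw [← hA]
  simp only [map_add, map_sub, map_smul, Do_Mu]
  module

lemma Wc.bdd (ζ : Wc) : ∃ R : ℝ, 0 < R ∧ ∀ t, R ≤ |t| → ζ.1 t = 0 := by
  obtain ⟨R, h1, h2⟩ := ζ.2.2.exists_pos_le_norm
  exact ⟨R, h1, fun t ht => h2 t (by simpa using ht)⟩

lemma rmW_near_zero (ζ : Wc) (f : SS n) : (rmW ζ f).1 =ᶠ[nhds 0] fun _ => 0 := by
  obtain ⟨R, hR, h⟩ := Wc.bdd ζ
  filter_upwards [Metric.ball_mem_nhds (0 : Eu n) (Real.exp_pos (-R))] with x hx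
  rw [rmW_ap]
  by_cases hx0 : x = 0
  · rw [hx0, SS.zero f, mul_zero]
  · have h1 : ‖x‖ < Real.exp (-R) := by simpa using hx
    have h2 : Real.log ‖x‖ < -R := by
      rw [Real.log_lt_iff_lt_exp (norm_pos_iff.2 hx0)]; exact h1
    rw [h _ (by rw [abs_of_neg (by linarith)]; linarith), zero_mul]

lemma rmW_smooth (ζ : Wc) (f : SS n) : Smooth (rmW ζ f).1 := by
  refine contDiff_iff_contDiffAt.2 fun x => ?_
  by_cases hx : x = 0
  · rw [hx]
    exact contDiffAt_const.congr_of_eventuallyEq (rmW_near_zero ζ f)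
  · exact SS.sm _ hx

lemma rmW_supp (ζ : Wc) (f : SS n) : HasCompactSupport (rmW ζ f).1 := by
  obtain ⟨R, hR, h⟩ := Wc.bdd ζ
  refine HasCompactSupport.of_support_subset_isCompact
    (isCompact_closedBall (0 : Eu n) (Real.exp R)) ?_
  intro x hx
  rw [Function.mem_support, rmW_ap] at hx
  have hx0 : x ≠ 0 := by rintro rfl; simp [SS.zero f] at hx
  have h1 : ζ.1 (Real.log ‖x‖) ≠ 0 := left_ne_zero_of_mul hx
  by_contra h2
  apply h1
  apply h
  have h3 : Real.exp R < ‖x‖ := by simpa using h2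
  have h4 : R < Real.log ‖x‖ := by rwa [Real.lt_log_iff_exp_lt (norm_pos_iff.2 hx0)]
  exact h4.le.trans (le_abs_self _)

lemma rmW_int (ζ : Wc) (f : SS n) : Integrable (rmW ζ f).1 :=
  (rmW_smooth ζ f).continuous.integrable_of_hasCompactSupport (rmW_supp ζ f)

lemma rmW_add_left (ζ ξ : Wc) (f : SS n) : rmW (ζ + ξ) f = rmW ζ f + rmW ξ f :=
  SS.ext' fun x _ => by simp [rmW_ap]; ring

lemma rmW_smul_left (c : ℝ) (ζ : Wc) (f : SS n) : rmW (c • ζ) f = c • rmW ζ f :=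
  SS.ext' fun x _ => by simp [rmW_ap]; ring

/-- weighted integral -/
def J : SS n →ₗ[ℝ] Wc →ₗ[ℝ] ℝ :=
  LinearMap.mk₂ ℝ (fun f ζ => ∫ x, (rmW ζ f).1 x)
    (fun f g ζ => by
      rw [map_add]; exact integral_add (rmW_int ζ f) (rmW_int ζ g))
    (fun c f ζ => by
      rw [map_smul]; exact integral_const_mul c _)
    (fun f ζ ξ => by
      rw [rmW_add_left]; exact integral_add (rmW_int ζ f) (rmW_int ξ f))
    (fun c f ζ => by
      rw [rmW_smul_left]; exact integral_const_mul c _)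

lemma J_ap (f : SS n) (ζ : Wc) : J f ζ = ∫ x, (rmW ζ f).1 x := rfl

lemma J_mono {f g : SS n} {ζ ξ : Wc}
    (h : ∀ x : Eu n, ζ.1 (Real.log ‖x‖) * f.1 x ≤ ξ.1 (Real.log ‖x‖) * g.1 x) : J f ζ ≤ J g ξ :=
  integral_mono (rmW_int ζ f) (rmW_int ξ g) h

lemma J_Xo (f : SS n) (ζ : Wc) : J (Xo f) ζ + n * J f ζ = - J f (dW ζ) := by
  have h1 := integral_XX ((rmW_smooth ζ f).of_le (by exact_mod_cast le_top)) (rmW_supp ζ f)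
  have h2 : ∀ x, XX (rmW ζ f).1 x = (rmW (dW ζ) f).1 x + (rmW ζ (Xo f)).1 x := fun x => by
    rw [← SS.add_ap, ← Xo_ap]
    have := Xo_rm ζ.2.1 (dW ζ).2.1 f
    exact congrArg (fun g : SS n => g.1 x) this
  simp_rw [h2] at h1
  rw [integral_add (rmW_int _ _) (rmW_int _ _)] at h1
  simp only [J_ap]
  linarith

lemma J_Ro (i j : Fin n) (f : SS n) (ζ : Wc) : J (Ro i j f) ζ = 0 := by
  have h1 := integral_RR i j ((rmW_smooth ζ f).of_le (by exact_mod_cast le_top)) (rmW_supp ζ f)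
  have h2 : ∀ x, RR i j (rmW ζ f).1 x = (rmW ζ (Ro i j f)).1 x := fun x => by
    rw [← Ro_ap]
    exact congrArg (fun g : SS n => g.1 x) (Ro_rm ζ.2.1 i j f)
  simp_rw [h2] at h1
  exact h1

lemma Xo_mul (f g : SS n) : Xo (f * g) = f * Xo g + Xo f * g := vfS_mul _ f g
lemma Ro_mul (i j : Fin n) (f g : SS n) : Ro i j (f * g) = f * Ro i j g + Ro i j f * g :=
  vfS_mul _ f g

lemma Do_mul (f g : SS n) : Xo (f * g) + (n : ℝ) • (f * g) = Do f * g + f * Do g := by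
  rw [Xo_mul, Do_eq, Do_eq]
  refine SS.ext' fun x _ => ?_
  simp; ring

lemma J_Do (f g : SS n) (ζ : Wc) : J (Do f * g) ζ + J (f * Do g) ζ = - J (f * g) (dW ζ) := by
  rw [← J_Xo, ← LinearMap.add_apply, ← map_add, ← Do_mul]
  simp

/-- the Γ pairing -/
def Q1 (f g : SS n) : Wc →ₗ[ℝ] ℝ := (1/2 : ℝ) • ∑ i, ∑ j, J (Ro i j f * Ro i j g)

lemma Q1_ap (f g : SS n) (ζ : Wc) : Q1 f g ζ = (1/2 : ℝ) * ∑ i, ∑ j, J (Ro i j f * Ro i j g) ζ := by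
  simp [Q1, LinearMap.sum_apply]

lemma Q1_symm (f g : SS n) : Q1 f g = Q1 g f := by
  simp only [Q1, mul_comm]

lemma Q1_Do (f g : SS n) (ζ : Wc) : Q1 (Do f) g ζ + Q1 f (Do g) ζ = - Q1 f g (dW ζ) := by
  simp only [Q1_ap, ← Do_Ro]
  rw [← mul_add, ← Finset.sum_add_distrib]
  simp only [← Finset.sum_add_distrib, J_Do]
  simp

lemma J_Mu (f g : SS n) (ζ : Wc) : J (f * Mu g) ζ = Q1 f g ζ := by
  rw [Q1_ap, Mu_eq]
  have h : ∀ i j : Fin n, J (Ro i j f * Ro i j g) ζ = - J (f * Ro i j (Ro i j g)) ζ := by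
    intro i j
    have := J_Ro i j (f * Ro i j g) ζ
    rw [Ro_mul, map_add, LinearMap.add_apply] at this
    linarith
  simp only [h]
  rw [mul_smul_comm, Finset.mul_sum]
  simp only [Finset.mul_sum, map_sum, map_smul, LinearMap.smul_apply, LinearMap.sum_apply,
    Finset.sum_neg_distrib, smul_eq_mul]
  simp only [← Finset.mul_sum]
  ring

lemma J_Mu2 (f g : SS n) (ζ : Wc) : J (f * Mu (Mu g)) ζ = J (Mu f * Mu g) ζ := by
  rw [J_Mu, Q1_symm, ← J_Mu, mul_comm]

lemma J_Mu3 (f g : SS n) (ζ : Wc) : J (f * Mu (Mu (Mu g))) ζ = Q1 (Mu f) (Mu g) ζ := by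
  rw [J_Mu2, J_Mu]

lemma J_pos (f : SS n) {ζ : Wc} (h : ∀ t, 0 ≤ ζ.1 t) : 0 ≤ J (f * f) ζ := by
  refine integral_nonneg fun x => ?_
  rw [rmW_ap, SS.mul_ap]
  exact mul_nonneg (h _) (mul_self_nonneg _)

lemma Q1_pos (f : SS n) {ζ : Wc} (h : ∀ t, 0 ≤ ζ.1 t) : 0 ≤ Q1 f f ζ := by
  rw [Q1_ap]
  exact mul_nonneg (by norm_num) (Finset.sum_nonneg fun i _ => Finset.sum_nonneg fun j _ =>
    J_pos _ h)

lemma amgm {ε : ℝ} (hε : 0 < ε) (a b : ℝ) : a * b ≤ ε * a ^ 2 + (1 / (4 * ε)) * b ^ 2 := by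
  have : ε * a ^ 2 + (1 / (4 * ε)) * b ^ 2 - a * b = (1 / (4 * ε)) * (2 * ε * a - b) ^ 2 := by
    field_simp; ring
  have h2 : 0 ≤ (1 / (4 * ε)) * (2 * ε * a - b) ^ 2 := by positivity
  linarith

lemma J_amgm {ε : ℝ} (hε : 0 < ε) (f g : SS n) (ζ ξ : Wc) :
    J (f * g) (ζ * ξ) ≤ ε * J (f * f) (ζ * ζ) + (1 / (4 * ε)) * J (g * g) (ξ * ξ) := by
  have h1 : ε * J (f * f) (ζ * ζ) + (1 / (4 * ε)) * J (g * g) (ξ * ξ)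
      = ∫ x, (ε • rmW (ζ * ζ) (f * f) + (1 / (4 * ε)) • rmW (ξ * ξ) (g * g)).1 x := by
    simp only [SS.add_ap, SS.smul_ap]
    rw [integral_add ((rmW_int _ _).const_mul _) ((rmW_int _ _).const_mul _),
      integral_const_mul, integral_const_mul]
    rfl
  rw [h1]
  refine integral_mono (rmW_int _ _) ?_ fun x => ?_
  · exact ((rmW_int _ _).const_mul _).add ((rmW_int _ _).const_mul _)
  · simp only [SS.add_ap, SS.smul_ap, rmW_ap, SS.mul_ap, Wc.mul_ap]
    have := amgm hε (ζ.1 (Real.log ‖x‖) * f.1 x) (ξ.1 (Real.log ‖x‖) * g.1 x)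
    nlinarith [this]

lemma Q1_amgm {ε : ℝ} (hε : 0 < ε) (f g : SS n) (ζ ξ : Wc) :
    Q1 f g (ζ * ξ) ≤ ε * Q1 f f (ζ * ζ) + (1 / (4 * ε)) * Q1 g g (ξ * ξ) := by
  simp only [Q1_ap]
  have : ∑ i, ∑ j, J (Ro i j f * Ro i j g) (ζ * ξ) ≤
    ∑ i, ∑ j, (ε * J (Ro i j f * Ro i j f) (ζ * ζ)
      + (1 / (4 * ε)) * J (Ro i j g * Ro i j g) (ξ * ξ)) :=
    Finset.sum_le_sum fun i _ => Finset.sum_le_sum fun j _ => J_amgm hε _ _ _ _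
  simp only [Finset.sum_add_distrib, ← Finset.mul_sum] at this
  linarith

/-- `Mj j f g` is the pairing `⟨ζ f, Mu^j g⟩` -/
def Mj (j : ℕ) (f g : SS n) : Wc →ₗ[ℝ] ℝ :=
  match j with
  | 0 => J (f * g)
  | 1 => Q1 f g
  | 2 => J (Mu f * Mu g)
  | _ => Q1 (Mu f) (Mu g)

lemma Mj_symm (j : ℕ) (f g : SS n) : Mj j f g = Mj j g f := by
  match j with
  | 0 => simp only [Mj, mul_comm]
  | 1 => exact Q1_symm _ _
  | 2 => simp only [Mj, mul_comm]
  | (k+3) => exact Q1_symm _ _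

lemma Mj_ibp (j : ℕ) (f g : SS n) (ζ : Wc) :
    Mj j (Do f) g ζ + Mj j f (Do g) ζ = - Mj j f g (dW ζ) := by
  match j with
  | 0 => exact J_Do _ _ _
  | 1 => exact Q1_Do _ _ _
  | 2 => simp only [Mj, ← Do_Mu]; exact J_Do _ _ _
  | (k+3) => simp only [Mj, ← Do_Mu]; exact Q1_Do _ _ _

lemma Mj_pos (j : ℕ) (f : SS n) {ζ : Wc} (h : ∀ t, 0 ≤ ζ.1 t) : 0 ≤ Mj j f f ζ := by
  match j with
  | 0 => exact J_pos _ h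
  | 1 => exact Q1_pos _ h
  | 2 => exact J_pos _ h
  | (k+3) => exact Q1_pos _ h

/-! ### Green formula for test functions -/

lemma lap_supp {f : Eu n → ℝ} (hc : HasCompactSupport f) : HasCompactSupport (laplacian f) := by
  have : laplacian f = fun x => ∑ i, fderiv ℝ (fderiv ℝ f) x (ee i) (ee i) :=
    funext (laplacian_eq f)
  rw [this]
  have h2 : HasCompactSupport (fderiv ℝ (fderiv ℝ f)) := (hc.fderiv ℝ).fderiv ℝ
  refine h2.mono' ?_
  refine subset_trans ?_ (subset_tsupport _)
  intro x hx
  rw [Function.mem_support] at hx ⊢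
  intro h0
  apply hx
  simp [h0]

lemma Smooth.pd {f : Eu n → ℝ} (hf : Smooth f) (v : Eu n) : Smooth (fun x => fderiv ℝ f x v) :=
  (hf.fderiv_right (by simp)).clm_apply contDiff_const

lemma int_of {f : Eu n → ℝ} (hf : Smooth f) (hc : HasCompactSupport f) : Integrable f :=
  hf.continuous.integrable_of_hasCompactSupport hc

lemma pd_ibp {f g : Eu n → ℝ} (hf : Smooth f) (hg : Smooth g) (hc : HasCompactSupport g)
    (v : Eu n) : ∫ x, f x * fderiv ℝ g x v = - ∫ x, fderiv ℝ f x v * g x := by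
  have h0 := integral_pd_zero (f := fun x => f x * g x)
    ((hf.mul hg).of_le (by exact_mod_cast le_top)) hc.mul_left v
  have h1 : ∀ x, fderiv ℝ (fun x => f x * g x) x v
      = f x * fderiv ℝ g x v + fderiv ℝ f x v * g x := by
    intro x
    rw [fderiv_fun_mul (hf.diff x) (hg.diff x)]
    simp [mul_comm]
  simp_rw [h1] at h0
  rw [integral_add] at h0
  · linarith
  · exact int_of (hf.mul (hg.pd v)) ((hc.fderiv_apply (𝕜 := ℝ) v).mul_left)
  · exact int_of ((hf.pd v).mul hg) hc.mul_left

lemma laplacian_eq' {f : Eu n → ℝ} (hf : Smooth f) (x : Eu n) :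
    laplacian f x = ∑ i, fderiv ℝ (fun y => fderiv ℝ f y (ee i)) x (ee i) := by
  rw [laplacian_eq]
  refine Finset.sum_congr rfl fun i _ => ?_
  have h2 : DifferentiableAt ℝ (fderiv ℝ f) x :=
    (hf.fderiv_right (m := (⊤ : ℕ∞)) (by simp)).differentiable (by simp) x
  rw [fderiv_clm_apply h2 (differentiableAt_const _)]
  simp

lemma green {f g : Eu n → ℝ} (hf : Smooth f) (hg : Smooth g) (hc : HasCompactSupport g) :
    ∫ x, f x * laplacian g x = - ∫ x, ∑ i, fderiv ℝ f x (ee i) * fderiv ℝ g x (ee i) := by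
  simp_rw [laplacian_eq' hg, Finset.mul_sum]
  rw [integral_finsetSum, integral_finsetSum, ← Finset.sum_neg_distrib]
  · exact Finset.sum_congr rfl fun i _ => pd_ibp hf (hg.pd _) (hc.fderiv_apply (𝕜 := ℝ) _) _
  · intro i _
    exact int_of ((hf.pd _).mul (hg.pd _)) ((hc.fderiv_apply (𝕜 := ℝ) _).mul_left)
  · intro i _
    exact int_of (hf.mul ((hg.pd _).pd _))
      (((hc.fderiv_apply (𝕜 := ℝ) _).fderiv_apply (𝕜 := ℝ) _).mul_left)

lemma green2 {f g : Eu n → ℝ} (hf : Smooth f) (hg : Smooth g) (hcf : HasCompactSupport f)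
    (hc : HasCompactSupport g) :
    ∫ x, f x * laplacian g x = ∫ x, laplacian f x * g x := by
  rw [green hf hg hc]
  have := green hg hf hcf
  simp_rw [mul_comm (laplacian f _)]
  rw [this]
  simp_rw [mul_comm]

lemma inner_ee (y : Eu n) (i : Fin n) : inner ℝ y (ee i) = y i := by
  simp [ee, EuclideanSpace.inner_single_right]

lemma energy {φ : Eu n → ℝ} (hf : Smooth φ) (hc : HasCompactSupport φ) :
    ∫ x, ‖gradient (laplacian φ) x‖ ^ 2
      = - ∫ x, φ x * laplacian (laplacian (laplacian φ)) x := by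
  have h1 := laplacian_smooth hf
  have c1 := lap_supp hc
  have h2 := laplacian_smooth h1
  have c2 := lap_supp c1
  rw [green2 hf h2 hc c2, green h1 h1 c1, neg_neg]
  congr 1
  funext x
  rw [EuclideanSpace.real_norm_sq_eq]
  refine Finset.sum_congr rfl fun i _ => ?_
  have : (gradient (laplacian φ) x) i = fderiv ℝ (laplacian φ) x (ee i) := by
    have h3 : inner ℝ (gradient (laplacian φ) x) (ee i) = fderiv ℝ (laplacian φ) x (ee i) := by
      rw [gradient]; simp
    rw [← h3, inner_ee]
  rw [this]; ring

end TH

namespace TH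

/-- abstract system of quadratic quantities -/
structure Sys (p h A T : ℝ) where
  M : ℕ → ℕ → ℕ → Wc →ₗ[ℝ] ℝ
  N : Wc →ₗ[ℝ] ℝ
  symm : ∀ j a b, M j a b = M j b a
  ibp : ∀ j a b ζ, M j (a+1) b ζ + M j a (b+1) ζ = - M j a b (dW ζ)
  pos : ∀ j a (ζ : Wc), (∀ t, 0 ≤ ζ.1 t) → 0 ≤ M j a a ζ
  Npos : ∀ (ζ : Wc), (∀ t, 0 ≤ ζ.1 t) → 0 ≤ N ζ
  am0 : ∀ a b (ε : ℝ), 0 < ε → ∀ ζ ξ : Wc, -(M 0 a b (ζ * ξ))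
    ≤ ε * M 0 b b (ζ * ζ) + (1 / (4 * ε)) * M 0 a a (ξ * ξ)
  in1 : ∀ a (ε : ℝ), 0 < ε → ∀ ζ ξ : Wc, M 1 a a (ζ * ξ)
    ≤ ε * M 2 a a (ζ * ζ) + (1 / (4 * ε)) * M 0 a a (ξ * ξ)
  in2 : ∀ a (ε : ℝ), 0 < ε → ∀ ζ ξ : Wc, M 2 a a (ζ * ξ)
    ≤ ε * M 3 a a (ζ * ζ) + (1 / (4 * ε)) * M 1 a a (ξ * ξ)
  eq0 : ∀ ζ, M 3 0 0 ζ + (3*A^2 - 8 - 3*h^2) * M 2 0 0 ζ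
        + (3*A^4 - 16*A^2 + 16 - 6*A^2*h^2 + 3*h^4) * M 1 0 0 ζ
        + (A^2*(A^2-4)^2 - (3*A^4+16)*h^2 + (3*A^2+8)*h^4 - h^6) * M 0 0 0 ζ
      + ((-6*h) * M 2 0 1 ζ + (-12*A^2*h + 12*h^3) * M 1 0 1 ζ
        + (-2*(3*A^4+16)*h + 4*(3*A^2+8)*h^3 - 6*h^5) * M 0 0 1 ζ)
      + ((-3) * M 2 0 2 ζ + (-6*A^2 + 18*h^2) * M 1 0 2 ζ
        + (-(3*A^4+16) + 6*(3*A^2+8)*h^2 - 15*h^4) * M 0 0 2 ζ)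
      + ((12*h) * M 1 0 3 ζ + (4*(3*A^2+8)*h - 20*h^3) * M 0 0 3 ζ)
      + (3 * M 1 0 4 ζ + (3*A^2+8 - 15*h^2) * M 0 0 4 ζ)
      + (-6*h) * M 0 0 5 ζ - M 0 0 6 ζ = N ζ
  eq1 : ∀ ζ, M 3 1 0 ζ + (3*A^2 - 8 - 3*h^2) * M 2 1 0 ζ
        + (3*A^4 - 16*A^2 + 16 - 6*A^2*h^2 + 3*h^4) * M 1 1 0 ζ
        + (A^2*(A^2-4)^2 - (3*A^4+16)*h^2 + (3*A^2+8)*h^4 - h^6) * M 0 1 0 ζ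
      + ((-6*h) * M 2 1 1 ζ + (-12*A^2*h + 12*h^3) * M 1 1 1 ζ
        + (-2*(3*A^4+16)*h + 4*(3*A^2+8)*h^3 - 6*h^5) * M 0 1 1 ζ)
      + ((-3) * M 2 1 2 ζ + (-6*A^2 + 18*h^2) * M 1 1 2 ζ
        + (-(3*A^4+16) + 6*(3*A^2+8)*h^2 - 15*h^4) * M 0 1 2 ζ)
      + ((12*h) * M 1 1 3 ζ + (4*(3*A^2+8)*h - 20*h^3) * M 0 1 3 ζ)
      + (3 * M 1 1 4 ζ + (3*A^2+8 - 15*h^2) * M 0 1 4 ζ)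
      + (-6*h) * M 0 1 5 ζ - M 0 1 6 ζ = - N (dW ζ) / (p + 1)
  stab : ∀ ζ : Wc, (∀ t, T ≤ t → ζ.1 t = 0) → p * N (ζ * ζ) ≤
        M 3 0 0 (ζ * ζ) + (3*A^2 - 8) * M 2 0 0 (ζ * ζ)
        + (3*A^4 - 16*A^2 + 16) * M 1 0 0 (ζ * ζ) + (A^2*(A^2-4)^2) * M 0 0 0 (ζ * ζ)
        + ((-3) * (M 2 0 2 (ζ * ζ) + 2 * M 2 0 1 (ζ * dW ζ) + M 2 0 0 (ζ * dW (dW ζ)))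
          + (-6*A^2) * (M 1 0 2 (ζ * ζ) + 2 * M 1 0 1 (ζ * dW ζ) + M 1 0 0 (ζ * dW (dW ζ)))
          + (-(3*A^4+16)) * (M 0 0 2 (ζ * ζ) + 2 * M 0 0 1 (ζ * dW ζ)
              + M 0 0 0 (ζ * dW (dW ζ))))
        + (3 * (M 1 0 4 (ζ * ζ) + 4 * M 1 0 3 (ζ * dW ζ) + 6 * M 1 0 2 (ζ * dW (dW ζ))
              + 4 * M 1 0 1 (ζ * dW (dW (dW ζ))) + M 1 0 0 (ζ * dW (dW (dW (dW ζ)))))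
          + (3*A^2+8) * (M 0 0 4 (ζ * ζ) + 4 * M 0 0 3 (ζ * dW ζ) + 6 * M 0 0 2 (ζ * dW (dW ζ))
              + 4 * M 0 0 1 (ζ * dW (dW (dW ζ))) + M 0 0 0 (ζ * dW (dW (dW (dW ζ))))))
        - (M 0 0 6 (ζ * ζ) + 6 * M 0 0 5 (ζ * dW ζ) + 15 * M 0 0 4 (ζ * dW (dW ζ))
              + 20 * M 0 0 3 (ζ * dW (dW (dW ζ))) + 15 * M 0 0 2 (ζ * dW (dW (dW (dW ζ))))
              + 6 * M 0 0 1 (ζ * dW (dW (dW (dW (dW ζ)))))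
              + M 0 0 0 (ζ * dW (dW (dW (dW (dW (dW ζ)))))))

lemma leib : ∀ (l : ℕ) (ζ ξ : Wc) (t K : ℝ),
    (∀ i i', i + i' = l → |(dW^[i] ζ).1 t * (dW^[i'] ξ).1 t| ≤ K) →
    |(dW^[l] (ζ * ξ)).1 t| ≤ 2 ^ l * K := by
  intro l
  induction l with
  | zero => intro ζ ξ t K h; simpa using h 0 0 rfl
  | succ l ih =>
    intro ζ ξ t K h
    rw [Function.iterate_succ_apply, dW_mul, iterate_map_add]
    have h1 := ih (dW ζ) ξ t K fun i i' hi => by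
      have := h (i+1) i' (by omega)
      rwa [Function.iterate_succ_apply] at this
    have h2 := ih ζ (dW ξ) t K fun i i' hi => by
      have := h i (i'+1) (by omega)
      rwa [Function.iterate_succ_apply] at this
    rw [Wc.add_ap]
    calc _ ≤ _ := abs_add_le _ _
      _ ≤ 2 ^ l * K + 2 ^ l * K := add_le_add h1 h2
      _ = 2 ^ (l+1) * K := by ring

namespace Sys
variable {p h A T : ℝ} (S : Sys p h A T)

lemma mono {j a : ℕ} {ζ ξ : Wc} (hh : ∀ t, ζ.1 t ≤ ξ.1 t) : S.M j a a ζ ≤ S.M j a a ξ := by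
  have := S.pos j a (ξ - ζ) fun t => by simp [hh t]
  rw [map_sub] at this; linarith

lemma bd {j a : ℕ} {ζ ξ : Wc} {c : ℝ} (hh : ∀ t, |ζ.1 t| ≤ c * ξ.1 t) :
    |S.M j a a ζ| ≤ c * S.M j a a ξ := by
  have h1 : S.M j a a ζ ≤ S.M j a a (c • ξ) := S.mono fun t => by
    simpa using (abs_le.1 (hh t)).2
  have h2 : S.M j a a ((-1 : ℝ) • ζ) ≤ S.M j a a (c • ξ) := S.mono fun t => by
    have := (abs_le.1 (hh t)).1
    simp; linarith
  simp only [map_smul, smul_eq_mul] at h1 h2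
  rw [abs_le]; constructor <;> linarith

lemma Nbd {ζ ξ : Wc} {c : ℝ} (hh : ∀ t, |ζ.1 t| ≤ c * ξ.1 t) :
    |S.N ζ| ≤ c * S.N ξ := by
  have h1 := S.Npos (c • ξ - ζ) fun t => by
    have := (abs_le.1 (hh t)).2
    simp; linarith
  have h2 := S.Npos (c • ξ + ζ) fun t => by
    have := (abs_le.1 (hh t)).1
    simp; linarith
  simp only [map_smul, map_add, map_sub, smul_eq_mul] at h1 h2
  rw [abs_le]; constructor <;> linarith

lemma r01 (j : ℕ) (θ : Wc) : S.M j 0 1 θ = -(1/2) * S.M j 0 0 (dW θ) := by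
  have h1 := S.ibp j 0 0 θ
  rw [S.symm j (0+1) 0] at h1; linarith
lemma r12 (j : ℕ) (θ : Wc) : S.M j 1 2 θ = -(1/2) * S.M j 1 1 (dW θ) := by
  have h1 := S.ibp j 1 1 θ
  rw [S.symm j (1+1) 1] at h1; linarith
lemma r23 (j : ℕ) (θ : Wc) : S.M j 2 3 θ = -(1/2) * S.M j 2 2 (dW θ) := by
  have h1 := S.ibp j 2 2 θ
  rw [S.symm j (2+1) 2] at h1; linarith
lemma r34 (j : ℕ) (θ : Wc) : S.M j 3 4 θ = -(1/2) * S.M j 3 3 (dW θ) := by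
  have h1 := S.ibp j 3 3 θ
  rw [S.symm j (3+1) 3] at h1; linarith
lemma r02 (j : ℕ) (θ : Wc) : S.M j 0 2 θ = - S.M j 1 1 θ + (1/2) * S.M j 0 0 (dW (dW θ)) := by
  have h1 := S.ibp j 0 1 θ
  have h2 := S.r01 j (dW θ)
  norm_num at h1; linarith
lemma r13 (j : ℕ) (θ : Wc) : S.M j 1 3 θ = - S.M j 2 2 θ + (1/2) * S.M j 1 1 (dW (dW θ)) := by
  have h1 := S.ibp j 1 2 θ
  have h2 := S.r12 j (dW θ)
  norm_num at h1; linarith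
lemma r24 (j : ℕ) (θ : Wc) : S.M j 2 4 θ = - S.M j 3 3 θ + (1/2) * S.M j 2 2 (dW (dW θ)) := by
  have h1 := S.ibp j 2 3 θ
  have h2 := S.r23 j (dW θ)
  norm_num at h1; linarith
lemma r03 (j : ℕ) (θ : Wc) : S.M j 0 3 θ = (3/2) * S.M j 1 1 (dW θ)
    - (1/2) * S.M j 0 0 (dW (dW (dW θ))) := by
  have h1 := S.ibp j 0 2 θ
  have h2 := S.r12 j θ
  have h3 := S.r02 j (dW θ)
  norm_num at h1; linarith
lemma r14 (j : ℕ) (θ : Wc) : S.M j 1 4 θ = (3/2) * S.M j 2 2 (dW θ)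
    - (1/2) * S.M j 1 1 (dW (dW (dW θ))) := by
  have h1 := S.ibp j 1 3 θ
  have h2 := S.r23 j θ
  have h3 := S.r13 j (dW θ)
  norm_num at h1; linarith
lemma r25 (j : ℕ) (θ : Wc) : S.M j 2 5 θ = (3/2) * S.M j 3 3 (dW θ)
    - (1/2) * S.M j 2 2 (dW (dW (dW θ))) := by
  have h1 := S.ibp j 2 4 θ
  have h2 := S.r34 j θ
  have h3 := S.r24 j (dW θ)
  norm_num at h1; linarith
lemma r04 (j : ℕ) (θ : Wc) : S.M j 0 4 θ = S.M j 2 2 θ - 2 * S.M j 1 1 (dW (dW θ))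
    + (1/2) * S.M j 0 0 (dW (dW (dW (dW θ)))) := by
  have h1 := S.ibp j 0 3 θ
  have h2 := S.r13 j θ
  have h3 := S.r03 j (dW θ)
  norm_num at h1; linarith
lemma r15 (j : ℕ) (θ : Wc) : S.M j 1 5 θ = S.M j 3 3 θ - 2 * S.M j 2 2 (dW (dW θ))
    + (1/2) * S.M j 1 1 (dW (dW (dW (dW θ)))) := by
  have h1 := S.ibp j 1 4 θ
  have h2 := S.r24 j θ
  have h3 := S.r14 j (dW θ)
  norm_num at h1; linarith
lemma r05 (j : ℕ) (θ : Wc) : S.M j 0 5 θ = -(5/2) * S.M j 2 2 (dW θ)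
    + (5/2) * S.M j 1 1 (dW (dW (dW θ)))
    - (1/2) * S.M j 0 0 (dW (dW (dW (dW (dW θ))))) := by
  have h1 := S.ibp j 0 4 θ
  have h2 := S.r14 j θ
  have h3 := S.r04 j (dW θ)
  norm_num at h1; linarith
lemma r16 (j : ℕ) (θ : Wc) : S.M j 1 6 θ = -(5/2) * S.M j 3 3 (dW θ)
    + (5/2) * S.M j 2 2 (dW (dW (dW θ)))
    - (1/2) * S.M j 1 1 (dW (dW (dW (dW (dW θ))))) := by
  have h1 := S.ibp j 1 5 θ
  have h2 := S.r25 j θ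
  have h3 := S.r15 j (dW θ)
  norm_num at h1; linarith
lemma r06 (j : ℕ) (θ : Wc) : S.M j 0 6 θ = - S.M j 3 3 θ + (9/2) * S.M j 2 2 (dW (dW θ))
    - 3 * S.M j 1 1 (dW (dW (dW (dW θ))))
    + (1/2) * S.M j 0 0 (dW (dW (dW (dW (dW (dW θ)))))) := by
  have h1 := S.ibp j 0 5 θ
  have h2 := S.r15 j θ
  have h3 := S.r05 j (dW θ)
  norm_num at h1; linarith

lemma term {ζ χ : Wc} {q : ℕ}
    (hχ : ∀ l l', 1 ≤ l + l' → l + l' + 2 * q ≤ 6 → ∀ t, |(dW^[l] ζ).1 t * (dW^[l'] ζ).1 t| ≤ χ.1 t)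
    (j a l l' : ℕ) (h1 : 1 ≤ l + l') (h2 : l + l' + 2 * q ≤ 6) :
    |S.M j a a (dW^[l] (ζ * dW^[l'] ζ))| ≤ 64 * S.M j a a χ := by
  refine S.bd fun t => ?_
  have h0 : 0 ≤ χ.1 t := (abs_nonneg _).trans (hχ l l' h1 h2 t)
  have := leib l ζ (dW^[l'] ζ) t (χ.1 t) fun i i' hi => by
    rw [← Function.iterate_add_apply]
    exact hχ _ _ (by omega) (by omega) t
  refine this.trans ?_
  have h3 : (2:ℝ) ^ l ≤ 2 ^ 6 := pow_le_pow_right₀ (by norm_num) (by omega)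
  nlinarith

end Sys
end TH

namespace TH

def Ap (Y K x y : ℝ) : Prop := |x - y| ≤ K * Y

lemma Ap.add {Y K x y K' x' y' : ℝ} (h : Ap Y K x y) (h' : Ap Y K' x' y') :
    Ap Y (K + K') (x + x') (y + y') := by
  unfold Ap at *
  calc |x + x' - (y + y')| = |(x - y) + (x' - y')| := by ring_nf
    _ ≤ _ := abs_add_le _ _
    _ ≤ _ := by linarith

lemma Ap.sm {Y K x y : ℝ} (c : ℝ) (h : Ap Y K x y) : Ap Y (|c| * K) (c * x) (c * y) := by
  unfold Ap at *
  rw [← mul_sub, abs_mul, mul_assoc]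
  exact mul_le_mul_of_nonneg_left h (abs_nonneg _)

lemma Ap.refl {Y x : ℝ} : Ap Y 0 x x := by simp [Ap]

lemma Ap.mono {Y K K' x y : ℝ} (hY : 0 ≤ Y) (h : Ap Y K x y) (hK : K ≤ K') : Ap Y K' x y := by
  unfold Ap at *; nlinarith

namespace Sys
variable {p h A T : ℝ} (S : Sys p h A T)

def O0 (χ : Wc) : ℝ := S.M 0 0 0 χ
def O1 (χ : Wc) : ℝ := S.M 1 0 0 χ + S.M 0 1 1 χ
def O2 (χ : Wc) : ℝ := S.M 2 0 0 χ + S.M 1 1 1 χ + S.M 0 2 2 χ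
def O3 (χ : Wc) : ℝ := S.M 3 0 0 χ + S.M 2 1 1 χ + S.M 1 2 2 χ + S.M 0 3 3 χ

/-- a uniform description of the error terms -/
def Er (ζ : Wc) (Y : ℝ) (k : ℕ) (Q : ℕ) : Prop :=
  ∀ j a l l', 1 ≤ l + l' → l + l' + 2 * (j + a) ≤ 6 + k → j + a ≤ Q →
    |S.M j a a (dW^[l] (ζ * dW^[l'] ζ))| ≤ 64 * Y

variable {S}
variable {ζ : Wc} {Y : ℝ}

lemma Er.nn (H : S.Er ζ Y 0 2) : 0 ≤ Y := by
  have := (abs_nonneg _).trans (H 0 0 1 0 (by norm_num) (by norm_num) (by norm_num)); linarith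

lemma ap0 (H : S.Er ζ Y 0 2) (j l : ℕ) (hl : 1 ≤ l) (h : l + 2 * j ≤ 6) :
    Ap Y 512 (S.M j 0 0 (ζ * dW^[l] ζ)) 0 := by
  have h1 := abs_le.1 (H j 0 0 l (by omega) (by omega) (by omega))
  simp only [Function.iterate_zero, id] at h1
  have := H.nn
  rw [Ap, sub_zero, abs_le]; constructor <;> linarith
lemma ap1 (H : S.Er ζ Y 0 2) (j l : ℕ) (h : 1 + l + 2 * j ≤ 6) :
    Ap Y 512 (S.M j 0 1 (ζ * dW^[l] ζ)) 0 := by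
  have h1 := abs_le.1 (H j 0 1 l (by omega) (by omega) (by omega))
  simp only [Function.iterate_zero, Function.iterate_succ, Function.comp, id] at h1
  have := H.nn
  rw [r01, Ap, sub_zero, abs_le]; constructor <;> linarith
lemma ap2 (H : S.Er ζ Y 0 2) (j l : ℕ) (hl : 1 ≤ l) (h : 2 + l + 2 * j ≤ 6) :
    Ap Y 512 (S.M j 0 2 (ζ * dW^[l] ζ)) 0 := by
  have h1 := abs_le.1 (H j 0 2 l (by omega) (by omega) (by omega))
  have h2 := abs_le.1 (H j 1 0 l (by omega) (by omega) (by omega))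
  simp only [Function.iterate_zero, Function.iterate_succ, Function.comp, id] at h1 h2
  have := H.nn
  rw [r02, Ap, sub_zero, abs_le]; constructor <;> linarith
lemma ap2' (H : S.Er ζ Y 0 2) (j : ℕ) (h : 2 + 2 * j ≤ 6) :
    Ap Y 512 (S.M j 0 2 (ζ * ζ)) (- S.M j 1 1 (ζ * ζ)) := by
  have h1 := abs_le.1 (H j 0 2 0 (by omega) (by omega) (by omega))
  simp only [Function.iterate_zero, Function.iterate_succ, Function.comp, id] at h1
  have := H.nn
  rw [r02, Ap, abs_le]; constructor <;> linarith
lemma ap3 (H : S.Er ζ Y 0 2) (j l : ℕ) (h : 3 + l + 2 * j ≤ 6) :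
    Ap Y 512 (S.M j 0 3 (ζ * dW^[l] ζ)) 0 := by
  have h1 := abs_le.1 (H j 0 3 l (by omega) (by omega) (by omega))
  have h2 := abs_le.1 (H j 1 1 l (by omega) (by omega) (by omega))
  simp only [Function.iterate_zero, Function.iterate_succ, Function.comp, id] at h1 h2
  have := H.nn
  rw [r03, Ap, sub_zero, abs_le]; constructor <;> linarith
lemma ap4 (H : S.Er ζ Y 0 2) (j l : ℕ) (hl : 1 ≤ l) (h : 4 + l + 2 * j ≤ 6) :
    Ap Y 512 (S.M j 0 4 (ζ * dW^[l] ζ)) 0 := by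
  have h1 := abs_le.1 (H j 0 4 l (by omega) (by omega) (by omega))
  have h2 := abs_le.1 (H j 1 2 l (by omega) (by omega) (by omega))
  have h3 := abs_le.1 (H j 2 0 l (by omega) (by omega) (by omega))
  simp only [Function.iterate_zero, Function.iterate_succ, Function.comp, id] at h1 h2 h3
  have := H.nn
  rw [r04, Ap, sub_zero, abs_le]; constructor <;> linarith
lemma ap4' (H : S.Er ζ Y 0 2) (j : ℕ) (h : 4 + 2 * j ≤ 6) :
    Ap Y 512 (S.M j 0 4 (ζ * ζ)) (S.M j 2 2 (ζ * ζ)) := by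
  have h1 := abs_le.1 (H j 0 4 0 (by omega) (by omega) (by omega))
  have h2 := abs_le.1 (H j 1 2 0 (by omega) (by omega) (by omega))
  simp only [Function.iterate_zero, Function.iterate_succ, Function.comp, id] at h1 h2
  have := H.nn
  rw [r04, Ap, abs_le]; constructor <;> linarith
lemma ap5 (H : S.Er ζ Y 0 2) (j l : ℕ) (h : 5 + l + 2 * j ≤ 6) :
    Ap Y 512 (S.M j 0 5 (ζ * dW^[l] ζ)) 0 := by
  have h1 := abs_le.1 (H j 0 5 l (by omega) (by omega) (by omega))
  have h2 := abs_le.1 (H j 1 3 l (by omega) (by omega) (by omega))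
  have h3 := abs_le.1 (H j 2 1 l (by omega) (by omega) (by omega))
  simp only [Function.iterate_zero, Function.iterate_succ, Function.comp, id] at h1 h2 h3
  have := H.nn
  rw [r05, Ap, sub_zero, abs_le]; constructor <;> linarith
lemma ap6' (H : S.Er ζ Y 0 2) :
    Ap Y 512 (S.M 0 0 6 (ζ * ζ)) (- S.M 0 3 3 (ζ * ζ)) := by
  have h1 := abs_le.1 (H 0 0 6 0 (by omega) (by omega) (by omega))
  have h2 := abs_le.1 (H 0 1 4 0 (by omega) (by omega) (by omega))
  have h3 := abs_le.1 (H 0 2 2 0 (by omega) (by omega) (by omega))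
  simp only [Function.iterate_zero, Function.iterate_succ, Function.comp, id] at h1 h2 h3
  have := H.nn
  rw [r06, Ap, abs_le]; constructor <;> linarith

/-- the approximate form of `eq0` -/
lemma apN (p h A : ℝ) : ∃ C : ℝ, ∀ {T : ℝ} (S : Sys p h A T) {ζ : Wc} {Y : ℝ}, S.Er ζ Y 0 2 →
    Ap Y C (S.N (ζ * ζ)) (S.M 3 0 0 (ζ*ζ) + (3*A^2 - 8 - 3*h^2) * S.M 2 0 0 (ζ*ζ)
        + (3*A^4 - 16*A^2 + 16 - 6*A^2*h^2 + 3*h^4) * S.M 1 0 0 (ζ*ζ)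
        + (A^2*(A^2-4)^2 - (3*A^4+16)*h^2 + (3*A^2+8)*h^4 - h^6) * S.M 0 0 0 (ζ*ζ)
      + (3 * S.M 2 1 1 (ζ*ζ) + (6*A^2 - 18*h^2) * S.M 1 1 1 (ζ*ζ)
        + ((3*A^4+16) - 6*(3*A^2+8)*h^2 + 15*h^4) * S.M 0 1 1 (ζ*ζ))
      + (3 * S.M 1 2 2 (ζ*ζ) + (3*A^2+8 - 15*h^2) * S.M 0 2 2 (ζ*ζ))
      + S.M 0 3 3 (ζ*ζ)) := by
  apply Exists.intro
  · intro T S ζ Y H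
    rw [← S.eq0]
    have a1 := ((((ap1 H 2 0 (by norm_num)).sm (-6*h)).add
      ((ap1 H 1 0 (by norm_num)).sm (-12*A^2*h + 12*h^3))).add
      ((ap1 H 0 0 (by norm_num)).sm (-2*(3*A^4+16)*h + 4*(3*A^2+8)*h^3 - 6*h^5)))
    have a2 := ((((ap2' H 2 (by norm_num)).sm (-3)).add
      ((ap2' H 1 (by norm_num)).sm (-6*A^2 + 18*h^2))).add
      ((ap2' H 0 (by norm_num)).sm (-(3*A^4+16) + 6*(3*A^2+8)*h^2 - 15*h^4)))
    have a3 := (((ap3 H 1 0 (by norm_num)).sm (12*h)).add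
      ((ap3 H 0 0 (by norm_num)).sm (4*(3*A^2+8)*h - 20*h^3)))
    have a4 := (((ap4' H 1 (by norm_num)).sm 3).add
      ((ap4' H 0 (by norm_num)).sm (3*A^2+8 - 15*h^2)))
    have a5 := (ap5 H 0 0 (by norm_num)).sm (-6*h)
    have a6 := (ap6' H).sm (-1)
    have a := ((((a1.add a2).add a3).add a4).add a5).add a6
    simp only [Function.iterate_zero, id] at a
    unfold Ap at a ⊢
    refine le_trans (le_of_eq ?_) a
    congr 1
    ring

/-- the approximate form of stability minus the equation -/
lemma key0 (p h A : ℝ) (hp : 1 < p) : ∃ C : ℝ, ∀ {T : ℝ} (S : Sys p h A T) {ζ : Wc} {Y : ℝ},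
    (∀ t, T ≤ t → ζ.1 t = 0) → S.Er ζ Y 0 2 →
    (p - 1) * S.M 3 0 0 (ζ*ζ) + (p * (3*A^2 - 8 - 3*h^2) - (3*A^2 - 8)) * S.M 2 0 0 (ζ*ζ)
        + (p * (3*A^4 - 16*A^2 + 16 - 6*A^2*h^2 + 3*h^4) - (3*A^4 - 16*A^2 + 16)) * S.M 1 0 0 (ζ*ζ)
        + (p * (A^2*(A^2-4)^2 - (3*A^4+16)*h^2 + (3*A^2+8)*h^4 - h^6) - A^2*(A^2-4)^2)
            * S.M 0 0 0 (ζ*ζ)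
      + ((3 * p - 3) * S.M 2 1 1 (ζ*ζ) + (p * (6*A^2 - 18*h^2) - 6*A^2) * S.M 1 1 1 (ζ*ζ)
        + (p * ((3*A^4+16) - 6*(3*A^2+8)*h^2 + 15*h^4) - (3*A^4+16)) * S.M 0 1 1 (ζ*ζ))
      + ((3 * p - 3) * S.M 1 2 2 (ζ*ζ) + (p * (3*A^2+8 - 15*h^2) - (3*A^2+8)) * S.M 0 2 2 (ζ*ζ))
      + (p - 1) * S.M 0 3 3 (ζ*ζ) ≤ C * Y := by
  obtain ⟨C0, hC0⟩ := apN p h A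
  apply Exists.intro
  · intro T S ζ Y hζ H
    have b := (hC0 S H).sm (-p)
    have hs := S.stab ζ hζ
    have a2 := ((((ap2' H 2 (by norm_num)).sm (-3)).add
      ((ap2' H 1 (by norm_num)).sm (-6*A^2))).add
      ((ap2' H 0 (by norm_num)).sm (-(3*A^4+16))))
    have a3 := ((((ap1 H 2 1 (by norm_num)).sm (-6)).add
      ((ap1 H 1 1 (by norm_num)).sm (-12*A^2))).add
      ((ap1 H 0 1 (by norm_num)).sm (-2 * (3*A^4+16))))
    have a4 := ((((ap0 H 2 2 (by norm_num) (by norm_num)).sm (-3)).add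
      ((ap0 H 1 2 (by norm_num) (by norm_num)).sm (-6*A^2))).add
      ((ap0 H 0 2 (by norm_num) (by norm_num)).sm (-(3*A^4+16))))
    have a5 := (((((ap4' H 1 (by norm_num)).sm 3).add
      ((ap3 H 1 1 (by norm_num)).sm 12)).add
      ((ap2 H 1 2 (by norm_num) (by norm_num)).sm 18)).add
      ((ap1 H 1 3 (by norm_num)).sm 12)).add ((ap0 H 1 4 (by norm_num) (by norm_num)).sm 3)
    have a6 := (((((ap4' H 0 (by norm_num)).sm (3*A^2+8)).add
      ((ap3 H 0 1 (by norm_num)).sm (4*(3*A^2+8)))).add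
      ((ap2 H 0 2 (by norm_num) (by norm_num)).sm (6*(3*A^2+8)))).add
      ((ap1 H 0 3 (by norm_num)).sm (4*(3*A^2+8)))).add
      ((ap0 H 0 4 (by norm_num) (by norm_num)).sm (3*A^2+8))
    have a7 := ((((((ap6' H).sm (-1)).add
      ((ap5 H 0 1 (by norm_num)).sm (-6))).add
      ((ap4 H 0 2 (by norm_num) (by norm_num)).sm (-15))).add
      ((ap3 H 0 3 (by norm_num)).sm (-20))).add
      ((ap2 H 0 4 (by norm_num) (by norm_num)).sm (-15))).add
      (((ap1 H 0 5 (by norm_num)).sm (-6)).add ((ap0 H 0 6 (by norm_num) (by norm_num)).sm (-1)))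
    have a := (((((a2.add a3).add a4).add a5).add a6).add a7).add b
    simp only [Function.iterate_zero, Function.iterate_succ, Function.comp, id] at a
    unfold Ap at a
    refine le_trans ?_ a
    refine le_trans ?_ (le_abs_self _)
    linarith

end Sys
end TH

namespace TH
namespace Sys
variable {p h A T : ℝ} (S : Sys p h A T)

def Full (χ : Wc) : ℝ := S.O0 χ + S.O1 χ + S.O2 χ + S.O3 χ + S.N χ

/-- domination of products of derivatives -/
def Dom (ζ χ : Wc) (k : ℕ) : Prop :=
  ∀ l l', 1 ≤ l + l' → l + l' ≤ k → ∀ t, |(dW^[l] ζ).1 t * (dW^[l'] ζ).1 t| ≤ χ.1 t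

lemma Dom.nn {ζ χ : Wc} {k : ℕ} (hk : 1 ≤ k) (H : Dom ζ χ k) (t : ℝ) : 0 ≤ χ.1 t :=
  (abs_nonneg _).trans (H 0 1 (by norm_num) (by omega) t)

lemma Mle (χ : Wc) (hχ : ∀ t, 0 ≤ χ.1 t) (j a : ℕ) (hja : j + a ≤ 3) : S.M j a a χ ≤ S.Full χ := by
  have f := fun j a => S.pos j a χ hχ
  have hN := S.Npos χ hχ
  unfold Full O0 O1 O2 O3
  have h00 := f 0 0; have h01 := f 0 1; have h02 := f 0 2; have h03 := f 0 3
  have h10 := f 1 0; have h11 := f 1 1; have h12 := f 1 2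
  have h20 := f 2 0; have h21 := f 2 1; have h30 := f 3 0
  have hj : j ≤ 3 := by omega
  have ha : a ≤ 3 := by omega
  interval_cases j <;> interval_cases a <;> linarith

lemma Er_of_full {ζ χ : Wc} (H : Dom ζ χ 6) : S.Er ζ (S.Full χ) 0 2 := by
  intro j a l l' h1 h2 h3
  refine (S.term (q := 0) (fun l l' h1 h2 => H l l' h1 (by omega)) j a l l' h1 (by omega)).trans ?_
  have := S.Mle χ (H.nn (by norm_num)) j a (by omega)
  linarith

lemma Er_of_three {ζ χ0 χ1 χ2 : Wc} (H0 : Dom ζ χ0 6) (H1 : Dom ζ χ1 4) (H2 : Dom ζ χ2 2) :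
    S.Er ζ (S.O0 χ0 + S.O1 χ1 + S.O2 χ2) 0 2 := by
  intro j a l l' h1 h2 h3
  have f0 := fun j a => S.pos j a χ0 (H0.nn (by norm_num))
  have f1 := fun j a => S.pos j a χ1 (H1.nn (by norm_num))
  have f2 := fun j a => S.pos j a χ2 (H2.nn (by norm_num))
  have a00 := f0 0 0
  have a01 := f1 0 1; have a10 := f1 1 0
  have a02 := f2 0 2; have a20 := f2 2 0; have a11 := f2 1 1
  unfold O0 O1 O2
  have : j + a = 0 ∨ j + a = 1 ∨ j + a = 2 := by omega
  rcases this with hq | hq | hq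
  · refine (S.term (q := 0) (fun l l' h1 h2 => H0 l l' h1 (by omega)) j a l l' h1 (by omega)).trans ?_
    have hj : j ≤ 0 := by omega
    have ha : a ≤ 0 := by omega
    interval_cases j; interval_cases a; linarith
  · refine (S.term (q := 1) (fun l l' h1 h2 => H1 l l' h1 (by omega)) j a l l' h1 (by omega)).trans ?_
    have hj : j ≤ 1 := by omega
    have ha : a ≤ 1 := by omega
    interval_cases j <;> interval_cases a <;> linarith
  · refine (S.term (q := 2) (fun l l' h1 h2 => H2 l l' h1 (by omega)) j a l l' h1 (by omega)).trans ?_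
    have hj : j ≤ 2 := by omega
    have ha : a ≤ 2 := by omega
    interval_cases j <;> interval_cases a <;> linarith

section key1
variable {S} {ζ χ : Wc}

lemma t1 (H : Dom ζ χ 6) (j a l : ℕ) (h0 : 1 ≤ l) (h : l ≤ 6) (hja : j + a ≤ 3) :
    |S.M j a a (dW^[l] (ζ * ζ))| ≤ 64 * S.Full χ := by
  have := (S.term (q := 0) (fun l l' h1 h2 => H l l' h1 (by omega)) j a l 0 (by omega) (by omega))
  refine this.trans ?_
  have := S.Mle χ (H.nn (by norm_num)) j a (by omega)
  linarith

lemma b0 (H : Dom ζ χ 6) (j : ℕ) (hj : j ≤ 3) : Ap (S.Full χ) 512 (S.M j 1 0 (ζ * ζ)) 0 := by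
  have h1 := abs_le.1 (t1 (S := S) H j 0 1 (by omega) (by omega) (by omega))
  simp only [Function.iterate_zero, Function.iterate_succ, Function.comp, id] at h1
  have := (H 0 1 (by norm_num) (by norm_num))
  rw [S.symm, r01, Ap, abs_le]; constructor <;> linarith
lemma b2 (H : Dom ζ χ 6) (j : ℕ) (hj : j ≤ 2) : Ap (S.Full χ) 512 (S.M j 1 2 (ζ * ζ)) 0 := by
  have h1 := abs_le.1 (t1 (S := S) H j 1 1 (by omega) (by omega) (by omega))
  simp only [Function.iterate_zero, Function.iterate_succ, Function.comp, id] at h1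
  rw [r12, Ap, abs_le]; constructor <;> linarith
lemma b3 (H : Dom ζ χ 6) (j : ℕ) (hj : j ≤ 1) :
    Ap (S.Full χ) 512 (S.M j 1 3 (ζ * ζ)) (- S.M j 2 2 (ζ * ζ)) := by
  have h1 := abs_le.1 (t1 (S := S) H j 1 2 (by omega) (by omega) (by omega))
  simp only [Function.iterate_zero, Function.iterate_succ, Function.comp, id] at h1
  rw [r13, Ap, abs_le]; constructor <;> linarith
lemma b4 (H : Dom ζ χ 6) (j : ℕ) (hj : j ≤ 1) :
    Ap (S.Full χ) 512 (S.M j 1 4 (ζ * ζ)) 0 := by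
  have h1 := abs_le.1 (t1 (S := S) H j 2 1 (by omega) (by omega) (by omega))
  have h2 := abs_le.1 (t1 (S := S) H j 1 3 (by omega) (by omega) (by omega))
  simp only [Function.iterate_zero, Function.iterate_succ, Function.comp, id] at h1 h2
  rw [r14, Ap, abs_le]; constructor <;> linarith
lemma b5 (H : Dom ζ χ 6) :
    Ap (S.Full χ) 512 (S.M 0 1 5 (ζ * ζ)) (S.M 0 3 3 (ζ * ζ)) := by
  have h1 := abs_le.1 (t1 (S := S) H 0 2 2 (by omega) (by omega) (by omega))
  have h2 := abs_le.1 (t1 (S := S) H 0 1 4 (by omega) (by omega) (by omega))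
  simp only [Function.iterate_zero, Function.iterate_succ, Function.comp, id] at h1 h2
  rw [r15, Ap, abs_le]; constructor <;> linarith
lemma b6 (H : Dom ζ χ 6) :
    Ap (S.Full χ) 512 (S.M 0 1 6 (ζ * ζ)) 0 := by
  have h1 := abs_le.1 (t1 (S := S) H 0 3 1 (by omega) (by omega) (by omega))
  have h2 := abs_le.1 (t1 (S := S) H 0 2 3 (by omega) (by omega) (by omega))
  have h3 := abs_le.1 (t1 (S := S) H 0 1 5 (by omega) (by omega) (by omega))
  simp only [Function.iterate_zero, Function.iterate_succ, Function.comp, id] at h1 h2 h3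
  rw [r16, Ap, abs_le]; constructor <;> linarith
lemma bN (H : Dom ζ χ 6) : Ap (S.Full χ) 512 (S.N (dW (ζ * ζ))) 0 := by
  have h1 : |S.N (dW (ζ * ζ))| ≤ 2 * S.N χ := S.Nbd fun t => by
    have := leib 1 ζ ζ t (χ.1 t) fun i i' hi => H i i' (by omega) (by omega) t
    simpa using this
  have hχ := H.nn (by norm_num)
  have f := fun j a => S.pos j a χ hχ
  have h00 := f 0 0; have h01 := f 0 1; have h02 := f 0 2; have h03 := f 0 3
  have h10 := f 1 0; have h11 := f 1 1; have h12 := f 1 2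
  have h20 := f 2 0; have h21 := f 2 1; have h30 := f 3 0
  have hN := S.Npos χ hχ
  rw [Ap, sub_zero]
  unfold Full O0 O1 O2 O3
  linarith
end key1

lemma key1 (p h A : ℝ) : ∃ C : ℝ, ∀ {T : ℝ} (S : Sys p h A T) {ζ χ : Wc}, Dom ζ χ 6 →
    h * (6 * S.M 2 1 1 (ζ*ζ) + (12*A^2 - 12*h^2) * S.M 1 1 1 (ζ*ζ)
      + (2*(3*A^4+16) - 4*(3*A^2+8)*h^2 + 6*h^4) * S.M 0 1 1 (ζ*ζ)
      + 12 * S.M 1 2 2 (ζ*ζ) + (4*(3*A^2+8) - 20*h^2) * S.M 0 2 2 (ζ*ζ)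
      + 6 * S.M 0 3 3 (ζ*ζ)) ≤ C * S.Full χ := by
  apply Exists.intro
  · intro T S ζ χ H
    have e := S.eq1 (ζ * ζ)
    have a0 := ((((b0 (S := S) H 3 (by norm_num)).sm 1).add
      ((b0 H 2 (by norm_num)).sm (3*A^2 - 8 - 3*h^2))).add
      ((b0 H 1 (by norm_num)).sm (3*A^4 - 16*A^2 + 16 - 6*A^2*h^2 + 3*h^4))).add
      ((b0 H 0 (by norm_num)).sm (A^2*(A^2-4)^2 - (3*A^4+16)*h^2 + (3*A^2+8)*h^4 - h^6))
    have a2 := ((((b2 (S := S) H 2 (by norm_num)).sm (-3)).add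
      ((b2 H 1 (by norm_num)).sm (-6*A^2 + 18*h^2))).add
      ((b2 H 0 (by norm_num)).sm (-(3*A^4+16) + 6*(3*A^2+8)*h^2 - 15*h^4)))
    have a3 := (((b3 (S := S) H 1 (by norm_num)).sm (12*h)).add
      ((b3 H 0 (by norm_num)).sm (4*(3*A^2+8)*h - 20*h^3)))
    have a4 := (((b4 (S := S) H 1 (by norm_num)).sm 3).add
      ((b4 H 0 (by norm_num)).sm (3*A^2+8 - 15*h^2)))
    have a5 := (b5 (S := S) H).sm (-6*h)
    have a6 := (b6 (S := S) H).sm (-1)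
    have a7 := (bN (S := S) H).sm (1/(p+1))
    have a := (((((a0.add a2).add a3).add a4).add a5).add a6).add a7
    unfold Ap at a
    refine le_trans ?_ a
    refine le_trans ?_ (le_abs_self _)
    have e' : -S.N (dW (ζ * ζ)) / (p + 1) = -(1/(p+1) * S.N (dW (ζ * ζ))) := by ring
    rw [e'] at e
    linarith

lemma keyaux (h C1 F : ℝ) (h0 : 0 < h) (e m s d : ℝ) (he : 0 < e) (hm : 0 ≤ m) (hs : 0 ≤ s)
    (hh : h * (e * m + s) ≤ C1 * F) : -(d * m) ≤ |d| * (C1 / (h * e)) * F := by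
  have : m ≤ (C1 / (h * e)) * F := by
    rw [div_mul_eq_mul_div, le_div_iff₀ (by positivity)]
    have := mul_nonneg h0.le hs
    linarith
  calc -(d * m) ≤ |d| * m := by
        rw [← neg_mul]; exact mul_le_mul_of_nonneg_right (neg_le_abs d) hm
    _ ≤ |d| * ((C1 / (h * e)) * F) := mul_le_mul_of_nonneg_left this (abs_nonneg _)
    _ = _ := by ring

set_option maxHeartbeats 1600000 in
lemma main_ineq (p h A : ℝ) (hp : 1 < p) (h0 : 0 ≤ h) (hA : h < A)
    (c20 : 0 ≤ p * (3*A^2 - 8 - 3*h^2) - (3*A^2 - 8))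
    (c10 : 0 ≤ p * (3*A^4 - 16*A^2 + 16 - 6*A^2*h^2 + 3*h^4) - (3*A^4 - 16*A^2 + 16))
    (c00 : 0 < p * (A^2*(A^2-4)^2 - (3*A^4+16)*h^2 + (3*A^2+8)*h^4 - h^6) - A^2*(A^2-4)^2)
    (e01 : 0 < 2*(3*A^4+16) - 4*(3*A^2+8)*h^2 + 6*h^4)
    (e02 : 0 < 4*(3*A^2+8) - 20*h^2) :
    ∃ C : ℝ, ∀ {T : ℝ} (S : Sys p h A T) {ζ χ : Wc},
    (∀ t, T ≤ t → ζ.1 t = 0) → Dom ζ χ 6 → S.M 0 0 0 (ζ*ζ) ≤ C * S.Full χ := by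
  obtain ⟨C0, hC0⟩ := key0 p h A hp
  obtain ⟨C1, hC1⟩ := key1 p h A
  set c := p * (A^2*(A^2-4)^2 - (3*A^4+16)*h^2 + (3*A^2+8)*h^4 - h^6) - A^2*(A^2-4)^2 with hc
  have sq : ∀ ζ : Wc, ∀ t, 0 ≤ (ζ * ζ).1 t := fun ζ t => by simpa using mul_self_nonneg _
  rcases h0.eq_or_lt with h0 | h0
  · refine ⟨C0 / c, fun {T} S {ζ χ} hζ H => ?_⟩
    have k := hC0 S hζ (S.Er_of_full H)
    rw [div_mul_eq_mul_div, le_div_iff₀ c00]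
    refine le_trans ?_ k
    have f := fun j a => S.pos j a (ζ*ζ) (sq ζ)
    have q1 := mul_nonneg c20 (f 2 0)
    have q2 := mul_nonneg c10 (f 1 0)
    have q3 := mul_nonneg (sub_nonneg.2 hp.le) (f 3 0)
    have q4 := mul_nonneg (sub_nonneg.2 hp.le) (f 0 3)
    have q5 := mul_nonneg (sub_nonneg.2 hp.le) (f 2 1)
    have q6 := mul_nonneg (sub_nonneg.2 hp.le) (f 1 2)
    have q7 := mul_nonneg (sub_nonneg.2 hp.le) (mul_nonneg (sq_nonneg A) (f 1 1))
    have q8 := mul_nonneg (sub_nonneg.2 hp.le) (mul_nonneg (by positivity : (0:ℝ) ≤ 3*A^4+16) (f 0 1))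
    have q9 := mul_nonneg (sub_nonneg.2 hp.le) (mul_nonneg (by positivity : (0:ℝ) ≤ 3*A^2+8) (f 0 2))
    subst h0
    nlinarith
  · have e11 : 0 < 12*A^2 - 12*h^2 := by nlinarith
    refine ⟨(C0 + |3*p-3| * (C1/(h*6)) + |p * (6*A^2 - 18*h^2) - 6*A^2| * (C1/(h*(12*A^2 - 12*h^2)))
      + |p * ((3*A^4+16) - 6*(3*A^2+8)*h^2 + 15*h^4) - (3*A^4+16)| *
        (C1/(h*(2*(3*A^4+16) - 4*(3*A^2+8)*h^2 + 6*h^4)))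
      + |3*p-3| * (C1/(h*12)) + |p * (3*A^2+8 - 15*h^2) - (3*A^2+8)| * (C1/(h*(4*(3*A^2+8) - 20*h^2)))
      + |p - 1| * (C1/(h*6)))/c, fun {T} S {ζ χ} hζ H => ?_⟩
    have k := hC0 S hζ (S.Er_of_full H)
    have k1 := hC1 S H
    rw [div_mul_eq_mul_div, le_div_iff₀ c00]
    have f := fun j a => S.pos j a (ζ*ζ) (sq ζ)
    have q1 := mul_nonneg c20 (f 2 0)
    have q2 := mul_nonneg c10 (f 1 0)
    have q3 := mul_nonneg (sub_nonneg.2 hp.le) (f 3 0)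
    have g21 := mul_nonneg (by norm_num : (0:ℝ) ≤ 6) (f 2 1)
    have g11 := mul_nonneg e11.le (f 1 1)
    have g01 := mul_nonneg e01.le (f 0 1)
    have g12 := mul_nonneg (by norm_num : (0:ℝ) ≤ 12) (f 1 2)
    have g02 := mul_nonneg e02.le (f 0 2)
    have g03 := mul_nonneg (by norm_num : (0:ℝ) ≤ 6) (f 0 3)
    have key := fun e m s d (he : (0:ℝ) < e) => keyaux h C1 (S.Full χ) h0 e m s d he
    have m21 := key _ _ ((12*A^2 - 12*h^2) * S.M 1 1 1 (ζ*ζ)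
      + (2*(3*A^4+16) - 4*(3*A^2+8)*h^2 + 6*h^4) * S.M 0 1 1 (ζ*ζ)
      + 12 * S.M 1 2 2 (ζ*ζ) + (4*(3*A^2+8) - 20*h^2) * S.M 0 2 2 (ζ*ζ)
      + 6 * S.M 0 3 3 (ζ*ζ)) (3*p-3) (by norm_num : (0:ℝ) < 6) (f 2 1) (by linarith) (by linarith)
    have m11 := key _ _ (6 * S.M 2 1 1 (ζ*ζ)
      + (2*(3*A^4+16) - 4*(3*A^2+8)*h^2 + 6*h^4) * S.M 0 1 1 (ζ*ζ)
      + 12 * S.M 1 2 2 (ζ*ζ) + (4*(3*A^2+8) - 20*h^2) * S.M 0 2 2 (ζ*ζ)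
      + 6 * S.M 0 3 3 (ζ*ζ)) (p * (6*A^2 - 18*h^2) - 6*A^2) e11 (f 1 1) (by linarith) (by linarith)
    have m01 := key _ _ (6 * S.M 2 1 1 (ζ*ζ) + (12*A^2 - 12*h^2) * S.M 1 1 1 (ζ*ζ)
      + 12 * S.M 1 2 2 (ζ*ζ) + (4*(3*A^2+8) - 20*h^2) * S.M 0 2 2 (ζ*ζ)
      + 6 * S.M 0 3 3 (ζ*ζ)) (p * ((3*A^4+16) - 6*(3*A^2+8)*h^2 + 15*h^4) - (3*A^4+16))
      e01 (f 0 1) (by linarith) (by linarith)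
    have m12 := key _ _ (6 * S.M 2 1 1 (ζ*ζ) + (12*A^2 - 12*h^2) * S.M 1 1 1 (ζ*ζ)
      + (2*(3*A^4+16) - 4*(3*A^2+8)*h^2 + 6*h^4) * S.M 0 1 1 (ζ*ζ)
      + (4*(3*A^2+8) - 20*h^2) * S.M 0 2 2 (ζ*ζ)
      + 6 * S.M 0 3 3 (ζ*ζ)) (3*p-3) (by norm_num : (0:ℝ) < 12) (f 1 2) (by linarith) (by linarith)
    have m02 := key _ _ (6 * S.M 2 1 1 (ζ*ζ) + (12*A^2 - 12*h^2) * S.M 1 1 1 (ζ*ζ)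
      + (2*(3*A^4+16) - 4*(3*A^2+8)*h^2 + 6*h^4) * S.M 0 1 1 (ζ*ζ)
      + 12 * S.M 1 2 2 (ζ*ζ)
      + 6 * S.M 0 3 3 (ζ*ζ)) (p * (3*A^2+8 - 15*h^2) - (3*A^2+8)) e02 (f 0 2) (by linarith) (by linarith)
    have m03 := key _ _ (6 * S.M 2 1 1 (ζ*ζ) + (12*A^2 - 12*h^2) * S.M 1 1 1 (ζ*ζ)
      + (2*(3*A^4+16) - 4*(3*A^2+8)*h^2 + 6*h^4) * S.M 0 1 1 (ζ*ζ)
      + 12 * S.M 1 2 2 (ζ*ζ) + (4*(3*A^2+8) - 20*h^2) * S.M 0 2 2 (ζ*ζ))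
      (p-1) (by norm_num : (0:ℝ) < 6) (f 0 3) (by linarith) (by linarith)
    rw [mul_comm (S.M 0 0 0 (ζ*ζ)) c]
    linarith
end Sys
end TH

namespace TH

/-- translation of cut-off functions -/
def tr (s : ℝ) : Wc →ₗ[ℝ] Wc where
  toFun ζ := ⟨fun t => ζ.1 (t - s), by
    refine ⟨ζ.2.1.comp (contDiff_id.sub contDiff_const), ?_⟩
    have := ζ.2.2.comp_homeomorph (Homeomorph.subRight s)
    exact this⟩
  map_add' _ _ := rfl
  map_smul' _ _ := rfl

lemma tr_ap (s : ℝ) (ζ : Wc) (t : ℝ) : (tr s ζ).1 t = ζ.1 (t - s) := rfl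
lemma tr_mul (s : ℝ) (ζ ξ : Wc) : tr s (ζ * ξ) = tr s ζ * tr s ξ := rfl
lemma tr_dW (s : ℝ) (ζ : Wc) : dW (tr s ζ) = tr s (dW ζ) := by
  apply Subtype.ext
  funext t
  rw [tr_ap, dW_ap, dW_ap]
  exact deriv_comp_sub_const (f := ζ.1) (x := t) (a := s)

/-- the translated system -/
def Sys.shift {p h A T : ℝ} (S : Sys p h A T) (s : ℝ) : Sys p h A (T - s) where
  M j a b := (S.M j a b).comp (tr s)
  N := S.N.comp (tr s)
  symm j a b := by rw [S.symm]
  ibp j a b ζ := by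
    simp only [LinearMap.comp_apply, ← tr_dW]; exact S.ibp j a b _
  pos j a ζ h := S.pos j a _ fun t => h _
  Npos ζ h := S.Npos _ fun t => h _
  am0 a b ε hε ζ ξ := by
    simp only [LinearMap.comp_apply, tr_mul]; exact S.am0 a b ε hε _ _
  in1 a ε hε ζ ξ := by
    simp only [LinearMap.comp_apply, tr_mul]; exact S.in1 a ε hε _ _
  in2 a ε hε ζ ξ := by
    simp only [LinearMap.comp_apply, tr_mul]; exact S.in2 a ε hε _ _
  eq0 ζ := by
    simp only [LinearMap.comp_apply]; exact S.eq0 _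
  eq1 ζ := by
    simp only [LinearMap.comp_apply, ← tr_dW]; exact S.eq1 _
  stab ζ h := by
    simp only [LinearMap.comp_apply, tr_mul, ← tr_dW]
    exact S.stab _ fun t ht => h _ (by linarith)

def bmp : ContDiffBump (1/2 : ℝ) := ⟨1/2, 3/2, by norm_num, by norm_num⟩
/-- basic cut-off -/
def et : Wc := ⟨bmp, ⟨bmp.contDiff, bmp.hasCompactSupport⟩⟩
def pw : ℕ → Wc
  | 0 => et
  | 1 => et
  | (i+2) => pw (i+1) * et

lemma et_nn (t : ℝ) : 0 ≤ et.1 t := bmp.nonneg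
lemma et_le (t : ℝ) : et.1 t ≤ 1 := bmp.le_one
lemma et_one {t : ℝ} (h0 : 0 ≤ t) (h1 : t ≤ 1) : et.1 t = 1 := by
  apply bmp.one_of_mem_closedBall
  rw [Metric.mem_closedBall, Real.dist_eq, abs_le]
  simp only [bmp]; constructor <;> linarith
lemma et_zero {t : ℝ} (h : t ≤ -1 ∨ 2 ≤ t) : et.1 t = 0 := by
  apply bmp.zero_of_le_dist
  rw [Real.dist_eq]
  simp only [bmp]
  rcases h with h | h
  · rw [abs_of_nonpos (by linarith)]; linarith
  · rw [abs_of_nonneg (by linarith)]; linarith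
lemma pw_succ {i : ℕ} (hi : 1 ≤ i) : pw (i+1) = pw i * et := by
  obtain ⟨k, rfl⟩ : ∃ k, i = k + 1 := ⟨i - 1, by omega⟩
  rfl
lemma pw_ap {i : ℕ} (hi : 1 ≤ i) (t : ℝ) : (pw i).1 t = et.1 t ^ i := by
  induction i, hi using Nat.le_induction with
  | base => simp [pw]
  | succ k hk ih => rw [pw_succ hk, Wc.mul_ap, ih, pow_succ]
lemma pw_mul {i j : ℕ} (hi : 1 ≤ i) (hj : 1 ≤ j) : pw i * pw j = pw (i + j) := by
  apply Subtype.ext; funext t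
  rw [Wc.mul_ap, pw_ap hi, pw_ap hj, pw_ap (by omega), pow_add]
lemma dW_pw {i : ℕ} (hi : 1 ≤ i) : dW (pw (i+1)) = ((i:ℝ) + 1) • (pw i * dW et) := by
  induction i, hi using Nat.le_induction with
  | base =>
    rw [pw_succ le_rfl, dW_mul]
    simp only [pw]
    apply Subtype.ext; funext t
    simp; ring
  | succ k hk ih =>
    rw [pw_succ (by omega), dW_mul, ih]
    apply Subtype.ext; funext t
    rw [pw_succ hk]
    simp; ring

lemma dW_pw_mul : ∀ (l i : ℕ) (ξ : Wc), 1 ≤ i →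
    ∃ ξ' : Wc, dW^[l] (pw (i + l) * ξ) = pw i * ξ' := by
  intro l
  induction l with
  | zero => intro i ξ _; exact ⟨ξ, rfl⟩
  | succ l ih =>
    intro i ξ hi
    obtain ⟨ξ', h⟩ := ih i (((i + l : ℕ) + 1 : ℝ) • (dW et * ξ) + et * dW ξ) hi
    refine ⟨ξ', ?_⟩
    rw [← h, Function.iterate_succ_apply]
    congr 1
    rw [← add_assoc, dW_mul, dW_pw (by omega), pw_succ (by omega)]
    apply Subtype.ext; funext t
    simp; ring

lemma Wc.bound (ζ : Wc) : ∃ C : ℝ, 0 ≤ C ∧ ∀ t, |ζ.1 t| ≤ C := by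
  obtain ⟨C, hC⟩ := ζ.2.2.exists_bound_of_continuous ζ.2.1.continuous
  exact ⟨C, (norm_nonneg _).trans (hC 0), fun t => hC t⟩

lemma pw_der (l i : ℕ) (hi : 1 ≤ i) : ∃ C : ℝ, 0 ≤ C ∧ ∀ t,
    |(dW^[l] (pw (i + l + 1))).1 t| ≤ C * et.1 t ^ i := by
  obtain ⟨ξ, h⟩ := dW_pw_mul l i et hi
  obtain ⟨C, h0, hC⟩ := Wc.bound ξ
  refine ⟨C, h0, fun t => ?_⟩
  rw [pw_succ (by omega), h, Wc.mul_ap, pw_ap hi, abs_mul, abs_of_nonneg (pow_nonneg (et_nn t) _),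
    mul_comm]
  exact mul_le_mul_of_nonneg_right (hC t) (pow_nonneg (et_nn t) _)

/-- `|dW^[l] η^k| ≤ C η^(k-l-1)` with a uniform constant for `l ≤ 6`; no loss for `l = 0` -/
lemma pw_der_all (k : ℕ) (hk : 8 ≤ k) : ∃ C : ℝ, 1 ≤ C ∧ ∀ l ≤ 6, ∀ t,
    |(dW^[l] (pw k)).1 t| ≤ C * et.1 t ^ (k - l - 1) := by
  have : ∀ l : ℕ, ∃ C : ℝ, 0 ≤ C ∧ (l ≤ 6 → ∀ t, |(dW^[l] (pw k)).1 t| ≤ C * et.1 t ^ (k - l - 1)) := by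
    intro l
    by_cases hl : l ≤ 6
    · obtain ⟨C, h0, h⟩ := pw_der l (k - l - 1) (by omega)
      rw [show k - l - 1 + l + 1 = k by omega] at h
      exact ⟨C, h0, fun _ => h⟩
    · exact ⟨0, le_rfl, fun h => absurd h hl⟩
  choose C h0 h using this
  refine ⟨1 + ∑ l ∈ Finset.range 7, C l, by
    have := Finset.sum_nonneg fun l (_ : l ∈ Finset.range 7) => h0 l
    linarith, fun l hl t => (h l hl t).trans ?_⟩
  refine mul_le_mul_of_nonneg_right ?_ (pow_nonneg (et_nn t) _)
  have := Finset.single_le_sum (fun l (_ : l ∈ Finset.range 7) => h0 l)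
    (Finset.mem_range.2 (by omega : l < 7))
  linarith

lemma pw_dom (k : ℕ) (hk : 8 ≤ k) : ∃ C : ℝ, 0 ≤ C ∧ ∀ q ≤ 2,
    Sys.Dom (pw k) (C • pw (2 * k - 12 + 4 * q)) (6 - 2 * q) := by
  obtain ⟨C, h1, h⟩ := pw_der_all k hk
  refine ⟨C * C, by positivity, fun q hq l l' hl hl' t => ?_⟩
  have e0 := et_nn t
  rw [abs_mul, Wc.smul_ap, pw_ap (by omega)]
  calc _ ≤ (C * et.1 t ^ (k - l - 1)) * (C * et.1 t ^ (k - l' - 1)) :=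
        mul_le_mul (h l (by omega) t) (h l' (by omega) t) (abs_nonneg _) (by positivity)
    _ = C * C * et.1 t ^ (k - l - 1 + (k - l' - 1)) := by rw [pow_add]; ring
    _ ≤ _ := by
        refine mul_le_mul_of_nonneg_left ?_ (by positivity)
        exact pow_le_pow_of_le_one e0 (et_le t) (by omega)

namespace Sys

lemma O0_smul {p h A T : ℝ} (S : Sys p h A T) (c : ℝ) (χ : Wc) : S.O0 (c • χ) = c * S.O0 χ := by
  simp [O0]
lemma O1_smul {p h A T : ℝ} (S : Sys p h A T) (c : ℝ) (χ : Wc) : S.O1 (c • χ) = c * S.O1 χ := by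
  simp [O1]; ring
lemma O2_smul {p h A T : ℝ} (S : Sys p h A T) (c : ℝ) (χ : Wc) : S.O2 (c • χ) = c * S.O2 χ := by
  simp [O2]; ring

lemma pw_nn {i : ℕ} (hi : 1 ≤ i) (t : ℝ) : 0 ≤ (pw i).1 t := by
  rw [pw_ap hi]; exact pow_nonneg (et_nn t) _
lemma pw_anti {i j : ℕ} (hi : 1 ≤ i) (hij : i ≤ j) (t : ℝ) : (pw j).1 t ≤ (pw i).1 t := by
  rw [pw_ap hi, pw_ap (by omega)]; exact pow_le_pow_of_le_one (et_nn t) (et_le t) hij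

lemma interp2 (k : ℕ) (hk : 8 ≤ k) (ε : ℝ) (hε : 0 < ε) : ∃ C : ℝ, 0 ≤ C ∧
    ∀ {p h A T : ℝ} (S : Sys p h A T),
      S.O2 (pw (2*k-4)) ≤ ε * S.O3 (pw (2*k)) + C * S.O1 (pw (2*k-8)) := by
  obtain ⟨C, h0, hC⟩ := pw_der 2 (2*k-4-3) (by omega)
  rw [show 2*k-4-3+2+1 = 2*k-4 by omega] at hC
  refine ⟨C + 2 * (1/(4*ε)), by positivity, fun {p h A T} S => ?_⟩
  have e1 : pw (2*k-4) = pw k * pw (k-4) := by rw [pw_mul (by omega) (by omega)]; congr 1; omega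
  have e2 : pw (2*k) = pw k * pw k := by rw [pw_mul (by omega) (by omega)]; congr 1; omega
  have e3 : pw (2*k-8) = pw (k-4) * pw (k-4) := by rw [pw_mul (by omega) (by omega)]; congr 1; omega
  have i2 := S.in2 0 ε hε (pw k) (pw (k-4))
  have i1 := S.in1 1 ε hε (pw k) (pw (k-4))
  have i0 := S.am0 1 3 ε hε (pw k) (pw (k-4))
  rw [← e1, ← e2, ← e3] at i2 i1 i0
  have r := S.r13 0 (pw (2*k-4))
  have b : |S.M 0 1 1 (dW (dW (pw (2*k-4))))| ≤ C * S.M 0 1 1 (pw (2*k-8)) := S.bd fun t => by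
    refine (hC t).trans (mul_le_mul_of_nonneg_left ?_ h0)
    rw [pw_ap (by omega)]
    exact pow_le_pow_of_le_one (et_nn t) (et_le t) (by omega)
  have b' := (abs_le.1 b).2
  have f := fun j a => S.pos j a (pw (2*k-8)) (pw_nn (by omega))
  have g := fun j a => S.pos j a (pw (2*k)) (pw_nn (by omega))
  have f1 := mul_nonneg h0 (f 1 0); have f2 := mul_nonneg h0 (f 0 1)
  have g1 := mul_nonneg hε.le (g 1 2)
  have q : 0 ≤ 1 / (4*ε) := by positivity
  have := mul_nonneg q (f 1 0)
  have := mul_nonneg q (f 0 1)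
  unfold O1 O2 O3
  linarith

lemma interp1 (k : ℕ) (hk : 8 ≤ k) (ε : ℝ) (hε : 0 < ε) : ∃ C : ℝ, 0 ≤ C ∧
    ∀ {p h A T : ℝ} (S : Sys p h A T),
      S.O1 (pw (2*k-8)) ≤ ε * S.O2 (pw (2*k-4)) + C * S.O0 (pw (2*k-12)) := by
  obtain ⟨C, h0, hC⟩ := pw_der 2 (2*k-8-3) (by omega)
  rw [show 2*k-8-3+2+1 = 2*k-8 by omega] at hC
  refine ⟨C + 2 * (1/(4*ε)), by positivity, fun {p h A T} S => ?_⟩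
  have e1 : pw (2*k-8) = pw (k-2) * pw (k-6) := by rw [pw_mul (by omega) (by omega)]; congr 1; omega
  have e2 : pw (2*k-4) = pw (k-2) * pw (k-2) := by rw [pw_mul (by omega) (by omega)]; congr 1; omega
  have e3 : pw (2*k-12) = pw (k-6) * pw (k-6) := by rw [pw_mul (by omega) (by omega)]; congr 1; omega
  have i1 := S.in1 0 ε hε (pw (k-2)) (pw (k-6))
  have i0 := S.am0 0 2 ε hε (pw (k-2)) (pw (k-6))
  rw [← e1, ← e2, ← e3] at i1 i0
  have r := S.r02 0 (pw (2*k-8))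
  have b : |S.M 0 0 0 (dW (dW (pw (2*k-8))))| ≤ C * S.M 0 0 0 (pw (2*k-12)) := S.bd fun t => by
    refine (hC t).trans (mul_le_mul_of_nonneg_left ?_ h0)
    rw [pw_ap (by omega)]
    exact pow_le_pow_of_le_one (et_nn t) (et_le t) (by omega)
  have b' := (abs_le.1 b).2
  have f := fun j a => S.pos j a (pw (2*k-12)) (pw_nn (by omega))
  have g := fun j a => S.pos j a (pw (2*k-4)) (pw_nn (by omega))
  have f1 := mul_nonneg h0 (f 0 0)
  have g1 := mul_nonneg hε.le (g 1 1)
  unfold O0 O1 O2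
  linarith

lemma coefle (c m W : ℝ) (hm : 0 ≤ m) (h : m ≤ W) : |c * m| ≤ |c| * W := by
  rw [abs_mul, abs_of_nonneg hm]; exact mul_le_mul_of_nonneg_left h (abs_nonneg _)

/-- first half of the Caccioppoli estimate -/
lemma cac1 (p h A : ℝ) (hp : 1 < p) (k : ℕ) (hk : 8 ≤ k) : ∃ C : ℝ, 0 ≤ C ∧
    ∀ {T : ℝ} (S : Sys p h A T), 2 ≤ T →
      S.O3 (pw (2*k)) + S.N (pw (2*k)) ≤ C * (S.O0 (pw (2*k-12)) + S.O1 (pw (2*k-8))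
        + S.O2 (pw (2*k-4))) := by
  obtain ⟨c, hc, hd⟩ := pw_dom k hk
  obtain ⟨C0, hC0⟩ := key0 p h A hp
  obtain ⟨C1, hC1⟩ := apN p h A
  set K0 : ℝ := (|C0| * c + |p * (3*A^2 - 8 - 3*h^2) - (3*A^2 - 8)|
    + |p * (3*A^4 - 16*A^2 + 16 - 6*A^2*h^2 + 3*h^4) - (3*A^4 - 16*A^2 + 16)|
    + |p * (A^2*(A^2-4)^2 - (3*A^4+16)*h^2 + (3*A^2+8)*h^4 - h^6) - A^2*(A^2-4)^2|
    + |p * (6*A^2 - 18*h^2) - 6*A^2|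
    + |p * ((3*A^4+16) - 6*(3*A^2+8)*h^2 + 15*h^4) - (3*A^4+16)|
    + |p * (3*A^2+8 - 15*h^2) - (3*A^2+8)|) / (p - 1) with hK0
  set K1 : ℝ := (|C1| * c + |3*A^2 - 8 - 3*h^2|
    + |3*A^4 - 16*A^2 + 16 - 6*A^2*h^2 + 3*h^4|
    + |A^2*(A^2-4)^2 - (3*A^4+16)*h^2 + (3*A^2+8)*h^4 - h^6|
    + |6*A^2 - 18*h^2|
    + |(3*A^4+16) - 6*(3*A^2+8)*h^2 + 15*h^4|
    + |3*A^2+8 - 15*h^2|) with hK1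
  have hp' : 0 < p - 1 := by linarith
  have hK0n : 0 ≤ K0 := by rw [hK0]; positivity
  have hK1n : 0 ≤ K1 := by rw [hK1]; positivity
  refine ⟨4 * K0 + K1, by positivity, fun {T} S hT => ?_⟩
  have hE := S.Er_of_three (ζ := pw k) (hd 0 (by norm_num)) (hd 1 (by norm_num)) (hd 2 (by norm_num))
  have hz : ∀ t, T ≤ t → (pw k).1 t = 0 := fun t ht => by
    rw [pw_ap (by omega), et_zero (Or.inr (by linarith)), zero_pow (by omega)]
  have k0 := hC0 S hz hE
  have k1 := hC1 S hE
  rw [pw_mul (by omega) (by omega), O0_smul, O1_smul, O2_smul, ← two_mul] at k0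
  rw [pw_mul (by omega) (by omega), O0_smul, O1_smul, O2_smul, ← two_mul, Ap] at k1
  have k1 := (abs_le.1 k1).2
  norm_num only at k0 k1
  rw [show 2*k-12+4 = 2*k-8 by omega, show 2*k-12+8 = 2*k-4 by omega] at k0 k1
  simp only [add_zero] at k0 k1
  have f0 := fun j a => S.pos j a (pw (2*k-12)) (pw_nn (by omega))
  have f1 := fun j a => S.pos j a (pw (2*k-8)) (pw_nn (by omega))
  have f2 := fun j a => S.pos j a (pw (2*k-4)) (pw_nn (by omega))
  have f3 := fun j a => S.pos j a (pw (2*k)) (pw_nn (by omega))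
  have m0 := fun j a => S.mono (j := j) (a := a) (pw_anti (i := 2*k-12) (j := 2*k) (by omega) (by omega))
  have m1 := fun j a => S.mono (j := j) (a := a) (pw_anti (i := 2*k-8) (j := 2*k) (by omega) (by omega))
  have m2 := fun j a => S.mono (j := j) (a := a) (pw_anti (i := 2*k-4) (j := 2*k) (by omega) (by omega))
  obtain ⟨W, hW⟩ : ∃ W, W = S.O0 (pw (2*k-12)) + S.O1 (pw (2*k-8)) + S.O2 (pw (2*k-4)) := ⟨_, rfl⟩
  have w00 := f0 0 0; have w01 := f1 0 1; have w10 := f1 1 0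
  have w02 := f2 0 2; have w11 := f2 1 1; have w20 := f2 2 0
  have hW' := hW
  unfold O0 O1 O2 at hW'
  have W0 : 0 ≤ W := by linarith
  have l00 : S.M 0 0 0 (pw (2*k)) ≤ W := by have := m0 0 0; linarith
  have l01 : S.M 0 1 1 (pw (2*k)) ≤ W := by have := m1 0 1; linarith
  have l10 : S.M 1 0 0 (pw (2*k)) ≤ W := by have := m1 1 0; linarith
  have l02 : S.M 0 2 2 (pw (2*k)) ≤ W := by have := m2 0 2; linarith
  have l11 : S.M 1 1 1 (pw (2*k)) ≤ W := by have := m2 1 1; linarith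
  have l20 : S.M 2 0 0 (pw (2*k)) ≤ W := by have := m2 2 0; linarith
  rw [← hW]
  have hY : C0 * (c * S.O0 (pw (2*k-12)) + c * S.O1 (pw (2*k-8)) + c * S.O2 (pw (2*k-4)))
      ≤ |C0| * c * W := by
    rw [← mul_add, ← mul_add, ← hW, ← mul_assoc]
    exact mul_le_mul_of_nonneg_right (mul_le_mul_of_nonneg_right (le_abs_self _) hc) W0
  have hY1 : C1 * (c * S.O0 (pw (2*k-12)) + c * S.O1 (pw (2*k-8)) + c * S.O2 (pw (2*k-4)))
      ≤ |C1| * c * W := by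
    rw [← mul_add, ← mul_add, ← hW, ← mul_assoc]
    exact mul_le_mul_of_nonneg_right (mul_le_mul_of_nonneg_right (le_abs_self _) hc) W0
  have g3 : S.O3 (pw (2*k)) ≤ K0 * W := by
    have a20 := abs_le.1 (coefle (p * (3*A^2 - 8 - 3*h^2) - (3*A^2 - 8)) _ W (f3 2 0) l20)
    have a10 := abs_le.1 (coefle (p * (3*A^4 - 16*A^2 + 16 - 6*A^2*h^2 + 3*h^4) - (3*A^4 - 16*A^2 + 16)) _ W (f3 1 0) l10)
    have a00 := abs_le.1 (coefle (p * (A^2*(A^2-4)^2 - (3*A^4+16)*h^2 + (3*A^2+8)*h^4 - h^6) - A^2*(A^2-4)^2) _ W (f3 0 0) l00)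
    have a11 := abs_le.1 (coefle (p * (6*A^2 - 18*h^2) - 6*A^2) _ W (f3 1 1) l11)
    have a01 := abs_le.1 (coefle (p * ((3*A^4+16) - 6*(3*A^2+8)*h^2 + 15*h^4) - (3*A^4+16)) _ W (f3 0 1) l01)
    have a02 := abs_le.1 (coefle (p * (3*A^2+8 - 15*h^2) - (3*A^2+8)) _ W (f3 0 2) l02)
    have u1 := mul_nonneg hp'.le (f3 2 1)
    have u2 := mul_nonneg hp'.le (f3 1 2)
    rw [hK0, div_mul_eq_mul_div, le_div_iff₀ hp']
    unfold O3
    linarith [a20.1, a10.1, a00.1, a11.1, a01.1, a02.1]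
  have g4 : S.N (pw (2*k)) ≤ 3 * S.O3 (pw (2*k)) + K1 * W := by
    have a20 := abs_le.1 (coefle (3*A^2 - 8 - 3*h^2) _ W (f3 2 0) l20)
    have a10 := abs_le.1 (coefle (3*A^4 - 16*A^2 + 16 - 6*A^2*h^2 + 3*h^4) _ W (f3 1 0) l10)
    have a00 := abs_le.1 (coefle (A^2*(A^2-4)^2 - (3*A^4+16)*h^2 + (3*A^2+8)*h^4 - h^6) _ W (f3 0 0) l00)
    have a11 := abs_le.1 (coefle (6*A^2 - 18*h^2) _ W (f3 1 1) l11)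
    have a01 := abs_le.1 (coefle ((3*A^4+16) - 6*(3*A^2+8)*h^2 + 15*h^4) _ W (f3 0 1) l01)
    have a02 := abs_le.1 (coefle (3*A^2+8 - 15*h^2) _ W (f3 0 2) l02)
    have u1 := f3 3 0
    have u2 := f3 0 3
    rw [hK1]
    unfold O3
    linarith [a20.2, a10.2, a00.2, a11.2, a01.2, a02.2]
  linarith

/-- Caccioppoli estimate -/
lemma cac (p h A : ℝ) (hp : 1 < p) (k : ℕ) (hk : 8 ≤ k) : ∃ C : ℝ, 0 ≤ C ∧
    ∀ {T : ℝ} (S : Sys p h A T), 2 ≤ T →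
      S.Full (pw (2*k)) ≤ C * S.M 0 0 0 (pw (2*k-12)) := by
  obtain ⟨C, hC, h3⟩ := cac1 p h A hp k hk
  obtain ⟨C2, hC2, h2⟩ := interp2 k hk (1/(2*(C+1))) (by positivity)
  obtain ⟨C1, hC1, h1⟩ := interp1 k hk (1/(2*(2+2*C2))) (by positivity)
  refine ⟨?_, ?_, fun {T} S hT => ?_⟩
  · exact (C+1)*(1+(1+2*C1)+(2+2*C2)*(1+2*C1+1))
  · positivity
  have h3 := h3 S hT
  have h2 := h2 S
  have h1 := h1 S
  have f0 := fun j a => S.pos j a (pw (2*k-12)) (pw_nn (by omega))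
  have f1 := fun j a => S.pos j a (pw (2*k-8)) (pw_nn (by omega))
  have f2 := fun j a => S.pos j a (pw (2*k-4)) (pw_nn (by omega))
  have f3 := fun j a => S.pos j a (pw (2*k)) (pw_nn (by omega))
  have m0 := fun j a => S.mono (j := j) (a := a) (pw_anti (i := 2*k-12) (j := 2*k) (by omega) (by omega))
  have m1 := fun j a => S.mono (j := j) (a := a) (pw_anti (i := 2*k-8) (j := 2*k) (by omega) (by omega))
  have m2 := fun j a => S.mono (j := j) (a := a) (pw_anti (i := 2*k-4) (j := 2*k) (by omega) (by omega))
  have n0 : S.O0 (pw (2*k)) ≤ S.O0 (pw (2*k-12)) := m0 0 0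
  have n1 : S.O1 (pw (2*k)) ≤ S.O1 (pw (2*k-8)) := add_le_add (m1 1 0) (m1 0 1)
  have n2 : S.O2 (pw (2*k)) ≤ S.O2 (pw (2*k-4)) := add_le_add (add_le_add (m2 2 0) (m2 1 1)) (m2 0 2)
  have hN := S.Npos (pw (2*k)) (pw_nn (by omega))
  have p0 : 0 ≤ S.O0 (pw (2*k-12)) := f0 0 0
  have p1 : 0 ≤ S.O1 (pw (2*k-8)) := add_nonneg (f1 1 0) (f1 0 1)
  have p2 : 0 ≤ S.O2 (pw (2*k-4)) := add_nonneg (add_nonneg (f2 2 0) (f2 1 1)) (f2 0 2)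
  have p3 : 0 ≤ S.O3 (pw (2*k)) :=
    add_nonneg (add_nonneg (add_nonneg (f3 3 0) (f3 2 1)) (f3 1 2)) (f3 0 3)
  change _ ≤ _ * S.O0 (pw (2*k-12))
  unfold Full
  generalize S.O0 (pw (2*k-12)) = X0 at *
  generalize S.O1 (pw (2*k-8)) = X1 at *
  generalize S.O2 (pw (2*k-4)) = X2 at *
  generalize S.O3 (pw (2*k)) = X3 at *
  generalize S.N (pw (2*k)) = N at *
  -- X3 ≤ C W
  have s2 : X2 ≤ (X0 + X1) + 2 * C2 * X1 := by
    have : (2*(C+1)) * X2 ≤ X3 + (2*(C+1)) * (C2 * X1) := by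
      have := mul_le_mul_of_nonneg_left h2 (by positivity : 0 ≤ 2*(C+1))
      have e : 2*(C+1) * (1/(2*(C+1))*X3 + C2*X1) = X3 + 2*(C+1)*(C2*X1) := by
        have : C + 1 ≠ 0 := by positivity
        field_simp
      linarith
    have hh : (C+1) * (X2 - ((X0 + X1) + 2 * C2 * X1)) ≤ 0 := by nlinarith
    have := nonpos_of_mul_nonpos_right hh (by positivity : 0 < C+1)
    linarith
  have s1 : X1 ≤ X0 + 2 * C1 * X0 := by
    have : (2*(2+2*C2)) * X1 ≤ X2 + (2*(2+2*C2)) * (C1 * X0) := by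
      have := mul_le_mul_of_nonneg_left h1 (by positivity : 0 ≤ 2*(2+2*C2))
      have e : 2*(2+2*C2) * (1/(2*(2+2*C2))*X2 + C1*X0) = X2 + 2*(2+2*C2)*(C1*X0) := by
        have : 2+2*C2 ≠ 0 := by positivity
        field_simp
      linarith
    have hh : (2 + 2*C2) * (X1 - (X0 + 2 * C1 * X0)) ≤ 0 := by nlinarith
    have := nonpos_of_mul_nonpos_right hh (by positivity : 0 < 2+2*C2)
    linarith
  have s2' : X2 ≤ (2 + 2*C2) * (1+2*C1+1) * X0 := by nlinarith
  have : C * (X0 + X1 + X2) ≤ C * (X0 + (X0 + 2*C1*X0) + (2 + 2*C2) * (1+2*C1+1) * X0) := by gcongr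
  linarith

end Sys
end TH

namespace TH

def tau1 : Wc := ⟨deriv Real.smoothTransition, (contDiff_infty_iff_deriv.1
    (Real.smoothTransition.contDiff (n := (⊤ : ℕ∞)))).2, by
  refine HasCompactSupport.intro (K := Set.Icc 0 1) isCompact_Icc fun t ht => ?_
  rw [Set.mem_Icc, not_and_or, not_le, not_le] at ht
  rcases ht with ht | ht
  · have : Real.smoothTransition =ᶠ[nhds t] fun _ => 0 := by
      filter_upwards [Iio_mem_nhds ht] with s hs
      exact Real.smoothTransition.zero_of_nonpos (le_of_lt hs)
    rw [this.deriv_eq]; simp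
  · have : Real.smoothTransition =ᶠ[nhds t] fun _ => 1 := by
      filter_upwards [Ioi_mem_nhds ht] with s hs
      exact Real.smoothTransition.one_of_one_le (le_of_lt hs)
    rw [this.deriv_eq]; simp⟩

lemma tau1_zero (l : ℕ) : ∀ t, (t < 0 ∨ 1 < t) → (dW^[l] tau1).1 t = 0 := by
  induction l with
  | zero =>
    intro t ht
    change deriv Real.smoothTransition t = 0
    rcases ht with ht | ht
    · have : Real.smoothTransition =ᶠ[nhds t] fun _ => 0 := by
        filter_upwards [Iio_mem_nhds ht] with s hs
        exact Real.smoothTransition.zero_of_nonpos (le_of_lt hs)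
      rw [this.deriv_eq]; simp
    · have : Real.smoothTransition =ᶠ[nhds t] fun _ => 1 := by
        filter_upwards [Ioi_mem_nhds ht] with s hs
        exact Real.smoothTransition.one_of_one_le (le_of_lt hs)
      rw [this.deriv_eq]; simp
  | succ l ih =>
    intro t ht
    rw [Function.iterate_succ_apply', dW_ap]
    have : (dW^[l] tau1).1 =ᶠ[nhds t] fun _ => 0 := by
      rcases ht with ht | ht
      · filter_upwards [Iio_mem_nhds ht] with s hs using ih s (Or.inl hs)
      · filter_upwards [Ioi_mem_nhds ht] with s hs using ih s (Or.inr hs)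
    rw [this.deriv_eq]; simp

lemma tau1_bd (K : ℕ) (hK : 1 ≤ K) : ∃ B : ℝ, 0 ≤ B ∧ ∀ l ≤ 6, ∀ t,
    |(dW^[l] tau1).1 t| ≤ B * (pw K).1 t := by
  choose B h0 hB using fun l => Wc.bound (dW^[l] tau1)
  refine ⟨∑ l ∈ Finset.range 7, B l, Finset.sum_nonneg fun l _ => h0 l, fun l hl t => ?_⟩
  have hnn : 0 ≤ (pw K).1 t := by rw [pw_ap hK]; exact pow_nonneg (et_nn t) _
  by_cases ht : t < 0 ∨ 1 < t
  · rw [tau1_zero l t ht, abs_zero]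
    exact mul_nonneg (Finset.sum_nonneg fun l _ => h0 l) hnn
  · push Not at ht
    rw [pw_ap hK, et_one ht.1 ht.2, one_pow, mul_one]
    exact (hB l t).trans (Finset.single_le_sum (f := B) (fun l _ => h0 l) (Finset.mem_range.2 (by omega)))

/-- plateau: one on `[-a, b]` -/
def plat (a b : ℝ) : Wc := ⟨fun t => Real.smoothTransition (t + a + 1) - Real.smoothTransition (t - b),
  by
    refine ContDiff.sub ?_ ?_
    · exact (Real.smoothTransition.contDiff (n := (⊤ : ℕ∞))).comp (by fun_prop)
    · exact (Real.smoothTransition.contDiff (n := (⊤ : ℕ∞))).comp (by fun_prop), by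
    refine HasCompactSupport.intro (K := Set.Icc (-|a| -|b| - 1) (|a| + |b| + 1)) isCompact_Icc fun t ht => ?_
    rw [Set.mem_Icc, not_and_or, not_le, not_le] at ht
    have h1 := neg_abs_le a; have h2 := neg_abs_le b
    have h3 := le_abs_self a; have h4 := le_abs_self b
    have h5 := abs_nonneg a; have h6 := abs_nonneg b
    rcases ht with ht | ht
    · rw [Real.smoothTransition.zero_of_nonpos (by linarith), Real.smoothTransition.zero_of_nonpos (by linarith), sub_zero]
    · rw [Real.smoothTransition.one_of_one_le (by linarith), Real.smoothTransition.one_of_one_le (by linarith), sub_self]⟩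

lemma plat_ap (a b t : ℝ) : (plat a b).1 t = Real.smoothTransition (t + a + 1) - Real.smoothTransition (t - b) := rfl

lemma st_mono {s t : ℝ} (h : s ≤ t) : Real.smoothTransition s ≤ Real.smoothTransition t :=
  Real.smoothTransition.monotone h

lemma plat_le (a b t : ℝ) : (plat a b).1 t ≤ 1 := by
  rw [plat_ap]
  linarith [Real.smoothTransition.le_one (t + a + 1), Real.smoothTransition.nonneg (t - b)]
lemma plat_nn {a b : ℝ} (hb : 0 ≤ b) (ha : 0 ≤ a) (t : ℝ) : 0 ≤ (plat a b).1 t := by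
  rw [plat_ap]
  have := st_mono (show t - b ≤ t + a + 1 by linarith)
  linarith
lemma plat_one {a b t : ℝ} (h1 : -a ≤ t) (h2 : t ≤ b) : (plat a b).1 t = 1 := by
  rw [plat_ap, Real.smoothTransition.one_of_one_le (by linarith), Real.smoothTransition.zero_of_nonpos (by linarith), sub_zero]
lemma plat_zero {a b t : ℝ} (h0 : 0 ≤ a) (hb : 0 ≤ b) (h2 : b + 1 ≤ t) : (plat a b).1 t = 0 := by
  rw [plat_ap, Real.smoothTransition.one_of_one_le (by linarith), Real.smoothTransition.one_of_one_le (by linarith), sub_self]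
lemma plat_mono {a b b' : ℝ} (h : b ≤ b') (t : ℝ) : (plat a b).1 t ≤ (plat a b').1 t := by
  rw [plat_ap, plat_ap]
  linarith [st_mono (show t - b' ≤ t - b by linarith)]

lemma tr_dW_iter (s : ℝ) (l : ℕ) (ζ : Wc) : dW^[l] (tr s ζ) = tr s (dW^[l] ζ) := by
  induction l with
  | zero => rfl
  | succ l ih => rw [Function.iterate_succ_apply', ih, Function.iterate_succ_apply', tr_dW]

lemma dW_plat (a b : ℝ) (l : ℕ) : dW^[l+1] (plat a b) = tr (-a-1) (dW^[l] tau1) - tr b (dW^[l] tau1) := by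
  have h1 : dW (plat a b) = tr (-a-1) tau1 - tr b tau1 := by
    apply Subtype.ext; funext t
    rw [dW_ap, Wc.sub_ap, tr_ap, tr_ap]
    have d : ∀ y, DifferentiableAt ℝ Real.smoothTransition y := fun y =>
      (Real.smoothTransition.contDiff (n := 1)).differentiable (by norm_num) y
    change deriv (fun t => Real.smoothTransition (t + a + 1) - Real.smoothTransition (t - b)) t
      = deriv Real.smoothTransition (t - (-a-1)) - deriv Real.smoothTransition (t - b)
    have d1 : DifferentiableAt ℝ (fun t => Real.smoothTransition (t + a + 1)) t :=
      (d (t + a + 1)).comp t (f := fun t => t + a + 1) (by fun_prop)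
    have d2 : DifferentiableAt ℝ (fun t => Real.smoothTransition (t - b)) t :=
      (d (t - b)).comp t (f := fun t => t - b) (by fun_prop)
    rw [deriv_fun_sub d1 d2,
      deriv_comp_sub_const]
    congr 1
    have : (fun t => Real.smoothTransition (t + a + 1)) = fun t => Real.smoothTransition (t - (-a-1)) := by
      funext t; congr 1; ring
    rw [this, deriv_comp_sub_const]
  induction l with
  | zero => exact h1
  | succ l ih =>
    rw [Function.iterate_succ_apply', ih, map_sub, tr_dW, tr_dW, ← Function.iterate_succ_apply' dW]

lemma plat_dom (K : ℕ) (hK : 1 ≤ K) : ∃ c : ℝ, 0 ≤ c ∧ ∀ a b : ℝ, 0 ≤ a → 0 ≤ b →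
    Sys.Dom (plat a b) (c • (tr (-a-1) (pw K) + tr b (pw K))) 6 := by
  obtain ⟨B, hB, h⟩ := tau1_bd K hK
  refine ⟨B + 2 * B^2, by positivity, fun a b ha hb l l' h1 h2 t => ?_⟩
  have nn : ∀ t, 0 ≤ (pw K).1 t := fun t => by rw [pw_ap hK]; exact pow_nonneg (et_nn t) _
  have le1 : ∀ t, (pw K).1 t ≤ 1 := fun t => by rw [pw_ap hK]; exact pow_le_one₀ (et_nn t) (et_le t)
  obtain ⟨P, hP⟩ : ∃ P, P = (pw K).1 (t - (-a-1)) + (pw K).1 (t - b) := ⟨_, rfl⟩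
  have P0 : 0 ≤ P := by rw [hP]; exact add_nonneg (nn _) (nn _)
  have P2 : P ≤ 2 := by rw [hP]; linarith [le1 (t - (-a-1)), le1 (t-b)]
  have key : ∀ l, 1 ≤ l → l ≤ 6 → |(dW^[l] (plat a b)).1 t| ≤ B * P := by
    intro l h1 h2
    obtain ⟨l, rfl⟩ : ∃ j, l = j + 1 := ⟨l - 1, by omega⟩
    rw [dW_plat, Wc.sub_ap, tr_ap, tr_ap, hP, mul_add]
    exact (abs_sub _ _).trans (add_le_add (h l (by omega) _) (h l (by omega) _))
  have z : |(plat a b).1 t| ≤ 1 := abs_le.2 ⟨by linarith [plat_nn hb ha t], plat_le a b t⟩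
  have e : (((B + 2*B^2) • (tr (-a-1) (pw K) + tr b (pw K)) : Wc)).1 t = (B + 2*B^2) * P := by
    rw [Wc.smul_ap, Wc.add_ap, tr_ap, tr_ap, hP]
  rw [e, abs_mul]
  have BP := mul_nonneg hB P0
  rcases Nat.eq_zero_or_pos l with h0 | h0
  · subst h0
    have := mul_le_mul z (key l' (by omega) (by omega)) (abs_nonneg _) zero_le_one
    exact this.trans (by nlinarith [mul_nonneg (sq_nonneg B) P0])
  rcases Nat.eq_zero_or_pos l' with h0' | h0'
  · subst h0'
    have := mul_le_mul (key l (by omega) (by omega)) z (abs_nonneg _) BP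
    exact this.trans (by nlinarith [mul_nonneg (sq_nonneg B) P0])
  · have := mul_le_mul (key l (by omega) (by omega)) (key l' (by omega) (by omega)) (abs_nonneg _) BP
    exact this.trans (by nlinarith [mul_nonneg (sq_nonneg B) P0, mul_nonneg (mul_nonneg (sq_nonneg B) P0) (sub_nonneg.2 P2)])

namespace Sys
variable {p h A T : ℝ}

lemma Full_add (S : Sys p h A T) (χ ξ : Wc) : S.Full (χ + ξ) = S.Full χ + S.Full ξ := by
  simp only [Full, O0, O1, O2, O3, map_add]; ring
lemma Full_smul (S : Sys p h A T) (c : ℝ) (χ : Wc) : S.Full (c • χ) = c * S.Full χ := by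
  simp only [Full, O0, O1, O2, O3, map_smul, smul_eq_mul]; ring
lemma Full_shift (S : Sys p h A T) (s : ℝ) (χ : Wc) : (S.shift s).Full χ = S.Full (tr s χ) := rfl

lemma N_le_Full (S : Sys p h A T) (χ : Wc) (hχ : ∀ t, 0 ≤ χ.1 t) : S.N χ ≤ S.Full χ := by
  have f := fun j a => S.pos j a χ hχ
  simp only [Full, O0, O1, O2, O3]
  linarith [f 0 0, f 0 1, f 1 0, f 0 2, f 1 1, f 2 0, f 0 3, f 1 2, f 2 1, f 3 0]

/-- the bound on one period -/
lemma cacY (p h A : ℝ) (hp : 1 < p) (k : ℕ) (hk : 8 ≤ k) : ∃ ε : ℝ, 0 < ε ∧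
    ∀ {T : ℝ} (S : Sys p h A T) (s CY : ℝ), s + 2 ≤ T →
      S.M 0 0 0 (tr s (pw (2*k-12))) ≤ ε * S.N (tr s (pw (2*k))) + CY →
      S.M 0 0 0 (tr s (pw (2*k-12))) ≤ 2 * CY ∧ ε * S.N (tr s (pw (2*k))) ≤ CY := by
  obtain ⟨C, hC, hc⟩ := cac p h A hp k hk
  refine ⟨1 / (2*(C+1)), by positivity, fun {T} S s CY hs hY => ?_⟩
  have h1 := hc (S.shift s) (by linarith)
  rw [Full_shift] at h1
  change _ ≤ C * S.M 0 0 0 (tr s (pw (2*k-12))) at h1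
  have h2 := S.N_le_Full (tr s (pw (2*k))) (fun t => Sys.pw_nn (by omega) _)
  have h3 := S.pos 0 0 (tr s (pw (2*k-12))) (fun t => Sys.pw_nn (by omega) _)
  have h4 : 1/(2*(C+1)) * S.N (tr s (pw (2*k))) ≤ 1/2 * S.M 0 0 0 (tr s (pw (2*k-12))) := by
    rw [one_div_mul_eq_div, div_le_iff₀ (by positivity)]
    nlinarith
  constructor <;> linarith

lemma liou (p h A : ℝ) (hp : 1 < p) (h0 : 0 ≤ h) (hA : h < A)
    (c20 : 0 ≤ p * (3*A^2 - 8 - 3*h^2) - (3*A^2 - 8))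
    (c10 : 0 ≤ p * (3*A^4 - 16*A^2 + 16 - 6*A^2*h^2 + 3*h^4) - (3*A^4 - 16*A^2 + 16))
    (c00 : 0 < p * (A^2*(A^2-4)^2 - (3*A^4+16)*h^2 + (3*A^2+8)*h^4 - h^6) - A^2*(A^2-4)^2)
    (e01 : 0 < 2*(3*A^4+16) - 4*(3*A^2+8)*h^2 + 6*h^4)
    (e02 : 0 < 4*(3*A^2+8) - 20*h^2) (k : ℕ) (hk : 8 ≤ k) :
    ∃ ε : ℝ, 0 < ε ∧ ∀ (CY c0 s0 : ℝ) (e : ℝ → ℝ), 0 < c0 → 2 ≤ s0 → Tendsto e atBot (nhds 0) →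
    ∃ T0 : ℝ, ∀ {T : ℝ} (S : Sys p h A T), T0 ≤ T →
      (∀ s, s + 2 ≤ T → S.M 0 0 0 (tr s (pw (2*k-12))) ≤ ε * S.N (tr s (pw (2*k))) + CY) →
      (∀ s ≤ 0, S.M 0 0 0 (tr s (pw (2*k-12))) ≤ e s) →
      c0 ≤ S.M 0 0 0 (tr (-s0) et) → False := by
  obtain ⟨C, hC, hc⟩ := cac p h A hp k hk
  obtain ⟨ε, hε, hY⟩ := cacY p h A hp k hk
  obtain ⟨C1, hC1⟩ := main_ineq p h A hp h0 hA c20 c10 c00 e01 e02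
  obtain ⟨c, hcn, hdom⟩ := plat_dom (2*k) (by omega)
  refine ⟨ε, hε, fun CY c0 s0 e hc0 hs0 he => ?_⟩
  set D : ℝ := |C1| * c * C + 1 with hD
  have D1 : 1 ≤ D := by rw [hD]; linarith [mul_nonneg (mul_nonneg (abs_nonneg C1) hcn) hC]
  obtain ⟨S0, hS0, heS⟩ : ∃ S0, s0 + 1 ≤ S0 ∧ D * e (-S0-1) ≤ c0/2 := by
    have h1 : ∀ᶠ s in atBot, e s < c0 / (2*D) := he.eventually (gt_mem_nhds (by positivity))
    obtain ⟨b, hb⟩ := (h1.and (eventually_le_atBot (-s0-2))).exists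
    refine ⟨-b-1, by linarith [hb.2], ?_⟩
    have := hb.1
    rw [show -(-b-1)-1 = b by ring]
    rw [lt_div_iff₀ (by positivity)] at this
    linarith
  obtain ⟨j, hj⟩ := exists_nat_gt ((D * (2*CY) + c0/2) / (c0/(2*D)))
  refine ⟨4*j+4, fun {T} S hT hY1 hE hL => ?_⟩
  obtain ⟨F, hF⟩ : ∃ F : ℝ → ℝ, F = fun b => S.M 0 0 0 (plat S0 b * plat S0 b) := ⟨_, rfl⟩
  have hG : ∀ b, 0 ≤ b → b + 2 ≤ T → F b ≤ D * S.M 0 0 0 (tr b (pw (2*k-12))) + c0/2 := by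
    intro b hb hbT
    have a1 := hC1 S (ζ := plat S0 b) (fun t ht => plat_zero (by linarith) hb (by linarith))
      (hdom S0 b (by linarith) hb)
    have a2 := hc (S.shift b) (by linarith)
    have a3 := hc (S.shift (-S0-1)) (by linarith)
    rw [Full_shift] at a2 a3
    change _ ≤ C * S.M 0 0 0 (tr b (pw (2*k-12))) at a2
    change _ ≤ C * S.M 0 0 0 (tr (-S0-1) (pw (2*k-12))) at a3
    rw [Full_smul, Full_add] at a1
    have a4 := hE (-S0-1) (by linarith)
    have p1 := S.pos 0 0 (tr b (pw (2*k-12))) (fun t => Sys.pw_nn (by omega) _)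
    have p2 := S.pos 0 0 (tr (-S0-1) (pw (2*k-12))) (fun t => Sys.pw_nn (by omega) _)
    have h2k : 1 ≤ 2*k := by omega
    have q1 : 0 ≤ S.Full (tr b (pw (2*k))) :=
      (S.Npos (tr b (pw (2*k))) (fun t => Sys.pw_nn h2k _)).trans (S.N_le_Full _ (fun t => Sys.pw_nn h2k _))
    have q2 : 0 ≤ S.Full (tr (-S0-1) (pw (2*k))) :=
      (S.Npos (tr (-S0-1) (pw (2*k))) (fun t => Sys.pw_nn h2k _)).trans (S.N_le_Full _ (fun t => Sys.pw_nn h2k _))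
    have a5 : F b ≤ |C1| * (c * (S.Full (tr (-S0-1) (pw (2*k))) + S.Full (tr b (pw (2*k))))) := by
      rw [hF]; exact a1.trans (mul_le_mul_of_nonneg_right (le_abs_self _) (by positivity))
    have a6 : |C1| * (c * (S.Full (tr (-S0-1) (pw (2*k))) + S.Full (tr b (pw (2*k)))))
      ≤ |C1| * (c * (C * S.M 0 0 0 (tr (-S0-1) (pw (2*k-12))) + C * S.M 0 0 0 (tr b (pw (2*k-12))))) := by
      gcongr
    have a7 : D * S.M 0 0 0 (tr (-S0-1) (pw (2*k-12))) ≤ D * e (-S0-1) := by gcongr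
    have a8 : |C1| * (c * (C * S.M 0 0 0 (tr (-S0-1) (pw (2*k-12))) + C * S.M 0 0 0 (tr b (pw (2*k-12)))))
      = (D - 1) * S.M 0 0 0 (tr (-S0-1) (pw (2*k-12))) + (D-1) * S.M 0 0 0 (tr b (pw (2*k-12))) := by
      rw [hD]; ring
    linarith
  have hB : ∀ b, 0 ≤ b → b + 2 ≤ T → F b ≤ D * (2*CY) + c0/2 := by
    intro b hb hbT
    have := (hY S b CY hbT (hY1 b hbT)).1
    have := mul_le_mul_of_nonneg_left this (by linarith : 0 ≤ D)
    linarith [hG b hb hbT]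
  have hF0 : ∀ b, 0 ≤ b → c0 ≤ F b := by
    intro b hb
    refine hL.trans ?_
    rw [hF]
    refine S.mono fun t => ?_
    rw [tr_ap, Wc.mul_ap]
    by_cases ht : -S0 ≤ t ∧ t ≤ b
    · rw [plat_one ht.1 ht.2, mul_one]; exact et_le _
    · rw [not_and_or, not_le, not_le] at ht
      rw [et_zero (by rcases ht with h | h; · left; linarith
                      · right; linarith)]
      exact mul_self_nonneg _
  have hstep : ∀ b, 0 ≤ b → b + 4 ≤ T → F b + c0/(2*D) ≤ F (b+4) := by
    intro b hb hbT
    have g1 := hG (b+2) (by linarith) (by linarith)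
    have g2 : S.M 0 0 0 (tr (b+2) (pw (2*k-12))) ≤ F (b+4) - F b := by
      rw [hF, ← map_sub]
      refine S.mono fun t => ?_
      rw [tr_ap, Wc.sub_ap, Wc.mul_ap, Wc.mul_ap]
      have m := plat_mono (a := S0) (show b ≤ b+4 by linarith) t
      have n := plat_nn hb (by linarith : 0 ≤ S0) t
      by_cases ht : b+1 ≤ t ∧ t ≤ b+4
      · rw [plat_one (by linarith) ht.2, plat_zero (by linarith) hb ht.1, pw_ap (by omega)]
        have := pow_le_one₀ (n := 2*k-12) (et_nn (t - (b+2))) (et_le _)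
        linarith
      · rw [not_and_or, not_le, not_le] at ht
        rw [pw_ap (by omega), et_zero (by rcases ht with h | h; · left; linarith
                                          · right; linarith), zero_pow (by omega)]
        nlinarith
    have g3 := hF0 (b+2) (by linarith)
    have g4 := mul_le_mul_of_nonneg_left g2 (by linarith : 0 ≤ D)
    have g5 : c0/2 ≤ D * (F (b+4) - F b) := by linarith
    have g6 : c0/(2*D) = (c0/2)/D := by field_simp
    have : (c0/2)/D ≤ F (b+4) - F b := by rw [div_le_iff₀ (by linarith)]; linarith
    linarith
  have hind : ∀ i : ℕ, i ≤ j → i * (c0/(2*D)) ≤ F (4*i) := by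
    intro i
    induction i with
    | zero =>
      intro _
      have := hF0 0 le_rfl
      simp; linarith
    | succ i ih =>
      intro hi
      have hi' : (i:ℝ) + 1 ≤ j := by exact_mod_cast hi
      have := hstep (4*i) (by positivity) (by linarith)
      have := ih (by omega)
      push_cast
      rw [show 4 * ((i:ℝ)+1) = 4*i+4 by ring]
      linarith
  have := hind j le_rfl
  have := hB (4*j) (by positivity) (by linarith)
  rw [div_lt_iff₀ (by positivity)] at hj
  linarith

end Sys
end TH

namespace TH
variable {n : ℕ}

structure Sol (p : ℝ) (v : Eu n → ℝ) : Prop where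
  sm : Smooth v
  eq : ∀ x, laplacian (laplacian (laplacian v)) x = -(|v x| ^ (p - 1) * v x)

def StabOn (p : ℝ) (v : Eu n → ℝ) (R : ℝ) : Prop := ∀ φ : Eu n → ℝ, Smooth φ → HasCompactSupport φ →
  tsupport φ ⊆ Metric.closedBall 0 R →
      p * (∫ x, |v x| ^ (p - 1) * φ x ^ 2) ≤ ∫ x, ‖gradient (laplacian φ) x‖ ^ 2

open Classical in
def emb (v : Eu n → ℝ) (hv : Smooth v) : SS n := ⟨fun x => if x = 0 then 0 else v x, by
  refine ⟨by simp, fun x hx => ?_⟩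
  refine (hv.contDiffAt (x := x)).congr_of_eventuallyEq ?_
  filter_upwards [sub_smooth_ne hx] with y hy
  simp [hy]⟩

lemma emb_ap (v : Eu n → ℝ) (hv : Smooth v) {x : Eu n} (hx : x ≠ 0) : (emb v hv).1 x = v x := by
  simp [emb, hx]

lemma Lo_near (f : SS n) {x : Eu n} (hx : x ≠ 0) : (Lo f).1 =ᶠ[nhds x] laplacian f.1 := by
  filter_upwards [sub_smooth_ne hx] with y hy using Lo_ap f hy

lemma Lo3_ap (f : SS n) {x : Eu n} (hx : x ≠ 0) :
    (Lo (Lo (Lo f))).1 x = laplacian (laplacian (laplacian f.1)) x := by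
  rw [Lo_ap _ hx]
  have h1 : (Lo (Lo f)).1 =ᶠ[nhds x] laplacian (laplacian f.1) :=
    (Lo_near _ hx).trans (laplacian_congr (Lo_near _ hx))
  exact (laplacian_congr h1).self_of_nhds

def Top (h : ℝ) (f : SS n) : SS n := Bop (h + 3 - 4) (Bop (h + 3 - 2) (Bop (h + 3) f))

lemma JM0 (f g : SS n) (ζ : Wc) : J (f * g) ζ = Mj 0 f g ζ := rfl
lemma JM1 (f g : SS n) (ζ : Wc) : J (f * Mu g) ζ = Mj 1 f g ζ := J_Mu _ _ _
lemma JM2 (f g : SS n) (ζ : Wc) : J (f * Mu (Mu g)) ζ = Mj 2 f g ζ := J_Mu2 _ _ _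
lemma JM3 (f g : SS n) (ζ : Wc) : J (f * Mu (Mu (Mu g))) ζ = Mj 3 f g ζ := J_Mu3 _ _ _

lemma J_Top (h A : ℝ) (hA : A = (n : ℝ) / 2 - 1) (f g : SS n) (ζ : Wc) :
   Mj 3 g f ζ + (3*A^2 - 8 - 3*h^2) * Mj 2 g f ζ
        + (3*A^4 - 16*A^2 + 16 - 6*A^2*h^2 + 3*h^4) * Mj 1 g f ζ
        + (A^2*(A^2-4)^2 - (3*A^4+16)*h^2 + (3*A^2+8)*h^4 - h^6) * Mj 0 g f ζ
      + ((-6*h) * Mj 2 g (Do f) ζ + (-12*A^2*h + 12*h^3) * Mj 1 g (Do f) ζ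
        + (-2*(3*A^4+16)*h + 4*(3*A^2+8)*h^3 - 6*h^5) * Mj 0 g (Do f) ζ)
      + ((-3) * Mj 2 g (Do (Do f)) ζ + (-6*A^2 + 18*h^2) * Mj 1 g (Do (Do f)) ζ
        + (-(3*A^4+16) + 6*(3*A^2+8)*h^2 - 15*h^4) * Mj 0 g (Do (Do f)) ζ)
      + ((12*h) * Mj 1 g (Do (Do (Do f))) ζ + (4*(3*A^2+8)*h - 20*h^3) * Mj 0 g (Do (Do (Do f))) ζ)
      + (3 * Mj 1 g (Do (Do (Do (Do f)))) ζ + (3*A^2+8 - 15*h^2) * Mj 0 g (Do (Do (Do (Do f)))) ζ)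
      + (-6*h) * Mj 0 g (Do (Do (Do (Do (Do f))))) ζ - Mj 0 g (Do (Do (Do (Do (Do (Do f)))))) ζ
      = J (g * Top h f) ζ := by
  rw [Top, Tform h A hA]
  simp only [mul_add, mul_sub, mul_smul_comm, map_add, map_sub, map_smul, LinearMap.add_apply,
    LinearMap.sub_apply, LinearMap.smul_apply, smul_eq_mul]
  simp only [JM3]
  simp only [JM2]
  simp only [JM1]
  simp only [JM0]

lemma J_stab (A : ℝ) (hA : A = (n : ℝ) / 2 - 1) (f : SS n) (ζ : Wc) :
  ∫ x, (rmW ζ f * Top 0 (rmW ζ f)).1 x =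
        Mj 3 f f (ζ * ζ) + (3*A^2 - 8) * Mj 2 f f (ζ * ζ)
        + (3*A^4 - 16*A^2 + 16) * Mj 1 f f (ζ * ζ) + (A^2*(A^2-4)^2) * Mj 0 f f (ζ * ζ)
        + ((-3) * (Mj 2 f (Do (Do f)) (ζ * ζ) + 2 * Mj 2 f (Do f) (ζ * dW ζ) + Mj 2 f f (ζ * dW (dW ζ)))
          + (-6*A^2) * (Mj 1 f (Do (Do f)) (ζ * ζ) + 2 * Mj 1 f (Do f) (ζ * dW ζ) + Mj 1 f f (ζ * dW (dW ζ)))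
          + (-(3*A^4+16)) * (Mj 0 f (Do (Do f)) (ζ * ζ) + 2 * Mj 0 f (Do f) (ζ * dW ζ)
              + Mj 0 f f (ζ * dW (dW ζ))))
        + (3 * (Mj 1 f (Do (Do (Do (Do f)))) (ζ * ζ) + 4 * Mj 1 f (Do (Do (Do f))) (ζ * dW ζ) + 6 * Mj 1 f (Do (Do f)) (ζ * dW (dW ζ))
              + 4 * Mj 1 f (Do f) (ζ * dW (dW (dW ζ))) + Mj 1 f f (ζ * dW (dW (dW (dW ζ)))))
          + (3*A^2+8) * (Mj 0 f (Do (Do (Do (Do f)))) (ζ * ζ) + 4 * Mj 0 f (Do (Do (Do f))) (ζ * dW ζ) + 6 * Mj 0 f (Do (Do f)) (ζ * dW (dW ζ))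
              + 4 * Mj 0 f (Do f) (ζ * dW (dW (dW ζ))) + Mj 0 f f (ζ * dW (dW (dW (dW ζ))))))
        - (Mj 0 f (Do (Do (Do (Do (Do (Do f)))))) (ζ * ζ) + 6 * Mj 0 f (Do (Do (Do (Do (Do f))))) (ζ * dW ζ) + 15 * Mj 0 f (Do (Do (Do (Do f)))) (ζ * dW (dW ζ))
              + 20 * Mj 0 f (Do (Do (Do f))) (ζ * dW (dW (dW ζ))) + 15 * Mj 0 f (Do (Do f)) (ζ * dW (dW (dW (dW ζ))))
              + 6 * Mj 0 f (Do f) (ζ * dW (dW (dW (dW (dW ζ)))))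
              + Mj 0 f f (ζ * dW (dW (dW (dW (dW (dW ζ))))))) := by
  have hI : ∃ I : SS n →ₗ[ℝ] ℝ, ∀ g : SS n, ∀ ξ, I (rmW ξ g) = J (f * g) (ζ * ξ) ∧
    I (Top 0 (rmW ζ f)) = ∫ x, (rmW ζ f * Top 0 (rmW ζ f)).1 x := by
    have hIntg : ∀ g : SS n, Integrable (rmW ζ f * g).1 := fun g => by
      have : rmW ζ f * g = rmW ζ (f * g) := SS.ext' fun x _ => by simp [rmW_ap]; ring
      rw [this]; exact rmW_int _ _
    refine ⟨⟨⟨fun g => ∫ x, (rmW ζ f * g).1 x, fun a b => ?_⟩, fun c a => ?_⟩, fun g ξ => ⟨?_, rfl⟩⟩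
    · rw [mul_add]; exact integral_add (hIntg a) (hIntg b)
    · change ∫ x, (rmW ζ f * c • a).1 x = _
      rw [mul_smul_comm]; exact integral_const_mul _ _
    · change ∫ x, (rmW ζ f * rmW ξ g).1 x = _
      rw [rmW_mul]; rfl
  obtain ⟨I, hI⟩ := hI
  rw [← (hI 0 0).2, Top, Tform 0 A hA]
  simp only [Do_rmW, map_add, Mu_rmW, map_sub, map_smul, smul_eq_mul, (hI _ _).1]
  simp only [JM3]
  simp only [JM2]
  simp only [JM1]
  simp only [JM0]
  ring

section concrete
variable (p : ℝ) (v : Eu n → ℝ) (hv : Sol p v)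

def mm (p : ℝ) : ℝ := 6 / (p - 1)
def hh (n : ℕ) (p : ℝ) : ℝ := (n : ℝ) / 2 - 3 - mm p

/-- Emden–Fowler type variable -/
def ww (hv : Sol p v) : SS n := rp (mm p - (n:ℝ)/2) (emb v hv.sm)

lemma ww_ap {x : Eu n} (hx : x ≠ 0) : (ww p v hv).1 x = ‖x‖ ^ (mm p - (n:ℝ)/2) * v x := by
  rw [ww, rp_ap _ _ hx, emb_ap _ _ hx]

lemma Tw_ap {x : Eu n} (hx : x ≠ 0) :
    (Top (hh n p) (ww p v hv)).1 x = ‖x‖ ^ (3 - hh n p) * (|v x| ^ (p-1) * v x) := by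
  have h1 : rp (hh n p + 3) (ww p v hv) = emb v hv.sm := by
    rw [ww, rp_rp, show hh n p + 3 + (mm p - (n:ℝ)/2) = 0 by rw [hh]; ring, rp_zero]
  have h2 := Lo3_rp (hh n p + 3) (ww p v hv)
  rw [h1] at h2
  have h3 := congrArg (fun g : SS n => g.1 x) h2
  simp only [SS.neg_ap] at h3
  rw [Lo3_ap _ hx, rp_ap _ _ hx] at h3
  have h4 : (emb v hv.sm).1 =ᶠ[nhds x] v := by
    filter_upwards [sub_smooth_ne hx] with y hy using emb_ap _ _ hy
  rw [(laplacian_congr (laplacian_congr (laplacian_congr h4))).self_of_nhds, hv.eq] at h3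
  rw [neg_inj.1 h3, ← mul_assoc, ← Real.rpow_add (norm_pos_iff.2 hx),
    show 3 - hh n p + (hh n p + 3 - 6) = 0 by ring, Real.rpow_zero, one_mul]
  rfl

lemma wT_ap (hp : 1 < p) {x : Eu n} (hx : x ≠ 0) :
    (ww p v hv * Top (hh n p) (ww p v hv)).1 x = ‖x‖ ^ (-2 * hh n p) * |v x| ^ (p+1) := by
  rw [SS.mul_ap, ww_ap p v hv hx, Tw_ap p v hv hx]
  have e1 : ‖x‖ ^ (-2 * hh n p) = ‖x‖ ^ (mm p - (n:ℝ)/2) * ‖x‖ ^ (3 - hh n p) := by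
    rw [← Real.rpow_add (norm_pos_iff.2 hx)]; congr 1; rw [hh]; ring
  have e2 : |v x| ^ (p+1) = |v x| ^ (p-1) * (v x * v x) := by
    rcases eq_or_ne (v x) 0 with h | h
    · rw [h, abs_zero, Real.zero_rpow (by linarith)]; simp
    · rw [show p + 1 = (p - 1) + 2 by ring, Real.rpow_add (abs_pos.2 h)]
      congr 1
      rw [Real.rpow_two, sq_abs, sq]
  rw [e1, e2]; ring

lemma eq1_aux (hp : 1 < p) : Xo (ww p v hv * Top (hh n p) (ww p v hv)) + (n:ℝ) • (ww p v hv * Top (hh n p) (ww p v hv))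
    = (p + 1) • (Do (ww p v hv) * Top (hh n p) (ww p v hv)) := by
  refine SS.ext' fun x hx => ?_
  set V := emb v hv.sm with hV
  -- the derivative of the potential
  have r0 := norm_pos_iff.2 hx
  have hd : HasFDerivAt (fun y => |v y| ^ (p+1)) (((p+1) * |v x| ^ (p-1) * v x) • fderiv ℝ v x) x := by
    have := (hasDerivAt_abs_rpow (v x) (p := p+1) (by linarith)).comp_hasFDerivAt x (hv.sm.diff x).hasFDerivAt
    rw [show p + 1 - 2 = p - 1 by ring] at this
    exact this
  have hψ : (ww p v hv * Top (hh n p) (ww p v hv)).1 =ᶠ[nhds x]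
      fun y => (fun t => Real.exp ((-2 * hh n p) * t)) (Real.log ‖y‖) * |v y| ^ (p+1) := by
    filter_upwards [sub_smooth_ne hx] with y hy
    rw [wT_ap p v hv hp hy, Real.rpow_def_of_pos (norm_pos_iff.2 hy), mul_comm (Real.log _)]
  have hsm : ContDiff ℝ (⊤ : ℕ∞) (fun t => Real.exp ((-2 * hh n p) * t)) := by fun_prop
  have hX : (Xo (ww p v hv * Top (hh n p) (ww p v hv))).1 x
      = ‖x‖ ^ (-2 * hh n p) * ((-2 * hh n p) * |v x| ^ (p+1) + (p+1) * |v x| ^ (p-1) * v x * XX v x) := by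
    rw [Xo_ap, XX, vf, hψ.fderiv_eq]
    rw [((SmAt.diffAt (diff_radial hsm hx)).hasFDerivAt.fun_mul hd).fderiv]
    simp only [_root_.add_apply, _root_.smul_apply, smul_eq_mul]
    rw [fderiv_radial hsm hx]
    have e : deriv (fun t => Real.exp ((-2 * hh n p) * t)) (Real.log ‖x‖) = (-2 * hh n p) * ‖x‖ ^ (-2 * hh n p) := by
      rw [Real.rpow_def_of_pos r0, mul_comm (Real.log _)]
      have := ((hasDerivAt_id (Real.log ‖x‖)).const_mul (-2 * hh n p)).exp
      rw [mul_one] at this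
      rw [mul_comm (-2 * hh n p) (Real.exp _)]; exact this.deriv
    rw [e, real_inner_self_eq_norm_sq, Real.rpow_def_of_pos r0, mul_comm (Real.log _)]
    field_simp
    simp only [XX, vf]
    ring
  have hD : (Do (ww p v hv)).1 x = ‖x‖ ^ (mm p - (n:ℝ)/2) * (mm p * v x + XX v x) := by
    rw [ww, Do_rp, rp_ap _ _ hx, SS.add_ap, SS.smul_ap, Do_eq, SS.add_ap, SS.smul_ap, Xo_ap, emb_ap _ _ hx]
    have h4 : (emb v hv.sm).1 =ᶠ[nhds x] v := by
      filter_upwards [sub_smooth_ne hx] with y hy using emb_ap _ _ hy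
    simp only [XX, vf]
    rw [h4.fderiv_eq]
    ring
  rw [SS.add_ap, SS.smul_ap, SS.smul_ap, hX, SS.mul_ap (Do _), hD, wT_ap p v hv hp hx, Tw_ap p v hv hx]
  have e1 : ‖x‖ ^ (-2 * hh n p) = ‖x‖ ^ (mm p - (n:ℝ)/2) * ‖x‖ ^ (3 - hh n p) := by
    rw [← Real.rpow_add (norm_pos_iff.2 hx)]; congr 1; rw [hh]; ring
  have e2 : |v x| ^ (p+1) = |v x| ^ (p-1) * (v x * v x) := by
    rcases eq_or_ne (v x) 0 with h | h
    · rw [h, abs_zero, Real.zero_rpow (by linarith)]; simp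
    · rw [show p + 1 = (p - 1) + 2 by ring, Real.rpow_add (abs_pos.2 h)]
      congr 1
      rw [Real.rpow_two, sq_abs, sq]
  have e3 : (p + 1) * mm p = n - 2 * hh n p := by
    rw [hh, mm]; have : p - 1 ≠ 0 := by linarith
    field_simp; ring
  rw [e1, e2]
  linear_combination (-(‖x‖ ^ (mm p - (n:ℝ)/2) * ‖x‖ ^ (3 - hh n p) * |v x| ^ (p-1) * v x ^ 2)) * e3

lemma w2_ap {x : Eu n} (hx : x ≠ 0) :
    (ww p v hv * Top (hh n p) (ww p v hv)).1 x = |v x| ^ (p-1) * (‖x‖ ^ (3:ℝ) * (ww p v hv).1 x) ^ 2 := by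
  rw [SS.mul_ap, ww_ap p v hv hx, Tw_ap p v hv hx]
  have e1 : ‖x‖ ^ (3 - hh n p) = ‖x‖ ^ (3:ℝ) * ‖x‖ ^ (3:ℝ) * ‖x‖ ^ (mm p - (n:ℝ)/2) := by
    rw [← Real.rpow_add (norm_pos_iff.2 hx), ← Real.rpow_add (norm_pos_iff.2 hx)]
    congr 1; rw [hh]; ring
  rw [e1]; ring

lemma ae_ne {n : ℕ} (hn : 1 ≤ n) : ∀ᵐ x : Eu n, x ≠ 0 := by
  have : Nonempty (Fin n) := ⟨⟨0, hn⟩⟩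
  rw [ae_iff]; simp

lemma stab_aux (hn : 1 ≤ n) (T : ℝ) (hst : StabOn p v (Real.exp T)) (ζ : Wc)
    (hζ : ∀ t, T ≤ t → ζ.1 t = 0) :
    p * J (ww p v hv * Top (hh n p) (ww p v hv)) (ζ * ζ) ≤
      ∫ x, (rmW ζ (ww p v hv) * Top 0 (rmW ζ (ww p v hv))).1 x := by
  set w := ww p v hv with hw
  have h1 := hst (rmW ζ (rp 3 w)).1 (rmW_smooth _ _) (rmW_supp _ _) (by
    apply closure_minimal _ Metric.isClosed_closedBall
    intro x hx
    rw [Function.mem_support, rmW_ap] at hx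
    rw [mem_closedBall_zero_iff]
    by_contra hc
    push Not at hc
    apply hx
    rw [hζ _ ?_, zero_mul]
    rw [Real.le_log_iff_exp_le ((Real.exp_pos T).trans hc)]
    exact hc.le)
  rw [energy (rmW_smooth _ _) (rmW_supp _ _)] at h1
  have e1 : ∫ x, |v x| ^ (p-1) * (rmW ζ (rp 3 w)).1 x ^ 2 = J (w * Top (hh n p) w) (ζ * ζ) := by
    rw [J_ap]
    apply integral_congr_ae
    filter_upwards [ae_ne hn] with x hx
    rw [rmW_ap, rmW_ap, hw, w2_ap p v hv hx, rp_ap _ _ hx, Wc.mul_ap]; ring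
  have e2 : -∫ x, (rmW ζ (rp 3 w)).1 x * laplacian (laplacian (laplacian (rmW ζ (rp 3 w)).1)) x
      = ∫ x, (rmW ζ w * Top 0 (rmW ζ w)).1 x := by
    rw [← integral_neg]
    apply integral_congr_ae
    filter_upwards [ae_ne hn] with x hx
    rw [← Lo3_ap _ hx, ← rp_rmW, show (3:ℝ) = 0 + 3 by norm_num, Lo3_rp, SS.neg_ap, rp_ap _ _ hx, rp_ap _ _ hx, SS.mul_ap]
    have : ‖x‖ ^ (0 + 3 : ℝ) * ‖x‖ ^ (0 + 3 - 6 : ℝ) = 1 := by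
      rw [← Real.rpow_add (norm_pos_iff.2 hx)]; norm_num
    rw [Top]
    linear_combination ((rmW ζ w).1 x * (Bop (0 + 3 - 4) (Bop (0 + 3 - 2) (Bop (0 + 3) (rmW ζ w)))).1 x) * this
  rw [e1, e2] at h1
  exact h1

def csys (hn : 1 ≤ n) (hp : 1 < p) (T : ℝ) (hst : StabOn p v (Real.exp T)) : Sys p (hh n p) ((n:ℝ)/2 - 1) T where
  M j a b := Mj j (Do^[a] (ww p v hv)) (Do^[b] (ww p v hv))
  N := J (ww p v hv * Top (hh n p) (ww p v hv))
  symm j a b := Mj_symm _ _ _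
  ibp j a b ζ := by
    rw [Function.iterate_succ_apply', Function.iterate_succ_apply']
    exact Mj_ibp _ _ _ _
  pos j a ζ h := Mj_pos j _ h
  Npos ζ h := by
    rw [J_ap]
    apply integral_nonneg_of_ae
    filter_upwards [ae_ne hn] with x hx
    rw [rmW_ap, wT_ap p v hv hp hx]
    have := h (Real.log ‖x‖)
    positivity
  am0 a b ε hε ζ ξ := by
    have := J_amgm hε (Do^[b] (ww p v hv)) (-(Do^[a] (ww p v hv))) ζ ξ
    have n1 : ∀ f g : SS n, (-f) * (-g) = f * g := fun f g => SS.ext' fun x _ => by simp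
    have n2 : ∀ f g : SS n, f * (-g) = -(g * f) := fun f g => SS.ext' fun x _ => by simp; ring
    rw [n1, n2, map_neg, LinearMap.neg_apply] at this
    exact this
  in1 a ε hε ζ ξ := by
    have := J_amgm hε (Mu (Do^[a] (ww p v hv))) (Do^[a] (ww p v hv)) ζ ξ
    rw [mul_comm (Mu (Do^[a] (ww p v hv))) (Do^[a] (ww p v hv)), J_Mu] at this
    exact this
  in2 a ε hε ζ ξ := by
    have := Q1_amgm hε (Mu (Do^[a] (ww p v hv))) (Do^[a] (ww p v hv)) ζ ξ
    rw [← J_Mu] at this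
    exact this
  eq0 ζ := J_Top (hh n p) _ rfl (ww p v hv) (ww p v hv) ζ
  eq1 ζ := by
    refine (J_Top (hh n p) _ rfl (ww p v hv) (Do (ww p v hv)) ζ).trans ?_
    have h1 := J_Xo (ww p v hv * Top (hh n p) (ww p v hv)) ζ
    have h2 := congrArg (fun f => J f ζ) (eq1_aux p v hv hp)
    simp only [map_add, map_smul, LinearMap.add_apply, LinearMap.smul_apply, smul_eq_mul] at h2
    rw [eq_div_iff (by linarith)]
    linarith
  stab ζ hζ := (stab_aux p v hv hn T hst ζ hζ).trans (J_stab _ rfl (ww p v hv) ζ).le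

end concrete
end TH

namespace TH
variable {n : ℕ}

def rn (n : ℕ) : SS n := rp (-(n:ℝ)) (emb (fun _ => 1) contDiff_const)

lemma rn_ap {x : Eu n} (hx : x ≠ 0) : (rn n).1 x = ‖x‖ ^ (-(n:ℝ)) := by
  rw [rn, rp_ap _ _ hx, emb_ap _ _ hx, mul_one]

lemma J_rn (hn : 1 ≤ n) (s : ℝ) (ζ : Wc) : J (rn n) (tr s ζ) = J (rn n) ζ := by
  rw [J_ap, J_ap]
  have h := Measure.integral_comp_smul (volume : Measure (Eu n)) (rmW (tr s ζ) (rn n)).1 (Real.exp s)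
  rw [finrank_euclideanSpace_fin] at h
  have e : ∀ᵐ x : Eu n, (rmW (tr s ζ) (rn n)).1 (Real.exp s • x) = ((Real.exp s)^n)⁻¹ * (rmW ζ (rn n)).1 x := by
    filter_upwards [ae_ne hn] with x hx
    have hx' : Real.exp s • x ≠ 0 := smul_ne_zero (Real.exp_pos s).ne' hx
    have r0 := norm_pos_iff.2 hx
    rw [rmW_ap, rmW_ap, rn_ap hx, rn_ap hx', tr_ap, norm_smul, Real.norm_of_nonneg (Real.exp_pos s).le,
      Real.log_mul (Real.exp_pos s).ne' r0.ne', Real.log_exp, add_sub_cancel_left,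
      Real.mul_rpow (Real.exp_pos s).le r0.le, Real.rpow_neg (Real.exp_pos s).le, Real.rpow_natCast]
    ring
  rw [integral_congr_ae e, integral_const_mul, abs_of_pos (by positivity), smul_eq_mul] at h
  exact (mul_left_cancel₀ (by positivity) h).symm

lemma rn_nn (x : Eu n) : 0 ≤ (rn n).1 x := by
  by_cases hx : x = 0
  · rw [hx, SS.zero]
  · rw [rn_ap hx]; positivity

lemma J_rn_pos (hn : 1 ≤ n) : 0 < J (rn n) et := by
  rw [J_ap]
  refine Continuous.integral_pos_of_hasCompactSupport_nonneg_nonzero (x := ee ⟨0, hn⟩)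
    (rmW_smooth et (rn n)).continuous (rmW_supp _ _) (fun x => ?_) ?_
  · rw [rmW_ap]; exact mul_nonneg (et_nn _) (rn_nn _)
  · have h1 : ‖(ee ⟨0, hn⟩ : Eu n)‖ = 1 := by simp [ee]
    have h0 : (ee ⟨0, hn⟩ : Eu n) ≠ 0 := by rw [← norm_pos_iff, h1]; norm_num
    rw [rmW_ap, rn_ap h0, h1, Real.log_one, et_one le_rfl (by norm_num), Real.one_rpow]
    norm_num

/-- comparison up to the origin -/
lemma J_mono' {f g : SS n} {ζ ξ : Wc}
    (h : ∀ x : Eu n, x ≠ 0 → ζ.1 (Real.log ‖x‖) * f.1 x ≤ ξ.1 (Real.log ‖x‖) * g.1 x) : J f ζ ≤ J g ξ := by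
  refine J_mono fun x => ?_
  by_cases hx : x = 0
  · rw [hx, SS.zero, SS.zero]; simp
  · exact h x hx

section
variable (p : ℝ) (v : Eu n → ℝ) (hv : Sol p v)

lemma ww2 {x : Eu n} (hx : x ≠ 0) : (ww p v hv * ww p v hv).1 x = ‖x‖ ^ (-(n:ℝ)) * (‖x‖ ^ (mm p) * |v x|) ^ 2 := by
  have r0 := norm_pos_iff.2 hx
  rw [SS.mul_ap, ww_ap p v hv hx, mul_pow, sq_abs]
  have : ‖x‖ ^ (mm p - (n:ℝ)/2) * ‖x‖ ^ (mm p - (n:ℝ)/2) = ‖x‖ ^ (-(n:ℝ)) * (‖x‖ ^ mm p * ‖x‖ ^ mm p) := by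
    rw [← Real.rpow_add r0, ← Real.rpow_add r0, ← Real.rpow_add r0]; congr 1; ring
  linear_combination (v x)^2 * this

lemma wT2 (hp : 1 < p) {x : Eu n} (hx : x ≠ 0) : (ww p v hv * Top (hh n p) (ww p v hv)).1 x
    = ‖x‖ ^ (-(n:ℝ)) * (‖x‖ ^ (mm p) * |v x|) ^ (p+1) := by
  have r0 := norm_pos_iff.2 hx
  rw [wT_ap p v hv hp hx, Real.mul_rpow (by positivity) (by positivity), ← mul_assoc]
  congr 1
  rw [← Real.rpow_mul r0.le, ← Real.rpow_add r0]
  congr 1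
  rw [hh, mm]; have : p - 1 ≠ 0 := by linarith
  field_simp; ring

lemma young_pt (hp : 1 < p) (k : ℕ) (hk : 24 / (p-1) + 13 ≤ 2*k) {ε : ℝ} (hε : 0 < ε)
    (η ω : ℝ) (h0 : 0 ≤ η) (h1 : η ≤ 1) (hω : 0 ≤ ω) :
    η ^ (2*k-12) * ω ^ 2 ≤ ε * (η ^ (2*k) * ω ^ (p+1)) + (1/ε) ^ (2/(p-1)) * η := by
  have hp' : 0 < p - 1 := by linarith
  have hk' : 13 ≤ 2*k := by
    have : (0:ℝ) ≤ 24/(p-1) := by positivity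
    have : (13:ℝ) ≤ 2*k := by linarith
    exact_mod_cast this
  rcases h0.eq_or_lt with h0 | h0
  · rw [← h0, zero_pow (by omega), zero_pow (by omega)]; simp
  rcases hω.eq_or_lt with hω | hω
  · rw [← hω]; simp only [ne_eq, OfNat.ofNat_ne_zero, not_false_eq_true, zero_pow, mul_zero]; positivity
  have e1 : η ^ (2*k) = η ^ (2*k-12) * η ^ 12 := by rw [← pow_add]; congr 1; omega
  have e2 : ω ^ (p+1) = ω ^ (p-1) * ω ^ 2 := by
    rw [← Real.rpow_two, ← Real.rpow_add hω]; congr 1; ring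
  by_cases hc : 1 ≤ ε * (η ^ 12 * ω ^ (p-1))
  · have : η ^ (2*k-12) * ω ^ 2 * 1 ≤ η ^ (2*k-12) * ω ^ 2 * (ε * (η ^ 12 * ω ^ (p-1))) := by gcongr
    have h3 : 0 ≤ (1/ε) ^ (2/(p-1)) * η := by positivity
    rw [e1, e2]; nlinarith
  · push Not at hc
    have h4 : ω ^ (p-1) ≤ (1/ε) * η ^ (-(12:ℝ)) := by
      rw [Real.rpow_neg h0.le, show (12:ℝ) = ((12:ℕ):ℝ) by norm_num, Real.rpow_natCast]
      rw [one_div, ← mul_inv, ← one_div, le_div_iff₀ (by positivity)]; linarith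
    have h5 := Real.rpow_le_rpow (by positivity) h4 (by positivity : 0 ≤ 2/(p-1))
    rw [← Real.rpow_mul hω.le, Real.mul_rpow (by positivity) (by positivity), ← Real.rpow_mul h0.le,
      mul_div_cancel₀ _ hp'.ne', Real.rpow_two] at h5
    have h6 : η ^ (2*k-12) * η ^ (-12 * (2/(p-1))) ≤ η := by
      rw [← Real.rpow_natCast, ← Real.rpow_add h0]
      conv_rhs => rw [← Real.rpow_one η]
      apply Real.rpow_le_rpow_of_exponent_ge h0 h1
      rw [Nat.cast_sub (by omega)]
      push_cast
      have : -12 * (2/(p-1)) = - (24/(p-1)) := by ring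
      rw [this]; linarith
    have h7 : η ^ (2*k-12) * ω ^ 2 ≤ η ^ (2*k-12) * ((1/ε) ^ (2/(p-1)) * η ^ (-12 * (2/(p-1)))) := by gcongr
    have h8 : (1/ε) ^ (2/(p-1)) * (η ^ (2*k-12) * η ^ (-12 * (2/(p-1)))) ≤ (1/ε) ^ (2/(p-1)) * η := by gcongr
    have h9 : 0 ≤ ε * (η ^ (2*k) * ω ^ (p+1)) := by positivity
    linarith

lemma M000 (hn : 1 ≤ n) (hp : 1 < p) (T : ℝ) (hst : StabOn p v (Real.exp T)) :
  (csys p v hv hn hp T hst).M 0 0 0 = J (ww p v hv * ww p v hv) := rfl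
lemma csysN (hn : 1 ≤ n) (hp : 1 < p) (T : ℝ) (hst : StabOn p v (Real.exp T)) :
  (csys p v hv hn hp T hst).N = J (ww p v hv * Top (hh n p) (ww p v hv)) := rfl

lemma young (hn : 1 ≤ n) (hp : 1 < p) (k : ℕ) (hk : 24 / (p-1) + 13 ≤ 2*k) {ε : ℝ} (hε : 0 < ε) (s : ℝ) :
    J (ww p v hv * ww p v hv) (tr s (pw (2*k-12))) ≤
      ε * J (ww p v hv * Top (hh n p) (ww p v hv)) (tr s (pw (2*k))) + (1/ε) ^ (2/(p-1)) * J (rn n) et := by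
  have hk' : 13 ≤ 2*k := by
    have hp' : 0 < p - 1 := by linarith
    have : (0:ℝ) ≤ 24/(p-1) := by positivity
    have : (13:ℝ) ≤ 2*k := by linarith
    exact_mod_cast this
  have e : ε * J (ww p v hv * Top (hh n p) (ww p v hv)) (tr s (pw (2*k))) + (1/ε) ^ (2/(p-1)) * J (rn n) et
      = ∫ x, (ε • rmW (tr s (pw (2*k))) (ww p v hv * Top (hh n p) (ww p v hv))
        + ((1/ε) ^ (2/(p-1))) • rmW (tr s et) (rn n)).1 x := by
    rw [← J_rn hn s et]
    simp only [SS.add_ap, SS.smul_ap]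
    rw [integral_add ((rmW_int _ _).const_mul _) ((rmW_int _ _).const_mul _),
      integral_const_mul, integral_const_mul]
    rfl
  rw [e, J_ap]
  refine integral_mono_ae (rmW_int _ _) (((rmW_int _ _).const_mul _).add ((rmW_int _ _).const_mul _)) ?_
  filter_upwards [ae_ne hn] with x hx
  simp only [SS.add_ap, SS.smul_ap, rmW_ap]
  rw [ww2 p v hv hx, wT2 p v hv hp hx, rn_ap hx, tr_ap, tr_ap, tr_ap, pw_ap (by omega), pw_ap (by omega)]
  have := young_pt p hp k hk hε (et.1 (Real.log ‖x‖ - s)) (‖x‖ ^ (mm p) * |v x|) (et_nn _) (et_le _) (by positivity)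
  have h2 : 0 ≤ ‖x‖ ^ (-(n:ℝ)) := by positivity
  nlinarith [mul_le_mul_of_nonneg_left this h2]

lemma small (hn : 1 ≤ n) (hp : 1 < p) (k : ℕ) (hk : 8 ≤ k) {B R : ℝ} (hB : ∀ x, ‖x‖ ≤ R → |v x| ≤ B) (hR : Real.exp 2 ≤ R)
    (s : ℝ) (hs : s ≤ 0) : J (ww p v hv * ww p v hv) (tr s (pw (2*k-12))) ≤
      B^2 * (Real.exp (s+2)) ^ (2 * mm p) * J (rn n) et := by
  have hm : 0 < mm p := div_pos (by norm_num) (by linarith)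
  have e : B^2 * (Real.exp (s+2)) ^ (2 * mm p) * J (rn n) et = J ((B^2 * (Real.exp (s+2)) ^ (2 * mm p)) • rn n) (tr s et) := by
    rw [map_smul, LinearMap.smul_apply, smul_eq_mul, J_rn hn]
  rw [e]
  refine J_mono' fun x hx => ?_
  have r0 := norm_pos_iff.2 hx
  rw [ww2 p v hv hx, SS.smul_ap, rn_ap hx, tr_ap, tr_ap, pw_ap (by omega)]
  by_cases ht : 2 ≤ Real.log ‖x‖ - s
  · rw [et_zero (Or.inr ht), zero_pow (by omega)]; simp
  · push Not at ht
    have h1 : ‖x‖ ≤ Real.exp (s+2) := by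
      rw [← Real.log_le_iff_le_exp r0]; linarith
    have h2 := hB x (h1.trans ((Real.exp_le_exp.2 (by linarith)).trans hR))
    have h3 : (‖x‖ ^ mm p * |v x|) ^ 2 ≤ B^2 * (Real.exp (s+2)) ^ (2 * mm p) := by
      rw [mul_pow, mul_comm, ← Real.rpow_two, ← Real.rpow_two, ← Real.rpow_mul r0.le, mul_comm (mm p)]
      rw [← Real.rpow_two]
      have := abs_nonneg (v x)
      have hB0 := this.trans h2
      gcongr
    have h4 : et.1 (Real.log ‖x‖ - s) ^ (2*k-12) ≤ et.1 (Real.log ‖x‖ - s) := by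
      have := pow_le_pow_of_le_one (et_nn (Real.log ‖x‖ - s)) (et_le _) (show 1 ≤ 2*k-12 by omega)
      rwa [pow_one] at this
    have := et_nn (Real.log ‖x‖ - s)
    calc _ ≤ et.1 (Real.log ‖x‖ - s) * (‖x‖ ^ (-(n:ℝ)) * (B^2 * (Real.exp (s+2)) ^ (2 * mm p))) := by gcongr
      _ = _ := by ring

lemma large (hn : 1 ≤ n) (hp : 1 < p) {s0 : ℝ} (hB : ∀ x, ‖x‖ ≤ Real.exp (2-s0) → 1/2 ≤ |v x|) :
   (1/4) * (Real.exp (-s0-1)) ^ (2 * mm p) * J (rn n) et ≤ J (ww p v hv * ww p v hv) (tr (-s0) et) := by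
  have hm : 0 < mm p := div_pos (by norm_num) (by linarith)
  have e : (1/4) * (Real.exp (-s0-1)) ^ (2 * mm p) * J (rn n) et = J (((1/4) * (Real.exp (-s0-1)) ^ (2 * mm p)) • rn n) (tr (-s0) et) := by
    rw [map_smul, LinearMap.smul_apply, smul_eq_mul, J_rn hn]
  rw [e]
  refine J_mono' fun x hx => ?_
  have r0 := norm_pos_iff.2 hx
  rw [ww2 p v hv hx, SS.smul_ap, rn_ap hx, tr_ap]
  by_cases ht : 2 ≤ Real.log ‖x‖ - (-s0) ∨ Real.log ‖x‖ - (-s0) ≤ -1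
  · rw [et_zero ht.symm]; simp
  · push Not at ht
    have h1 : ‖x‖ ≤ Real.exp (2-s0) := by
      rw [← Real.log_le_iff_le_exp r0]; linarith
    have h1' : Real.exp (-s0-1) ≤ ‖x‖ := by
      rw [← Real.le_log_iff_exp_le r0]; linarith
    have h2 := hB x h1
    have h3 : (1/4) * (Real.exp (-s0-1)) ^ (2 * mm p) ≤ (‖x‖ ^ mm p * |v x|) ^ 2 := by
      rw [mul_pow, mul_comm (_^2), ← Real.rpow_two, ← Real.rpow_two, ← Real.rpow_mul r0.le, mul_comm (mm p)]
      have : (1/4 : ℝ) ≤ |v x| ^ 2 := by nlinarith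
      rw [← Real.rpow_two] at this
      gcongr
    have := et_nn (Real.log ‖x‖ - (-s0))
    calc _ = et.1 (Real.log ‖x‖ - (-s0)) * (‖x‖ ^ (-(n:ℝ)) * ((1/4) * (Real.exp (-s0-1)) ^ (2 * mm p))) := by ring
      _ ≤ _ := by gcongr

end
end TH

namespace TH
variable {n : ℕ}

def StabAt (p : ℝ) (v : Eu n → ℝ) (y : Eu n) (R : ℝ) : Prop := ∀ φ : Eu n → ℝ, Smooth φ → HasCompactSupport φ →
  tsupport φ ⊆ Metric.closedBall y R →
      p * (∫ x, |v x| ^ (p - 1) * φ x ^ 2) ≤ ∫ x, ‖gradient (laplacian φ) x‖ ^ 2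

def sca (y : Eu n) (l : ℝ) (f : Eu n → ℝ) : Eu n → ℝ := fun z => f (y + l • z)

lemma sca_smooth (y : Eu n) (l : ℝ) {f : Eu n → ℝ} (hf : Smooth f) : Smooth (sca y l f) :=
  hf.comp (by fun_prop : ContDiff ℝ (⊤ : ℕ∞) (fun z : Eu n => y + l • z))

lemma fderiv_sca (y : Eu n) (l : ℝ) {F : Type*} [NormedAddCommGroup F] [NormedSpace ℝ F] {f : Eu n → F}
    (hf : Differentiable ℝ f) (x : Eu n) :
    fderiv ℝ (fun z => f (y + l • z)) x = l • fderiv ℝ f (y + l • x) := by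
  have h1 : HasFDerivAt (fun z : Eu n => y + l • z) (l • ContinuousLinearMap.id ℝ (Eu n)) x := by
    simpa using ((hasFDerivAt_id x).const_smul l).const_add y
  have h2 := (hf (y + l • x)).hasFDerivAt.comp x h1
  rw [show (fun z => f (y + l • z)) = f ∘ (fun z : Eu n => y + l • z) from rfl, h2.fderiv]
  ext w; simp

lemma lap_smul (c : ℝ) {f : Eu n → ℝ} (hf : Smooth f) : laplacian (fun x => c * f x) = fun x => c * laplacian f x := by
  funext x
  rw [laplacian_eq' (contDiff_const.mul hf), laplacian_eq' hf, Finset.mul_sum]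
  refine Finset.sum_congr rfl fun i _ => ?_
  have e : ∀ (g : Eu n → ℝ) (hg : Smooth g), ∀ y, fderiv ℝ (fun x => c * g x) y (ee i) = c * fderiv ℝ g y (ee i) := by
    intro g hg y
    rw [fderiv_const_mul (hg.diff y)]; simp
  rw [show (fun y => fderiv ℝ (fun x => c * f x) y (ee i)) = fun y => c * fderiv ℝ f y (ee i) from funext (e f hf)]
  exact e _ (hf.pd _) x

lemma lap_sca (y : Eu n) (l : ℝ) {f : Eu n → ℝ} (hf : Smooth f) :
    laplacian (sca y l f) = fun x => l^2 * sca y l (laplacian f) x := by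
  funext x
  rw [laplacian_eq' (sca_smooth y l hf), sca, laplacian_eq' hf, Finset.mul_sum]
  refine Finset.sum_congr rfl fun i _ => ?_
  have e : ∀ z, fderiv ℝ (sca y l f) z (ee i) = l * (fun w => fderiv ℝ f w (ee i)) (y + l • z) := by
    intro z
    unfold sca
    rw [fderiv_sca y l hf.diff]; simp
  rw [show (fun y_1 => fderiv ℝ (sca y l f) y_1 (ee i)) = _ from funext e]
  have hs : Smooth (fun z : Eu n => (fun w => fderiv ℝ f w (ee i)) (y + l • z)) := sca_smooth y l (hf.pd (ee i))
  rw [fderiv_const_mul (hs.diff x), fderiv_sca y l (hf.pd (ee i)).diff]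
  simp; ring

lemma lap_csca (c : ℝ) (y : Eu n) (l : ℝ) {f : Eu n → ℝ} (hf : Smooth f) :
    laplacian (fun x => c * sca y l f x) = fun x => (c * l^2) * sca y l (laplacian f) x := by
  rw [lap_smul c (sca_smooth y l hf), lap_sca y l hf]; funext x; ring

lemma int_sca (y : Eu n) {l : ℝ} (hl : 0 < l) (f : Eu n → ℝ) : ∫ z, sca y l f z = (l^n)⁻¹ * ∫ x, f x := by
  have h := Measure.integral_comp_smul (volume : Measure (Eu n)) (fun x => f (y + x)) l
  rw [finrank_euclideanSpace_fin, abs_of_pos (by positivity), integral_add_left_eq_self, smul_eq_mul] at h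
  exact h

lemma resc {p : ℝ} (hp : 1 < p) {u : Eu n → ℝ} (hu : Sol p u) (y : Eu n) {l : ℝ} (hl : 0 < l) :
    Sol p (fun z => l ^ (mm p) * u (y + l • z)) := by
  have hm : mm p * (p-1) = 6 := by rw [mm]; have : p - 1 ≠ 0 := by linarith
                                   field_simp
  refine ⟨contDiff_const.mul (sca_smooth y l hu.sm), fun x => ?_⟩
  have e0 : (fun z => l ^ (mm p) * u (y + l • z)) = fun z => l ^ (mm p) * sca y l u z := rfl
  rw [e0, lap_csca _ _ _ hu.sm, lap_csca _ _ _ (laplacian_smooth hu.sm),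
    lap_csca _ _ _ (laplacian_smooth (laplacian_smooth hu.sm))]
  simp only [sca]
  rw [hu.eq, abs_mul, abs_of_pos (Real.rpow_pos_of_pos hl (mm p)), Real.mul_rpow (by positivity) (by positivity), ← Real.rpow_mul hl.le, hm]
  rw [show (6:ℝ) = ((6:ℕ):ℝ) by norm_num, Real.rpow_natCast]
  ring

lemma resc_stab {p : ℝ} (hp : 1 < p) {u : Eu n → ℝ} (y : Eu n) {l : ℝ} (hl : 0 < l) {R : ℝ}
    (hs : StabAt p u y (l * R)) : StabOn p (fun z => l ^ (mm p) * u (y + l • z)) R := by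
  have hm : mm p * (p-1) = 6 := by rw [mm]; have : p - 1 ≠ 0 := by linarith
                                   field_simp
  intro φ hφ hc hsup
  set ψ : Eu n → ℝ := sca (-(l⁻¹ • y)) l⁻¹ φ with hψ
  have hψs : Smooth ψ := sca_smooth _ _ hφ
  have hφψ : sca y l ψ = φ := by
    funext z; simp only [hψ, sca]
    congr 1
    rw [smul_add, smul_smul, inv_mul_cancel₀ hl.ne', one_smul]; abel
  have hsub : tsupport ψ ⊆ Metric.closedBall y (l*R) := by
    apply closure_minimal _ Metric.isClosed_closedBall
    intro x hx
    have : φ (-(l⁻¹ • y) + l⁻¹ • x) ≠ 0 := hx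
    have := hsup (subset_tsupport _ this)
    rw [mem_closedBall_zero_iff, ← smul_neg, ← smul_add, norm_smul, Real.norm_of_nonneg (by positivity),
      inv_mul_le_iff₀ hl] at this
    rw [mem_closedBall_iff_norm]
    rwa [neg_add_eq_sub] at this
  have hψc : HasCompactSupport ψ := IsCompact.of_isClosed_subset (isCompact_closedBall y (l*R)) (isClosed_tsupport _) hsub
  have h := hs ψ hψs hψc hsub
  have i1 := int_sca y hl (fun x => |u x| ^ (p - 1) * ψ x ^ 2)
  have i2 := int_sca y hl (fun x => ‖gradient (laplacian ψ) x‖ ^ 2)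
  have e1 : ∀ z, |l ^ (mm p) * u (y + l • z)| ^ (p - 1) * φ z ^ 2 = l^6 * sca y l (fun x => |u x| ^ (p - 1) * ψ x ^ 2) z := by
    intro z
    rw [← hφψ]; simp only [sca]
    rw [abs_mul, abs_of_pos (Real.rpow_pos_of_pos hl (mm p)), Real.mul_rpow (by positivity) (by positivity), ← Real.rpow_mul hl.le, hm]
    rw [show (6:ℝ) = ((6:ℕ):ℝ) by norm_num, Real.rpow_natCast]
    ring
  have e2 : ∀ z, ‖gradient (laplacian φ) z‖ ^ 2 = l^6 * sca y l (fun x => ‖gradient (laplacian ψ) x‖ ^ 2) z := by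
    intro z
    rw [← hφψ]
    have gn : ∀ (f : Eu n → ℝ) x, ‖gradient f x‖ = ‖fderiv ℝ f x‖ := by
      intro f x; rw [gradient]; simp
    simp only [sca, gn]
    change ‖fderiv ℝ (laplacian (sca y l ψ)) z‖ ^ 2 = _
    rw [lap_sca y l hψs]
    have hs2 : Smooth (sca y l (laplacian ψ)) := sca_smooth y l (laplacian_smooth hψs)
    rw [fderiv_const_mul (hs2.diff z)]
    unfold sca
    rw [fderiv_sca y l (laplacian_smooth hψs).diff, norm_smul, norm_smul, Real.norm_of_nonneg (by positivity),
      Real.norm_of_nonneg (by positivity)]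
    ring
  simp only [e1, e2]
  rw [integral_const_mul, integral_const_mul, i1, i2]
  have : 0 ≤ l^6 * (l^n)⁻¹ := by positivity
  nlinarith [mul_le_mul_of_nonneg_left h this]

end TH

namespace TH
variable {n : ℕ}

def QL (n : ℕ) (p : ℝ) : Prop := ∀ B δ : ℝ, 0 < δ → ∃ R0 : ℝ, 0 < R0 ∧ ∀ (v : Eu n → ℝ) (R : ℝ), Sol p v → R0 ≤ R → StabOn p v R →
  (∀ x, ‖x‖ ≤ R → |v x| ≤ B) → (∀ x, ‖x‖ ≤ δ → 1/2 ≤ |v x|) → False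

lemma exists_k (p : ℝ) : ∃ k : ℕ, 8 ≤ k ∧ 24 / (p-1) + 13 ≤ 2*k := by
  obtain ⟨k, hk⟩ := exists_nat_gt (24 / (p-1) + 13)
  refine ⟨k + 8, by omega, ?_⟩
  push_cast; linarith [(Nat.cast_nonneg k : (0:ℝ) ≤ k)]

lemma StabOn.mono {p : ℝ} {v : Eu n → ℝ} {R R' : ℝ} (h : StabOn p v R) (hR : R' ≤ R) : StabOn p v R' :=
  fun φ a b c => h φ a b (c.trans (Metric.closedBall_subset_closedBall hR))

lemma QL_pos (hn : 1 ≤ n) (p : ℝ) (hp : 1 < p) (A h : ℝ) (hAe : A = (n:ℝ)/2-1) (hhe : h = hh n p) (h0 : 0 ≤ h) (hA : h < A)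
    (c20 : 0 ≤ p * (3*A^2 - 8 - 3*h^2) - (3*A^2 - 8))
    (c10 : 0 ≤ p * (3*A^4 - 16*A^2 + 16 - 6*A^2*h^2 + 3*h^4) - (3*A^4 - 16*A^2 + 16))
    (c00 : 0 < p * (A^2*(A^2-4)^2 - (3*A^4+16)*h^2 + (3*A^2+8)*h^4 - h^6) - A^2*(A^2-4)^2)
    (e01 : 0 < 2*(3*A^4+16) - 4*(3*A^2+8)*h^2 + 6*h^4)
    (e02 : 0 < 4*(3*A^2+8) - 20*h^2) : QL n p := by
  intro B δ hδ
  have hm : 0 < mm p := div_pos (by norm_num) (by linarith)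
  obtain ⟨k, hk8, hk⟩ := exists_k p
  obtain ⟨ε, hε, hl⟩ := Sys.liou p h A hp h0 hA c20 c10 c00 e01 e02 k hk8
  have hJ := J_rn_pos hn
  set s0 : ℝ := max 2 (2 - Real.log δ) with hs0
  have hs2 : 2 ≤ s0 := le_max_left _ _
  have hsd : Real.exp (2-s0) ≤ δ := by
    rw [← Real.le_log_iff_exp_le hδ]; linarith [le_max_right 2 (2 - Real.log δ)]
  obtain ⟨T0, hT⟩ := hl ((1/ε) ^ (2/(p-1)) * J (rn n) et) ((1/4) * (Real.exp (-s0-1)) ^ (2 * mm p) * J (rn n) et) s0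
    (fun s => B^2 * (Real.exp (s+2)) ^ (2 * mm p) * J (rn n) et) (by positivity) hs2 (by
      have h1 : Tendsto (fun s : ℝ => Real.exp (s+2)) atBot (nhds 0) :=
        Real.tendsto_exp_atBot.comp (tendsto_atBot_add_const_right _ _ tendsto_id)
      have h2 := h1.rpow_const (p := 2 * mm p) (Or.inr (by positivity))
      rw [Real.zero_rpow (by positivity)] at h2
      simpa using (h2.const_mul (B^2)).mul_const (J (rn n) et))
  refine ⟨Real.exp (max T0 2), Real.exp_pos _, fun v R hv hR hst hB hv2 => ?_⟩
  have hR0 : 0 < R := (Real.exp_pos _).trans_le hR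
  have hR2 : Real.exp 2 ≤ R := (Real.exp_le_exp.2 (le_max_right _ _)).trans hR
  have hTR : T0 ≤ Real.log R := by
    rw [Real.le_log_iff_exp_le hR0]; exact (Real.exp_le_exp.2 (le_max_left _ _)).trans hR
  have hst' : StabOn p v (Real.exp (Real.log R)) := by rwa [Real.exp_log hR0]
  have S := csys p v hv hn hp (Real.log R) hst'
  subst hAe hhe
  refine hT (csys p v hv hn hp (Real.log R) hst') hTR (fun s hs => ?_) (fun s hs => ?_) ?_
  · rw [M000, csysN]; exact young p v hv hn hp k hk hε s
  · rw [M000]; exact small p v hv hn hp k hk8 hB hR2 s hs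
  · rw [M000]; exact large p v hv hn hp (fun x hx => hv2 x (hx.trans hsd))

lemma QL_neg (hn : 1 ≤ n) (p : ℝ) (hp : 1 < p) (h0 : hh n p < 0) : QL n p := by
  intro B δ hδ
  obtain ⟨k, hk8, hk⟩ := exists_k p
  obtain ⟨ε, hε, hl⟩ := Sys.cacY p (hh n p) ((n:ℝ)/2-1) hp k hk8
  set q := Real.exp (1/2) with hq
  have hq1 : 1 < q := by rw [hq, ← Real.exp_zero]; exact Real.exp_lt_exp.2 (by norm_num)
  set c : ℝ := (1/2)^(p+1) * (volume : Measure (Eu n)).real (Metric.ball 0 δ) with hc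
  have hc0 : 0 < c := by
    have : 0 < (volume : Measure (Eu n)).real (Metric.ball 0 δ) :=
      ENNReal.toReal_pos (Metric.measure_ball_pos _ _ hδ).ne' measure_ball_lt_top.ne
    positivity
  set CY := (1/ε) ^ (2/(p-1)) * J (rn n) et with hCY
  obtain ⟨s, hs1, hs2⟩ : ∃ s : ℝ, δ < Real.exp s * (q-1) ∧ CY < ε * (Real.exp (-(2*hh n p)*s) * c) := by
    have t1 : Tendsto (fun s : ℝ => Real.exp s * (q-1)) atTop atTop :=
      Real.tendsto_exp_atTop.atTop_mul_const (by linarith)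
    have t2 : Tendsto (fun s : ℝ => ε * (Real.exp (-(2*hh n p)*s) * c)) atTop atTop :=
      ((Real.tendsto_exp_atTop.comp (tendsto_id.const_mul_atTop (by linarith))).atTop_mul_const hc0).const_mul_atTop hε
    obtain ⟨s, hs⟩ := ((t1.eventually_gt_atTop δ).and (t2.eventually_gt_atTop CY)).exists
    exact ⟨s, hs⟩
  refine ⟨2 * Real.exp (s+3), by positivity, fun v R hv hR hst hB hv2 => ?_⟩
  set x0 : Eu n := Real.exp (s+1/2) • ee ⟨0, hn⟩ with hx0
  have h1 : ‖(ee ⟨0, hn⟩ : Eu n)‖ = 1 := by simp [ee]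
  have hnx : ‖x0‖ = Real.exp (s+1/2) := by
    rw [hx0, norm_smul, h1, mul_one, Real.norm_of_nonneg (Real.exp_pos _).le]
  have hat : StabAt p v (-x0) (1 * Real.exp (s+3)) := fun φ a b d => hst φ a b (d.trans (by
    apply Metric.closedBall_subset_closedBall'
    rw [dist_zero_right, norm_neg, hnx]
    have : Real.exp (s+1/2) ≤ Real.exp (s+3) := Real.exp_le_exp.2 (by linarith)
    linarith))
  have hv' := resc hp hv (-x0) (l := 1) one_pos
  have hst' := resc_stab hp (-x0) (l := 1) one_pos hat
  set w : Eu n → ℝ := fun z => (1:ℝ) ^ (mm p) * v (-x0 + (1:ℝ) • z) with hw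
  have hwv : ∀ z, w z = v (z - x0) := by intro z; rw [hw]; simp [neg_add_eq_sub]
  have hfin := (hl (csys p w hv' hn hp (s+3) hst') s CY (by linarith)
    (by rw [M000, csysN]; exact young p w hv' hn hp k hk hε s)).2
  rw [csysN, J_ap] at hfin
  have key : Real.exp (-(2*hh n p)*s) * c ≤ ∫ x, (rmW (tr s (pw (2*k))) (ww p w hv' * Top (hh n p) (ww p w hv'))).1 x := by
    have hvol : (volume : Measure (Eu n)).real (Metric.ball x0 δ) = (volume : Measure (Eu n)).real (Metric.ball 0 δ) := by
      rw [Measure.real, Measure.real, Measure.addHaar_ball_center]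
    calc Real.exp (-(2*hh n p)*s) * c = ∫ x in Metric.ball x0 δ, Real.exp (-(2*hh n p)*s) * (1/2)^(p+1) := by
          rw [setIntegral_const, hvol, hc, smul_eq_mul]; ring
      _ ≤ ∫ x in Metric.ball x0 δ, (rmW (tr s (pw (2*k))) (ww p w hv' * Top (hh n p) (ww p w hv'))).1 x := by
          refine setIntegral_mono_on (integrableOn_const (measure_ball_lt_top.ne)) (rmW_int _ _).integrableOn measurableSet_ball ?_
          intro x hx
          rw [mem_ball_iff_norm] at hx
          have hq2 : Real.exp (s+1/2) = Real.exp s * q := by rw [Real.exp_add]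
          have hq3 : Real.exp (s+1) = Real.exp s * q * q := by
            rw [hq, mul_assoc, ← Real.exp_add, ← Real.exp_add]; norm_num
          have r1 : Real.exp s ≤ ‖x‖ := by
            have := norm_sub_norm_le x0 x
            rw [norm_sub_rev] at this
            nlinarith
          have r2 : ‖x‖ ≤ Real.exp (s+1) := by
            have := norm_sub_norm_le x x0
            have : Real.exp s * (q-1) ≤ Real.exp s * (q-1) * q := le_mul_of_one_le_right (by nlinarith [Real.exp_pos s]) hq1.le
            nlinarith
          have r0 : 0 < ‖x‖ := (Real.exp_pos s).trans_le r1
          have hx0' : x ≠ 0 := norm_pos_iff.1 r0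
          rw [rmW_ap, tr_ap, pw_ap (by omega), et_one (by
            rw [sub_nonneg, Real.le_log_iff_exp_le r0]; exact r1) (by
            rw [sub_le_iff_le_add, Real.log_le_iff_le_exp r0, add_comm]; exact r2), one_pow, one_mul,
            wT2 p w hv' hp hx0', Real.mul_rpow (by positivity) (by positivity), ← mul_assoc, ← Real.rpow_mul r0.le,
            ← Real.rpow_add r0]
          have ex : -(n:ℝ) + mm p * (p+1) = -(2*hh n p) := by
            rw [hh, mm]; have : p - 1 ≠ 0 := by linarith
            field_simp; ring
          have h5 : 1/2 ≤ |w x| := by rw [hwv]; exact hv2 _ hx.le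
          have h6 : Real.exp (-(2*hh n p)*s) ≤ ‖x‖ ^ (-(2*hh n p)) := by
            rw [mul_comm, Real.exp_mul]
            exact Real.rpow_le_rpow (Real.exp_pos _).le r1 (by linarith)
          rw [ex]
          have hp1 : 0 ≤ p + 1 := by linarith
          gcongr
      _ ≤ _ := by
          refine setIntegral_le_integral (rmW_int _ _) (Eventually.of_forall fun x => ?_)
          change 0 ≤ _
          by_cases hx : x = 0
          · rw [hx, SS.zero]
          rw [rmW_ap, tr_ap, wT2 p w hv' hp hx]
          have := Sys.pw_nn (show 1 ≤ 2*k by omega) (Real.log ‖x‖ - s)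
          positivity
  nlinarith [mul_le_mul_of_nonneg_left key hε.le]

end TH

namespace TH

def gg (N y : ℝ) : ℝ := (N^2-y)*((N+2)^2-y)*((N-2)^2-y)

lemma gg_anti {N y y' : ℝ} (hN : 2 < N) (h : y ≤ y') (h' : y' ≤ (N-2)^2) : gg N y' ≤ gg N y := by
  unfold gg
  have a1 : 0 ≤ (N-2)^2 - y' := by linarith
  have a2 : 0 ≤ N^2 - y' := by nlinarith
  have a3 : 0 ≤ (N+2)^2 - y' := by nlinarith
  have a4 : 0 ≤ N^2 - y := by linarith
  have a5 : 0 ≤ (N+2)^2 - y := by linarith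
  gcongr

lemma gg_strict {N y y' : ℝ} (hN : 2 < N) (h : y < y') (h' : y' ≤ (N-2)^2) : gg N y' < gg N y := by
  unfold gg
  have a1 : 0 ≤ (N-2)^2 - y' := by linarith
  have a2 : 0 < N^2 - y' := by nlinarith
  have a3 : 0 < (N+2)^2 - y' := by nlinarith
  have a4 : 0 ≤ N^2 - y := by linarith
  have h1 : (N^2-y')*((N+2)^2-y') ≤ (N^2-y)*((N+2)^2-y) := by gcongr
  have h2 : 0 < (N^2-y')*((N+2)^2-y') := by positivity
  calc (N^2-y')*((N+2)^2-y')*((N-2)^2-y') < (N^2-y')*((N+2)^2-y')*((N-2)^2-y) := by gcongr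
    _ ≤ _ := by
      have : 0 ≤ (N-2)^2-y := by linarith
      gcongr

lemma gg_one {N : ℝ} (hN : 3 < N) : ((N-1)*(N+1)*(N-3))^2 < gg N 1 := by
  have e : gg N 1 - ((N-1)*(N+1)*(N-3))^2 = ((N-1)*(N+1))^2*(N-3)*6 := by unfold gg; ring
  have : 0 < ((N-1)*(N+1))^2*(N-3)*6 := by
    have : 0 < N - 1 := by linarith
    have : 0 < N - 3 := by linarith
    have : 0 < N + 1 := by linarith
    positivity
  linarith

lemma gg_four (N : ℝ) : gg N ((N-4)^2) = 384*(N-1)*(N-2)*(N-3) := by unfold gg; ring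

/-- large dimension -/
lemma gg_four_neg {N : ℝ} (hN : 15/2 ≤ N) : gg N ((N-4)^2) < ((N-1)*(N+1)*(N-3))^2 := by
  rw [gg_four]
  obtain ⟨t, ht⟩ : ∃ t, t = N - 15/2 := ⟨_, rfl⟩
  have h0 : 0 ≤ t := by linarith
  have e : ((N-1)*(N+1)*(N-3))^2 - 384*(N-1)*(N-2)*(N-3) = (N-1)*(N-3)*((N-1)*(N+1)^2*(N-3) - 384*(N-2)) := by ring
  have h1 : 0 < (N-1)*(N+1)^2*(N-3) - 384*(N-2) := by
    have : N = t + 15/2 := by linarith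
    rw [this]; ring_nf; positivity
  have : 0 < N - 1 := by linarith
  have : 0 < N - 3 := by linarith
  have : 0 < (N-1)*(N-3)*((N-1)*(N+1)^2*(N-3) - 384*(N-2)) := by positivity
  linarith

lemma gg_lin {N : ℝ} (hN : 15/2 ≤ N) : gg N (2*N-1) < ((N-1)*(N+1)*(N-3))^2 := by
  obtain ⟨t, ht⟩ : ∃ t, t = N - 15/2 := ⟨_, rfl⟩
  have h0 : 0 ≤ t := by linarith
  have h1 : 0 < ((N-1)*(N+1)*(N-3))^2 - gg N (2*N-1) := by
    have : N = t + 15/2 := by linarith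
    rw [this]; unfold gg; ring_nf; positivity
  linarith

lemma card {x : ℝ} (hx : 15 ≤ x) : gg (x/2) (dfn x ^ 2) = ((x/2-1)*(x/2+1)*(x/2-3))^2 ∧ 0 ≤ dfn x ∧ dfn x < x/2 - 4 := by
  obtain ⟨t, ht⟩ : ∃ t, t = x - 15 := ⟨_, rfl⟩
  have h0 : 0 ≤ t := by linarith
  have hxt : x = t + 15 := by linarith
  have d2 : 0 ≤ dd2 x := by
    rw [hxt]; unfold dd2; ring_nf; positivity
  have d1 : 0 < - dd1 x := by
    rw [hxt]; unfold dd1; ring_nf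
    nlinarith [pow_nonneg h0 2, pow_nonneg h0 3, pow_nonneg h0 4, pow_nonneg h0 5, pow_nonneg h0 6]
  set q : ℝ := 1024 + 768*x^2 with hq
  have hq0 : 0 < q := by positivity
  have hdq : dd1 x ^ 2 - 1296 * dd2 x = q^3 := by rw [hq]; unfold dd1 dd2; ring
  set s := Real.sqrt (dd2 x) with hs
  have hs2 : s^2 = dd2 x := Real.sq_sqrt d2
  have hs0 : 0 ≤ s := Real.sqrt_nonneg _
  have hQ : 0 < -(dd1 x + 36 * s) := by
    by_contra hc
    push Not at hc
    have : (- dd1 x)^2 ≤ (36*s)^2 := by apply pow_le_pow_left₀ d1.le; linarith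
    have h3 : 0 < q^3 := by positivity
    nlinarith
  set D := dd0 x with hD
  have hDD : D = (-(dd1 x + 36 * s)) ^ ((1:ℝ)/3) := rfl
  have hD0 : 0 < D := by rw [hDD]; positivity
  have hD3 : D^3 = -(dd1 x + 36 * s) := by
    rw [hDD, ← Real.rpow_natCast, ← Real.rpow_mul hQ.le]; norm_num
  set E := q / D with hE
  have hE0 : 0 < E := by positivity
  have hDE : D * E = q := by rw [hE]; field_simp
  have hE3 : E^3 = -dd1 x + 36 * s := by
    have : D^3 * E^3 = q^3 := by rw [← mul_pow, hDE]
    rw [hD3, ← hdq, ← hs2] at this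
    have h5 : -(dd1 x + 36 * s) * (E^3 - (-dd1 x + 36 * s)) = 0 := by linear_combination this
    rcases mul_eq_zero.1 h5 with h | h
    · linarith
    · linarith
  set y0 := x^2/4 + 8/3 - (D+E)/24 with hy0
  have hsum : D^3 + E^3 = -2*dd1 x := by rw [hD3, hE3]; ring
  have hg : gg (x/2) y0 = ((x/2-1)*(x/2+1)*(x/2-3))^2 := by
    have h6 : (D+E)^3 = -2*dd1 x + 3*q*(D+E) := by rw [← hsum, ← hDE]; ring
    have : gg (x/2) y0 - ((x/2-1)*(x/2+1)*(x/2-3))^2 = ((D+E)^3 - (-2*dd1 x + 3*q*(D+E)))/13824 := by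
      rw [hy0, hq]; unfold gg dd1; ring
    rw [h6, sub_self, zero_div] at this
    linarith
  have hN : 15/2 ≤ x/2 := by linarith
  have hDE4 : 4*q ≤ (D+E)^2 := by nlinarith [sq_nonneg (D-E)]
  have hle : y0 ≤ (x/2-2)^2 := by
    have : 48*x - 32 ≤ D+E := by
      apply le_of_sq_le_sq _ (by positivity)
      refine le_trans ?_ hDE4
      rw [hq]; nlinarith
    rw [hy0]; nlinarith
  have h1 : 1 < y0 := by
    by_contra hc
    push Not at hc
    have := gg_anti (N := x/2) (by linarith) hc (by nlinarith)
    have := gg_one (N := x/2) (by linarith)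
    linarith
  have h4 : y0 < (x/2-4)^2 := by
    by_contra hc
    push Not at hc
    have := gg_anti (N := x/2) (by linarith) hc hle
    have := gg_four_neg hN
    linarith
  have hd : dfn x ^ 2 = y0 := by
    have e : dfn x = (1/6) * Real.sqrt (36 * y0) := by
      unfold dfn
      congr 2
      rw [hy0, hE, hq, ← hD]
      field_simp
      ring
    rw [e, mul_pow, Real.sq_sqrt (by linarith)]; ring
  have hdn : 0 ≤ dfn x := by unfold dfn; positivity
  refine ⟨by rw [hd, hg], hdn, ?_⟩
  rw [← hd] at h4
  exact lt_of_pow_lt_pow_left₀ 2 (by linarith) h4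

lemma c10_aux {A h : ℝ} (hA2 : 2 < A) (h0 : 0 ≤ h) (b : ℝ) (hAb : A = b + 2) (hhb : h < b)
    (hcases : A ≤ 6 ∨ (13/2 ≤ A ∧ h^2 ≤ 5/2*A + 25/4 ∧ (27/4)*h^2 - 729/16 ≤ h^3)) :
    0 ≤ 3*(2*(3*A^4-16*A^2+16) - (A+4-h)*h^2*(2*A^2-h^2)) := by
  rcases hcases with hc | hc
  · have hb4 : b ≤ 4 := by linarith
    have X : 0 ≤ (b-h)*(6*(b+h)*(2*(b+2)^2-b^2-h^2) - h^2*(2*(b+2)^2-h^2)) := by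
      apply mul_nonneg (by linarith)
      obtain ⟨Z, hZ⟩ : ∃ Z, Z = 2*(b+2)^2-b^2-h^2 := ⟨_, rfl⟩
      have hZ8 : 8*b ≤ Z := by rw [hZ]; nlinarith
      have e : 6*(b+h)*(2*(b+2)^2-b^2-h^2) - h^2*(2*(b+2)^2-h^2) = (6*b + h*(6-h))*Z - h^2*b^2 := by rw [hZ]; ring
      rw [e]
      have h06 : 0 ≤ h*(6-h) := mul_nonneg h0 (by linarith)
      have h1 : 6*b*(8*b) ≤ (6*b + h*(6-h))*Z := by
        apply mul_le_mul _ hZ8 (by linarith) (by linarith)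
        linarith
      have h2 : h^2*b^2 ≤ 16*b^2 := by
        apply mul_le_mul_of_nonneg_right _ (sq_nonneg b)
        nlinarith
      linarith [mul_self_nonneg b, sq b]
    rw [hAb]
    have e3 : 3*(2*(3*(b+2)^4-16*(b+2)^2+16) - (b+2+4-h)*h^2*(2*(b+2)^2-h^2))
      = 3*((b-h)*(6*(b+h)*(2*(b+2)^2-b^2-h^2) - h^2*(2*(b+2)^2-h^2)) + 64*b*(b+1)) := by ring
    rw [e3]
    have : 0 ≤ b := by linarith
    positivity
  · obtain ⟨hA, b1, b2⟩ := hc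
    have k1 : (A+4-h)*h^2 ≤ (A-11/4)*h^2 + 729/16 := by nlinarith
    obtain ⟨H, hH⟩ : ∃ H, H = h^2 := ⟨_, rfl⟩
    have k2 : (A+4-h)*h^2*(2*A^2-h^2) ≤ ((A-11/4)*H + 729/16)*(2*A^2-H) := by
      rw [hH]; apply mul_le_mul_of_nonneg_right k1; nlinarith
    rw [← hH] at b1
    obtain ⟨r, hr⟩ : ∃ r, r = 5/2*A+25/4 := ⟨_, rfl⟩
    have hH0 : 0 ≤ H := by rw [hH]; positivity
    have k3 : ((A-11/4)*H + 729/16)*(2*A^2-H) ≤ ((A-11/4)*r + 729/16)*(2*A^2-r) := by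
      have : 0 ≤ (r-H)*((A-11/4)*(2*A^2-r-H) - 729/16) := by
        apply mul_nonneg (by linarith)
        have : 40 ≤ 2*A^2-r-H := by nlinarith
        nlinarith
      nlinarith
    have k4 : ((A-11/4)*r + 729/16)*(2*A^2-r) ≤ 2*(3*A^4-16*A^2+16) := by
      obtain ⟨t, ht⟩ : ∃ t, t = A - 13/2 := ⟨_, rfl⟩
      have ht0 : 0 ≤ t := by linarith
      have : 0 ≤ 2*(3*A^4-16*A^2+16) - ((A-11/4)*r + 729/16)*(2*A^2-r) := by
        rw [hr, show A = t + 13/2 by linarith]; ring_nf; positivity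
      linarith
    linarith

lemma QL_main {n : ℕ} (hn : 1 ≤ n) (p : ℝ) (hp : 1 < p) (hpc : 15 ≤ n → p < pc n) : QL n p := by
  rcases lt_or_ge (hh n p) 0 with h0 | h0
  · exact QL_neg hn p hp h0
  obtain ⟨h, hhe⟩ : ∃ h, h = hh n p := ⟨_, rfl⟩
  obtain ⟨A, hA⟩ : ∃ A, A = (n:ℝ)/2-1 := ⟨_, rfl⟩
  obtain ⟨m, hm⟩ : ∃ m, m = mm p := ⟨_, rfl⟩
  have hp1 : 0 < p - 1 := by linarith
  have hm0 : 0 < m := by rw [hm]; exact div_pos (by norm_num) hp1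
  have hmh : m = A - 2 - h := by rw [hhe, hA, hh, hm]; ring
  have hpm : p * m = m + 6 := by rw [hm, mm]; field_simp; ring
  rw [← hhe] at h0
  have hN : 3 < (n:ℝ)/2 := by linarith
  have hn7 : 7 ≤ n := by
    have : (6:ℝ) < n := by linarith
    exact_mod_cast this
  have hA2 : 2 < A := by linarith
  -- the main inequality
  have main : ((A+1-1)*(A+1+1)*(A+1-3))^2 < gg (A+1) ((h-1)^2) ∧ (15 ≤ n → (h-1)^2 < 2*(A+1)-1) := by
    have hN' : 3 < A + 1 := by linarith
    rcases lt_or_ge h 1 with h1 | h1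
    · refine ⟨(gg_one hN').trans_le (gg_anti (by linarith) (by nlinarith) ?_), fun _ => by nlinarith⟩
      nlinarith
    · rcases lt_or_ge n 15 with h15 | h15
      · refine ⟨?_, fun h => by omega⟩
        have hlt : (h-1)^2 < (A+1-4)^2 := by
          apply pow_lt_pow_left₀ _ (by linarith) (by norm_num); linarith
        have h2 := gg_strict (N := A+1) (by linarith) hlt (by nlinarith)
        refine lt_of_le_of_lt ?_ h2
        rw [gg_four]
        have hAn : A + 1 = (n:ℝ)/2 := by linarith
        have hA6 : A ≤ 6 := by
          have : (n:ℝ) ≤ 14 := by exact_mod_cast (by omega : n ≤ 14)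
          linarith
        have h8 : 0 ≤ 384*(A-1) - A*(A+2)^2*(A-2) := by
          have e : 384*(A-1) - A*(A+2)^2*(A-2) = (6-A)*((A-2)*(A^2+10*A+64)) + 384 := by ring
          have : 0 ≤ (6-A)*((A-2)*(A^2+10*A+64)) := mul_nonneg (by linarith) (mul_nonneg (by linarith) (by positivity))
          linarith
        have h9 : 0 ≤ A*(A-2)*(384*(A-1) - A*(A+2)^2*(A-2)) := mul_nonneg (mul_nonneg (by linarith) (by linarith)) h8
        nlinarith
      · have hx : (15:ℝ) ≤ n := by exact_mod_cast h15
        obtain ⟨hc1, hc2, hc3⟩ := card hx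
        have hAn : A + 1 = (n:ℝ)/2 := by linarith
        have hpc' := hpc h15
        set d := dfn n with hd
        have hlt : h < 1 + d := by
          rw [pc, lt_div_iff₀ (by linarith)] at hpc'
          have : p * m * ((n:ℝ) - 8 - 2*d) < ((n:ℝ)+4-2*d) * m := by nlinarith
          rw [hpm] at this
          nlinarith
        have hsq : (h-1)^2 < d^2 := by
          apply pow_lt_pow_left₀ _ (by linarith) (by norm_num); linarith
        have hd2 : d^2 ≤ (A+1-2)^2 := by
          rw [hAn]; apply pow_le_pow_left₀ hc2; linarith
        have key : ((A+1-1)*(A+1+1)*(A+1-3))^2 < gg (A+1) ((h-1)^2) := by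
          have := gg_strict (N := A+1) (by linarith) hsq hd2
          rw [hAn] at this ⊢
          rw [hc1] at this
          exact this
        refine ⟨key, fun _ => ?_⟩
        by_contra hc
        push Not at hc
        have h3 := gg_anti (N := A+1) (by linarith) hc (by linarith)
        have h4 := gg_lin (N := A+1) (by linarith)
        linarith
  obtain ⟨main, hy⟩ := main
  have P : ∀ c : ℝ, ∀ d : ℝ, (0 < (m+6)*c - m*d ↔ 0 < p*c - d) ∧ (0 ≤ (m+6)*c - m*d ↔ 0 ≤ p*c - d) := by
    intro c d
    have : (m+6)*c - m*d = m * (p*c - d) := by rw [← hpm]; ring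
    rw [this]
    exact ⟨mul_pos_iff_of_pos_left hm0, mul_nonneg_iff_of_pos_left hm0⟩
  have hcases : A ≤ 6 ∨ (13/2 ≤ A ∧ (h-1)^2 < 2*(A+1)-1) := by
    rcases lt_or_ge n 15 with h15 | h15
    · left
      have : (n:ℝ) ≤ 14 := by exact_mod_cast (by omega : n ≤ 14)
      linarith
    · right
      have hx : (15:ℝ) ≤ n := by exact_mod_cast h15
      exact ⟨by linarith, hy h15⟩
  -- consequences in the large case
  have big : (13/2 ≤ A ∧ (h-1)^2 < 2*(A+1)-1) → h^2 ≤ 5/2*A + 25/4 ∧ (27/4)*h^2 - 729/16 ≤ h^3 := by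
    rintro ⟨_, h2⟩
    constructor
    · nlinarith [sq_nonneg (h-1-4)]
    · have : 0 ≤ (h-9/2)^2*(h+9/4) := mul_nonneg (sq_nonneg _) (by linarith)
      nlinarith
  obtain ⟨b, hb⟩ : ∃ b, b = A - 2 := ⟨_, rfl⟩
  have hAb : A = b + 2 := by linarith
  have hhb : h < b := by linarith
  refine QL_pos hn p hp A h hA hhe h0 (by linarith) ?_ ?_ ?_ ?_ ?_
  · rw [← (P _ _).2]
    have e : (m+6)*(3*A^2 - 8 - 3*h^2) - m*(3*A^2-8) = 3*(6*A^2 - 16 - h^2*(A+4-h)) := by rw [hmh]; ring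
    rw [e]
    rcases hcases with hc | hc
    · have : 0 ≤ (b-h)*(6*(b+h) - h^2) := mul_nonneg (by linarith) (by nlinarith)
      rw [hAb]; nlinarith
    · obtain ⟨b1, b2⟩ := big hc
      have := hc.1
      nlinarith [mul_le_mul_of_nonneg_left b1 (by linarith : 0 ≤ A - 11/4)]
  · rw [← (P _ _).2]
    have e : (m+6)*(3*A^4 - 16*A^2 + 16 - 6*A^2*h^2 + 3*h^4) - m*(3*A^4 - 16*A^2 + 16)
        = 3*(2*(3*A^4-16*A^2+16) - (A+4-h)*h^2*(2*A^2-h^2)) := by rw [hmh]; ring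
    rw [e]
    exact c10_aux hA2 h0 b hAb hhb (hcases.imp id fun hc => ⟨hc.1, big hc⟩)
  · rw [← (P _ _).1]
    have e : (m+6)*(A^2*(A^2-4)^2 - (3*A^4+16)*h^2 + (3*A^2+8)*h^4 - h^6) - m*(A^2*(A^2-4)^2)
      = m * (gg (A+1) ((h-1)^2) - ((A+1-1)*(A+1+1)*(A+1-3))^2) := by rw [hmh]; unfold gg; ring
    rw [e]
    exact mul_pos hm0 (by linarith)
  · have e : 2*(3*A^4+16) - 4*(3*A^2+8)*h^2 + 6*h^4 = 6*(A^2-h^2)^2 + 32*(1-h^2) := by ring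
    rw [e]
    have : 4*h+4 ≤ A^2-h^2 := by nlinarith
    nlinarith
  · rcases hcases with hc | hc
    · rw [hAb]; nlinarith
    · obtain ⟨b1, b2⟩ := big hc
      have := hc.1
      nlinarith

end TH

namespace TH
variable {n : ℕ}

def one1 : SS n := emb (fun _ => 1) contDiff_const

def Kf (ζ : Wc) (c : ℝ) : SS n := rmW ζ (rp c one1)

lemma one1_near {x : Eu n} (hx : x ≠ 0) : (one1 : SS n).1 =ᶠ[nhds x] fun _ => 1 := by
  filter_upwards [sub_smooth_ne hx] with y hy using emb_ap _ _ hy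

lemma Xo_one : Xo (one1 : SS n) = 0 := SS.ext' fun x hx => by
  rw [Xo_ap, XX, vf_congr (one1_near hx)]
  simp [vf]

lemma Ro_one (i j : Fin n) : Ro i j (one1 : SS n) = 0 := SS.ext' fun x hx => by
  rw [Ro_ap, RR, vf_congr (one1_near hx)]
  simp [vf]

lemma Mu_one : Mu (one1 : SS n) = 0 := by
  rw [Mu_eq]; simp [Ro_one]

lemma Xo_rp_one (c : ℝ) : Xo (rp c one1 : SS n) = c • rp c one1 := by
  have h := Do_rp (n := n) c one1
  rw [Do_eq, Do_eq, Xo_one, zero_add, map_add, map_smul, map_smul] at h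
  exact add_right_cancel h

lemma Xo_Kf (ζ : Wc) (c : ℝ) : Xo (Kf ζ c : SS n) = Kf (dW ζ + c • ζ) c := by
  unfold Kf
  rw [rmW, Xo_rm ζ.2.1 (dW ζ).2.1, Xo_rp_one, map_smul, rmW_add_left, rmW_smul_left]
  rfl

lemma Mu_Kf (ζ : Wc) (c : ℝ) : Mu (Kf ζ c : SS n) = 0 := by
  unfold Kf
  rw [Mu_rmW, Mu_rp, Mu_one]; simp

lemma Kf_add (a b : Wc) (c : ℝ) : (Kf (a + b) c : SS n) = Kf a c + Kf b c := rmW_add_left _ _ _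
lemma Kf_smul (t : ℝ) (b : Wc) (c : ℝ) : (Kf (t • b) c : SS n) = t • Kf b c := rmW_smul_left _ _ _

lemma rp_Kf (d : ℝ) (ζ : Wc) (c : ℝ) : rp d (Kf ζ c : SS n) = Kf ζ (d + c) := by
  unfold Kf; rw [rp_rmW, rp_rp]

def LW (n : ℕ) (c : ℝ) (ζ : Wc) : Wc := dW (dW ζ) + (2*c + n - 2) • dW ζ + (c*(c+n-2)) • ζ

lemma Lo_Kf (ζ : Wc) (c : ℝ) : Lo (Kf ζ c : SS n) = Kf (LW n c ζ) (-2 + c) := by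
  rw [Lo_eq, Mu_Kf, Xo_Kf, Xo_Kf, ← rp_Kf]
  congr 1
  simp only [LW, map_add, map_smul, Kf_add, Kf_smul]
  module

lemma J_dW (c : ℝ) (ζ : Wc) : J (rp c one1 : SS n) (dW ζ) = -((n:ℝ) + c) * J (rp c one1 : SS n) ζ := by
  have := J_Xo (rp c one1 : SS n) ζ
  rw [Xo_rp_one, map_smul, LinearMap.smul_apply, smul_eq_mul] at this
  linarith

lemma Kf_zero_nhds (ζ : Wc) (c : ℝ) : (Kf ζ c : SS n).1 =ᶠ[nhds 0] fun _ => 0 := rmW_near_zero _ _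

lemma lap_Kf (ζ : Wc) (c : ℝ) : laplacian (Kf ζ c : SS n).1 = (Kf (LW n c ζ) (-2 + c) : SS n).1 := by
  funext x
  by_cases hx : x = 0
  · rw [hx, SS.zero, (laplacian_congr (Kf_zero_nhds ζ c)).self_of_nhds]
    rw [laplacian_eq]; simp
  · rw [← Lo_Kf, Lo_ap _ hx]

lemma grad_Kf (ζ : Wc) (c : ℝ) (x w : Eu n) :
    fderiv ℝ (Kf ζ c : SS n).1 x w = (rp (-2) (Xo (Kf ζ c : SS n))).1 x * inner ℝ x w := by
  by_cases hx : x = 0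
  · rw [hx, SS.zero, (Kf_zero_nhds ζ c).fderiv_eq]; simp
  have h1 : (Kf ζ c : SS n).1 =ᶠ[nhds x] fun x => (fun t => ζ.1 t * Real.exp (c*t)) (Real.log ‖x‖) := by
    filter_upwards [sub_smooth_ne hx] with y hy
    unfold Kf
    rw [rmW_ap]
    congr 1
    unfold rp
    rw [rm_ap]
    have : (one1 : SS n).1 y = 1 := emb_ap _ _ hy
    rw [this, mul_one]
  have hs : ContDiff ℝ (⊤ : ℕ∞) (fun t => ζ.1 t * Real.exp (c*t)) := ζ.2.1.mul (by fun_prop)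
  have r0 := norm_pos_iff.2 hx
  rw [rp_ap _ _ hx, Xo_ap, XX, vf, h1.fderiv_eq, fderiv_radial hs hx, fderiv_radial hs hx, real_inner_self_eq_norm_sq,
    div_self (by positivity), mul_one, Real.rpow_neg r0.le, Real.rpow_two]
  ring

/-- the kernels -/
def kap (n : ℕ) : SS n := Kf et 0
def GG (n : ℕ) : SS n := Kf (LW n (-2+0) (LW n 0 et)) (-2+(-2+0))
def rhoW (n : ℕ) : Wc := (-1:ℝ) • (dW (LW n (-2+0) (LW n 0 et)) + (-2+(-2+0):ℝ) • LW n (-2+0) (LW n 0 et))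
def rho (n : ℕ) : SS n := Kf (rhoW n) (-2+(-2+(-2+0)))

lemma GG_eq : (GG n).1 = laplacian (laplacian (kap n).1) := by
  rw [kap, lap_Kf, lap_Kf]; rfl

lemma rho_eq (x w : Eu n) : (rho n).1 x * inner ℝ x w = - fderiv ℝ (GG n).1 x w := by
  rw [GG, grad_Kf, Xo_Kf, rp_Kf, rho, rhoW, Kf_smul, SS.smul_ap]
  ring

lemma rho_int : ∫ x, (rho n).1 x = 8 * ((n:ℝ)-2)*((n:ℝ)-4)*((n:ℝ)-6) * J (rp (-2+(-2+(-2+0))) one1 : SS n) et := by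
  have : ∫ x, (rho n).1 x = J (rp (-2+(-2+(-2+0))) one1 : SS n) (rhoW n) := rfl
  rw [this, rhoW]
  simp only [LW, map_add, map_smul, smul_eq_mul, J_dW]
  ring

lemma rho_int_pos (hn : 7 ≤ n) : 0 < ∫ x, (rho n).1 x := by
  rw [rho_int]
  have hn' : (7:ℝ) ≤ n := by exact_mod_cast hn
  have : 0 < J (rp (-2+(-2+(-2+0))) one1 : SS n) et := by
    rw [J_ap]
    refine Continuous.integral_pos_of_hasCompactSupport_nonneg_nonzero (x := ee ⟨0, by omega⟩)
      (rmW_smooth et _).continuous (rmW_supp _ _) (fun x => ?_) ?_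
    · change 0 ≤ (rmW et (rp (-2+(-2+(-2+0))) one1 : SS n)).1 x
      by_cases hx : x = 0
      · rw [hx, SS.zero]
      rw [rmW_ap, rp_ap _ _ hx, one1, emb_ap _ _ hx]
      have := et_nn (Real.log ‖x‖)
      positivity
    · have h1 : ‖(ee ⟨0, by omega⟩ : Eu n)‖ = 1 := by simp [ee]
      have h0 : (ee ⟨0, by omega⟩ : Eu n) ≠ 0 := by rw [← norm_pos_iff, h1]; norm_num
      rw [rmW_ap, rp_ap _ _ h0, h1, Real.log_one, et_one le_rfl (by norm_num), Real.one_rpow, one1, emb_ap _ _ h0]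
      norm_num
  have a1 : 0 < (n:ℝ) - 2 := by linarith
  have a2 : 0 < (n:ℝ) - 4 := by linarith
  have a3 : 0 < (n:ℝ) - 6 := by linarith
  positivity

lemma kap_smooth : Smooth (kap n).1 := rmW_smooth _ _
lemma kap_supp : HasCompactSupport (kap n).1 := rmW_supp _ _
lemma rho_smooth : Smooth (rho n).1 := rmW_smooth _ _
lemma rho_supp : HasCompactSupport (rho n).1 := rmW_supp _ _
lemma GG_smooth : Smooth (GG n).1 := rmW_smooth _ _
lemma GG_supp : HasCompactSupport (GG n).1 := rmW_supp _ _

/-- compactly supported: everything in a fixed ball -/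
lemma exists_rad (n : ℕ) : ∃ r : ℝ, 1 ≤ r ∧ tsupport (kap n).1 ⊆ Metric.closedBall 0 r ∧ tsupport (rho n).1 ⊆ Metric.closedBall 0 r := by
  obtain ⟨r1, h1⟩ := (kap_supp (n := n)).isCompact.isBounded.subset_closedBall 0
  obtain ⟨r2, h2⟩ := (rho_supp (n := n)).isCompact.isBounded.subset_closedBall 0
  refine ⟨max 1 (max r1 r2), le_max_left _ _, h1.trans (Metric.closedBall_subset_closedBall ?_),
    h2.trans (Metric.closedBall_subset_closedBall ?_)⟩
  · exact (le_max_left _ _).trans (le_max_right _ _)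
  · exact (le_max_right _ _).trans (le_max_right _ _)

end TH

namespace TH
variable {n : ℕ}

/-- iterated directional derivatives -/
def DL : List (Eu n) → (Eu n → ℝ) → (Eu n → ℝ)
  | [], f => f
  | v :: L, f => fun x => fderiv ℝ (DL L f) x v

lemma DL_smooth {f : Eu n → ℝ} (hf : Smooth f) (L : List (Eu n)) : Smooth (DL L f) := by
  induction L with
  | nil => exact hf
  | cons v L ih => exact Smooth.pd ih v

lemma DL_supp {f : Eu n → ℝ} (hf : HasCompactSupport f) (L : List (Eu n)) : HasCompactSupport (DL L f) := by
  induction L with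
  | nil => exact hf
  | cons v L ih => exact ih.fderiv_apply ℝ v

lemma DL_tsupp (f : Eu n → ℝ) (L : List (Eu n)) : tsupport (DL L f) ⊆ tsupport f := by
  induction L with
  | nil => exact le_rfl
  | cons v L ih => exact (tsupport_fderiv_apply_subset ℝ v).trans ih

lemma DL_append (f : Eu n → ℝ) (L M : List (Eu n)) : DL (L ++ M) f = DL L (DL M f) := by
  induction L with
  | nil => rfl
  | cons v L ih => simp only [List.cons_append, DL, ih]

lemma DL_iter {f : Eu n → ℝ} (hf : Smooth f) (L : List (Eu n)) (x : Eu n) :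
    DL L f x = iteratedFDeriv ℝ L.length f x L.get := by
  induction L generalizing x with
  | nil => simp [DL]
  | cons v L ih =>
    have h1 : DL L f = fun y => iteratedFDeriv ℝ L.length f y L.get := funext ih
    have hd : DifferentiableAt ℝ (iteratedFDeriv ℝ L.length f) x :=
      (hf.differentiable_iteratedFDeriv (by exact_mod_cast WithTop.coe_lt_top _)) x
    change fderiv ℝ (DL L f) x v = _
    rw [h1, fderiv_continuousMultilinear_apply_const_apply hd]
    change _ = iteratedFDeriv ℝ (L.length+1) f x _
    rw [iteratedFDeriv_succ_apply_left]
    rfl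

lemma DL_le {f : Eu n → ℝ} (hf : Smooth f) (L : List (Eu n)) (x : Eu n) :
    |DL L f x| ≤ ‖iteratedFDeriv ℝ L.length f x‖ * (L.map norm).prod := by
  rw [DL_iter hf]
  have h := ContinuousMultilinearMap.le_opNorm (iteratedFDeriv ℝ L.length f x) L.get
  have e : (L.map norm).prod = ∏ i, ‖L.get i‖ := by
    rw [← List.prod_ofFn]
    congr 1
    conv_lhs => rw [← List.ofFn_get L, List.map_ofFn]
    rfl
  rw [e]
  exact h

lemma DL_ibp (L : List (Eu n)) : ∀ {φ w : Eu n → ℝ}, Smooth φ → HasCompactSupport φ → Smooth w →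
    ∫ x, φ x * DL L w x = (-1)^L.length * ∫ x, DL L.reverse φ x * w x := by
  induction L with
  | nil => intro φ w _ _ _; simp [DL]
  | cons v L ih =>
    intro φ w h1 h2 h3
    have h4 := pd_ibp (DL_smooth h3 L) h1 h2 v
    have h5 := ih (φ := fun x => fderiv ℝ φ x v) (h1.pd v) (h2.fderiv_apply ℝ v) h3
    have e1 : ∫ x, φ x * DL (v :: L) w x = - ∫ x, fderiv ℝ φ x v * DL L w x := by
      rw [← neg_eq_iff_eq_neg]
      rw [show (∫ x, fderiv ℝ φ x v * DL L w x) = ∫ x, DL L w x * fderiv ℝ φ x v from by simp only [mul_comm], h4]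
      simp only [DL, mul_comm]
    rw [e1, h5, List.reverse_cons, DL_append, List.length_cons, pow_succ]
    simp [DL]

lemma lap_pd {f : Eu n → ℝ} (hf : Smooth f) (v : Eu n) :
    laplacian (fun x => fderiv ℝ f x v) = fun x => fderiv ℝ (laplacian f) x v := by
  funext x
  have e : laplacian f = fun x => ∑ i, fderiv ℝ (fun y => fderiv ℝ f y (ee i)) x (ee i) :=
    funext (laplacian_eq' hf)
  have sw : ∀ (g : Eu n → ℝ), Smooth g → ∀ a b : Eu n, (fun z => fderiv ℝ (fun y => fderiv ℝ g y a) z b)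
      = fun z => fderiv ℝ (fun y => fderiv ℝ g y b) z a := by
    intro g hg a b
    funext z
    have hd : DifferentiableAt ℝ (fderiv ℝ g) z := (hg.fderiv_right (m := (⊤:ℕ∞)) (by simp)).differentiable (by simp) z
    have h2 : ∀ c d : Eu n, fderiv ℝ (fun y => fderiv ℝ g y c) z d = fderiv ℝ (fderiv ℝ g) z d c := by
      intro c d
      rw [fderiv_clm_apply hd (by fun_prop)]; simp
    rw [h2, h2]
    exact D2_symm hg.contDiffAt _ _
  rw [laplacian_eq' (hf.pd v), e, fderiv_fun_sum]
  · rw [ContinuousLinearMap.sum_apply]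
    refine Finset.sum_congr rfl fun i _ => ?_
    rw [sw f hf v (ee i)]
    exact congrFun (sw (fun y => fderiv ℝ f y (ee i)) (hf.pd _) v (ee i)) x
  · intro i _
    exact (((hf.pd (ee i)).pd (ee i)).diff) x

lemma lap_DL {f : Eu n → ℝ} (hf : Smooth f) (L : List (Eu n)) :
    laplacian (DL L f) = DL L (laplacian f) := by
  induction L with
  | nil => rfl
  | cons v L ih =>
    change laplacian (fun x => fderiv ℝ (DL L f) x v) = fun x => fderiv ℝ (DL L (laplacian f)) x v
    rw [lap_pd (DL_smooth hf L), ih]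

lemma DL_smul (c : ℝ) {f : Eu n → ℝ} (hf : Smooth f) (L : List (Eu n)) :
    DL L (fun x => c * f x) = fun x => c * DL L f x := by
  induction L with
  | nil => rfl
  | cons v L ih =>
    funext x
    simp only [DL, ih]
    rw [fderiv_const_mul ((DL_smooth hf L).diff x)]; simp

lemma DL_sca {f : Eu n → ℝ} (hf : Smooth f) (y : Eu n) (t : ℝ) (L : List (Eu n)) :
    DL L (sca y t f) = fun x => t^L.length * sca y t (DL L f) x := by
  induction L with
  | nil => simp [DL]
  | cons v L ih =>
    funext x
    simp only [DL, ih]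
    have hs : Smooth (DL L f) := DL_smooth hf L
    rw [fderiv_const_mul ((sca_smooth y t hs).diff x)]
    have := fderiv_sca y t hs.diff x
    simp only [ContinuousLinearMap.smul_apply, smul_eq_mul]
    rw [show sca y t (DL L f) = fun z => DL L f (y + t • z) from rfl, this]
    simp [sca, List.length_cons, pow_succ]; ring

lemma green3 {f g : Eu n → ℝ} (hf : Smooth f) (hg : Smooth g) (hc : HasCompactSupport g) :
    ∫ x, f x * laplacian g x = ∫ x, laplacian f x * g x := by
  have e1 : ∀ x, f x * laplacian g x = ∑ i, f x * fderiv ℝ (fun y => fderiv ℝ g y (ee i)) x (ee i) := by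
    intro x; rw [laplacian_eq' hg, Finset.mul_sum]
  have e2 : ∀ x, laplacian f x * g x = ∑ i, fderiv ℝ (fun y => fderiv ℝ f y (ee i)) x (ee i) * g x := by
    intro x; rw [laplacian_eq' hf, Finset.sum_mul]
  simp only [e1, e2]
  rw [integral_finsetSum, integral_finsetSum]
  · refine Finset.sum_congr rfl fun i _ => ?_
    have a := pd_ibp hf (hg.pd (ee i)) (hc.fderiv_apply ℝ (ee i)) (ee i)
    have b := pd_ibp (hf.pd (ee i)) hg hc (ee i)
    rw [a, b, neg_neg]
  · intro i _
    exact int_of (ContDiff.mul ((hf.pd (ee i)).pd (ee i)) hg) hc.mul_left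
  · intro i _
    exact int_of (ContDiff.mul hf ((hg.pd (ee i)).pd (ee i))) (((hc.fderiv_apply ℝ (ee i)).fderiv_apply ℝ (ee i)).mul_left)

end TH

namespace TH
variable {n : ℕ}

lemma DL_ofFn {f : Eu n → ℝ} (hf : Smooth f) {k : ℕ} (m : Fin k → Eu n) (x : Eu n) :
    DL (List.ofFn m) f x = iteratedFDeriv ℝ k f x m := by
  induction k generalizing x with
  | zero => simp [DL]
  | succ k ih =>
    have hd : DifferentiableAt ℝ (iteratedFDeriv ℝ k f) x :=
      (hf.differentiable_iteratedFDeriv (by exact_mod_cast WithTop.coe_lt_top _)) x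
    rw [List.ofFn_succ]
    change fderiv ℝ (DL (List.ofFn fun i => m i.succ) f) x (m 0) = _
    rw [show DL (List.ofFn fun i => m i.succ) f = fun y => iteratedFDeriv ℝ k f y (fun i => m i.succ) from
      funext fun y => ih _ y, fderiv_continuousMultilinear_apply_const_apply hd, iteratedFDeriv_succ_apply_left]
    rfl

lemma A_deriv {ρ w : Eu n → ℝ} (hρ : Smooth ρ) (hc : HasCompactSupport ρ) (hw : Smooth w) (t : ℝ) :
    HasDerivAt (fun s : ℝ => ∫ y, ρ y * w ((0 : Eu n) + s • y)) (∫ y, ρ y * fderiv ℝ w (0 + t • y) y) t := by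
  have hfc : Continuous (fderiv ℝ w) := (hw.fderiv_right (m := (⊤:ℕ∞)) (by simp)).continuous
  have hρc := hρ.continuous
  have hwc := hw.continuous
  have cF : Continuous fun q : ℝ × Eu n => ρ q.2 * fderiv ℝ w (0 + q.1 • q.2) q.2 := by
    have : Continuous fun q : ℝ × Eu n => fderiv ℝ w (0 + q.1 • q.2) q.2 :=
      (hfc.comp (by fun_prop)).clm_apply continuous_snd
    fun_prop
  obtain ⟨M, hM⟩ := ((isCompact_closedBall t 1).prod hc.isCompact).exists_bound_of_continuousOn cF.continuousOn
  have hIntg : ∀ s : ℝ, Integrable fun y => ρ y * w ((0 : Eu n) + s • y) := fun s =>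
    int_of (ContDiff.mul hρ (sca_smooth 0 s hw)) hc.mul_right
  refine (hasDerivAt_integral_of_dominated_loc_of_deriv_le (μ := volume)
    (F := fun (s : ℝ) (y : Eu n) => ρ y * w ((0 : Eu n) + s • y))
    (F' := fun (s : ℝ) (y : Eu n) => ρ y * fderiv ℝ w (0 + s • y) y) (x₀ := t) (s := Metric.ball t 1)
    (bound := (tsupport ρ).indicator fun _ => M) (Metric.ball_mem_nhds t one_pos)
    (Eventually.of_forall fun s => (hIntg s).aestronglyMeasurable) (hIntg t) ?_ ?_ ?_ ?_).2
  · exact (cF.comp (by fun_prop : Continuous fun y : Eu n => (t, y))).aestronglyMeasurable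
  · refine Eventually.of_forall fun y s hs => ?_
    by_cases hy : y ∈ tsupport ρ
    · rw [Set.indicator_of_mem hy]
      exact hM (s, y) ⟨Metric.ball_subset_closedBall hs, hy⟩
    · rw [Set.indicator_of_notMem hy, image_eq_zero_of_notMem_tsupport hy]; simp
  · rw [integrable_indicator_iff hc.isCompact.isClosed.measurableSet]
    exact integrableOn_const hc.isCompact.measure_lt_top.ne
  · refine Eventually.of_forall fun y s _ => ?_
    have h1 : HasDerivAt (fun s : ℝ => (0 : Eu n) + s • y) y s := by
      simpa using ((hasDerivAt_id s).smul_const y).const_add (0 : Eu n)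
    exact ((hw.diff _).hasFDerivAt.comp_hasDerivAt s h1).const_mul _

lemma A_deriv_eq {w : Eu n → ℝ} (hw : Smooth w) (t : ℝ) :
    ∫ y, (rho n).1 y * fderiv ℝ w (0 + t • y) y
      = t^5 * ∫ y, (kap n).1 y * sca 0 t (laplacian (laplacian (laplacian w))) y := by
  have e1 : ∀ y : Eu n, (rho n).1 y * fderiv ℝ w (0 + t • y) y
      = ∑ i, - (sca 0 t (fun z => fderiv ℝ w z (ee i)) y * fderiv ℝ (GG n).1 y (ee i)) := by
    intro y
    have : fderiv ℝ w (0 + t • y) y = ∑ i, y i * fderiv ℝ w (0 + t • y) (ee i) := by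
      generalize fderiv ℝ w (0 + t • y) = T
      conv_lhs => rw [← sum_ee y]
      simp [map_sum]
    rw [this, Finset.mul_sum]
    refine Finset.sum_congr rfl fun i _ => ?_
    have h := rho_eq y (ee i)
    rw [inner_ee] at h
    simp only [sca]
    linear_combination fderiv ℝ w (0 + t • y) (ee i) * h
  simp only [e1]
  rw [integral_finsetSum]
  swap
  · intro i _
    refine (int_of (ContDiff.mul (sca_smooth 0 t (hw.pd (ee i))) (GG_smooth.pd (ee i))) ?_).neg
    exact (GG_supp.fderiv_apply ℝ (ee i)).mul_left
  have e2 : ∀ i : Fin n, ∫ y, - (sca 0 t (fun z => fderiv ℝ w z (ee i)) y * fderiv ℝ (GG n).1 y (ee i))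
      = ∫ y, t * fderiv ℝ (fun z => fderiv ℝ w z (ee i)) (0 + t • y) (ee i) * (GG n).1 y := by
    intro i
    rw [integral_neg, pd_ibp (sca_smooth 0 t (hw.pd (ee i))) GG_smooth GG_supp, neg_neg]
    refine integral_congr_ae (Eventually.of_forall fun y => ?_)
    have := fderiv_sca 0 t (hw.pd (ee i)).diff y
    change fderiv ℝ (fun z => (fun z => fderiv ℝ w z (ee i)) (0 + t • z)) y (ee i) * _ = _
    rw [this]; simp
  simp only [e2]
  rw [← integral_finsetSum]
  swap
  · intro i _
    refine int_of (ContDiff.mul (contDiff_const.mul (sca_smooth 0 t ((hw.pd (ee i)).pd (ee i)))) GG_smooth) ?_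
    exact GG_supp.mul_left
  have e3 : ∀ y, ∑ i, t * fderiv ℝ (fun z => fderiv ℝ w z (ee i)) (0 + t • y) (ee i) * (GG n).1 y
      = t * (sca 0 t (laplacian w) y * laplacian (laplacian (kap n).1) y) := by
    intro y
    rw [← GG_eq, sca, laplacian_eq' hw, Finset.sum_mul, Finset.mul_sum]
    exact Finset.sum_congr rfl fun i _ => by ring
  simp only [e3]
  have sk := kap_smooth (n := n)
  have s1 := laplacian_smooth hw
  have s2 := laplacian_smooth s1
  rw [integral_const_mul, green3 (sca_smooth 0 t s1) (laplacian_smooth sk) (lap_supp kap_supp),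
    lap_sca 0 t s1, green3 (contDiff_const.mul (sca_smooth 0 t s2)) sk kap_supp, lap_csca _ 0 t s2,
    ← integral_const_mul, ← integral_const_mul]
  refine integral_congr_ae (Eventually.of_forall fun y => ?_)
  simp only [sca]
  ring

lemma int_bd {φ f : Eu n → ℝ} {K r a : ℝ} (g : Eu n → ℝ) (hg : Continuous g) (hgc : HasCompactSupport g)
    (h1 : ∀ y, |φ y| ≤ g y * a) (hs : tsupport φ ⊆ Metric.closedBall 0 r) (hf : ∀ y, ‖y‖ ≤ r → |f y| ≤ K)
    (ha : 0 ≤ a) (hg0 : ∀ y, 0 ≤ g y) (hK : 0 ≤ K) :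
    |∫ y, φ y * f y| ≤ (∫ y, g y) * a * K := by
  rw [← integral_mul_const, ← integral_mul_const]
  have hgi : Integrable g := hg.integrable_of_hasCompactSupport hgc
  have hgi2 : Integrable (fun y => g y * a * K) := (hgi.mul_const a).mul_const K
  rw [← Real.norm_eq_abs]
  refine norm_integral_le_of_norm_le hgi2 (Eventually.of_forall fun y => ?_)
  rw [Real.norm_eq_abs, abs_mul]
  by_cases hy : y ∈ tsupport φ
  · exact mul_le_mul (h1 y) (hf y (by simpa using hs hy)) (abs_nonneg _) (mul_nonneg (hg0 y) ha)
  · rw [image_eq_zero_of_notMem_tsupport hy]; simp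
    exact mul_nonneg (mul_nonneg (hg0 y) ha) hK

lemma DL_int_bd {φ f : Eu n → ℝ} {K r : ℝ} (hφ : Smooth φ) (hc : HasCompactSupport φ) (hfs : Smooth f)
    (hs : tsupport φ ⊆ Metric.closedBall 0 r) (hf : ∀ y, ‖y‖ ≤ r → |f y| ≤ K) (hK : 0 ≤ K) (L : List (Eu n)) :
    |∫ y, φ y * DL L f y| ≤ (∫ y, ‖iteratedFDeriv ℝ L.length φ y‖) * (L.map norm).prod * K := by
  rw [DL_ibp L hφ hc hfs, abs_mul, abs_pow, abs_neg, abs_one, one_pow, one_mul]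
  refine int_bd (fun y => ‖iteratedFDeriv ℝ L.length φ y‖) ?_ ?_ (fun y => ?_) ((DL_tsupp _ _).trans hs) hf ?_ ?_ hK
  · exact (hφ.continuous_iteratedFDeriv (by exact_mod_cast le_top)).norm
  · exact (hc.iteratedFDeriv (𝕜 := ℝ) _).norm
  · have h := DL_le hφ L.reverse y
    rwa [List.map_reverse, List.prod_reverse, List.length_reverse] at h
  · refine List.prod_nonneg fun x hx => ?_
    obtain ⟨v, _, rfl⟩ := List.mem_map.1 hx
    exact norm_nonneg v
  · exact fun y => norm_nonneg _

/-- elliptic estimate in dimensions at least 7 -/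
lemma ell7 (hn : 7 ≤ n) : ∃ C r : ℝ, 0 ≤ C ∧ 1 ≤ r ∧ ∀ (v : Eu n → ℝ) (K : ℝ), Smooth v → 0 ≤ K →
    (∀ y, ‖y‖ ≤ r → |v y| ≤ K) → (∀ y, ‖y‖ ≤ r → |laplacian (laplacian (laplacian v)) y| ≤ K) →
    ∀ k ≤ 5, ‖iteratedFDeriv ℝ k v 0‖ ≤ C * K := by
  obtain ⟨r, hr, hk, hρ⟩ := exists_rad n
  set I := ∫ x, (rho n).1 x with hI
  have I0 : 0 < I := rho_int_pos hn
  let c : ℕ → ℝ := fun k => ((∫ y, ‖iteratedFDeriv ℝ k (rho n).1 y‖) + ∫ y, ‖iteratedFDeriv ℝ k (kap n).1 y‖) / I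
  have c0 : ∀ k, 0 ≤ c k := fun k => div_nonneg (add_nonneg (integral_nonneg fun _ => norm_nonneg _)
    (integral_nonneg fun _ => norm_nonneg _)) I0.le
  refine ⟨∑ k ∈ Finset.range 6, c k, r, Finset.sum_nonneg fun k _ => c0 k, hr, ?_⟩
  intro v K hv hK hb1 hb2 k hk5
  have key : ‖iteratedFDeriv ℝ k v 0‖ ≤ c k * K := by
    refine ContinuousMultilinearMap.opNorm_le_bound (mul_nonneg (c0 k) hK) fun m => ?_
    set L := List.ofFn m with hL
    have hlen : L.length = k := by simp [hL]
    have e0 : iteratedFDeriv ℝ k v 0 m = DL L v 0 := by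
      rw [hL, DL_ofFn hv]
    have eP : ∏ i, ‖m i‖ = (L.map norm).prod := by
      rw [hL, List.map_ofFn, List.prod_ofFn]; rfl
    rw [e0, eP]
    set P := (L.map norm).prod
    have P0 : 0 ≤ P := by rw [← eP]; positivity
    set f := laplacian (laplacian (laplacian v)) with hf
    have s1 := laplacian_smooth hv
    have s2 := laplacian_smooth s1
    have hfs : Smooth f := laplacian_smooth s2
    set a1 := ∫ y, ‖iteratedFDeriv ℝ k (rho n).1 y‖
    set a2 := ∫ y, ‖iteratedFDeriv ℝ k (kap n).1 y‖
    have hw : Smooth (DL L v) := DL_smooth hv L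
    have hA1 : |∫ y, (rho n).1 y * DL L v ((0 : Eu n) + (1:ℝ) • y)| ≤ a1 * P * K := by
      have := DL_int_bd rho_smooth rho_supp hv hρ hb1 hK L
      rw [hlen] at this
      simpa using this
    have hA' : ∀ t ∈ Set.Ico (0:ℝ) 1, ‖∫ y, (rho n).1 y * fderiv ℝ (DL L v) (0 + t • y) y‖ ≤ a2 * P * K := by
      intro t ht
      rw [A_deriv_eq hw, lap_DL hv, lap_DL s1, lap_DL s2, ← hf]
      have e1 : t^5 * ∫ y, (kap n).1 y * sca 0 t (DL L f) y = t^(5-k) * ∫ y, (kap n).1 y * DL L (sca 0 t f) y := by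
        rw [← integral_const_mul, ← integral_const_mul]
        refine integral_congr_ae (Eventually.of_forall fun y => ?_)
        simp only [DL_sca hfs, hlen]
        rw [show t^5 = t^(5-k) * t^k by rw [← pow_add]; congr 1; omega]
        ring
      rw [e1, Real.norm_eq_abs, abs_mul, abs_pow]
      have h1 : |t|^(5-k) ≤ 1 := pow_le_one₀ (abs_nonneg _) (abs_le.2 ⟨by linarith [ht.1], ht.2.le⟩)
      have h2 := DL_int_bd (K := K) kap_smooth kap_supp (sca_smooth 0 t hfs) hk (fun y hy => by
        refine hb2 _ ?_
        rw [zero_add, norm_smul, Real.norm_eq_abs, abs_of_nonneg ht.1]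
        nlinarith [norm_nonneg y, ht.1, ht.2]) hK L
      rw [hlen] at h2
      exact (mul_le_of_le_one_left (abs_nonneg _) h1).trans h2
    have hM := norm_image_sub_le_of_norm_deriv_le_segment_01'
      (f := fun s : ℝ => ∫ y, (rho n).1 y * DL L v ((0 : Eu n) + s • y))
      (fun t _ => (A_deriv rho_smooth rho_supp hw t).hasDerivWithinAt) hA'
    have eA0 : (∫ y, (rho n).1 y * DL L v ((0 : Eu n) + (0:ℝ) • y)) = I * DL L v 0 := by
      simp only [zero_smul, add_zero, integral_mul_const, hI]
    rw [eA0] at hM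
    have h3 : |I * DL L v 0| ≤ (a1 + a2) * P * K := by
      have h4 := abs_sub_abs_le_abs_sub (I * DL L v 0) (∫ y, (rho n).1 y * DL L v ((0 : Eu n) + (1:ℝ) • y))
      rw [abs_sub_comm, ← Real.norm_eq_abs (_ - _)] at h4
      linarith
    rw [abs_mul, abs_of_pos I0] at h3
    have : c k * K * P = (a1 + a2) * P * K / I := by simp only [c]; ring
    rw [this, Real.norm_eq_abs, le_div_iff₀ I0]
    linarith
  refine key.trans (mul_le_mul_of_nonneg_right ?_ hK)
  exact Finset.single_le_sum (f := c) (fun k _ => c0 k) (Finset.mem_range.2 (by omega))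

end TH

namespace TH
variable {n : ℕ}

/-- projection and inclusion -/
def prj (n : ℕ) : Eu (n+7) →L[ℝ] Eu n :=
  ∑ i : Fin n, (EuclideanSpace.proj (Fin.castAdd 7 i) : Eu (n+7) →L[ℝ] ℝ).smulRight (ee i)
def inj (n : ℕ) : Eu n →L[ℝ] Eu (n+7) :=
  ∑ i : Fin n, (EuclideanSpace.proj i : Eu n →L[ℝ] ℝ).smulRight (ee (Fin.castAdd 7 i))

lemma prj_ap (x : Eu (n+7)) (k : Fin n) : prj n x k = x (Fin.castAdd 7 k) := by
  simp [prj, ee_apply]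
lemma inj_l (x : Eu n) (k : Fin n) : inj n x (Fin.castAdd 7 k) = x k := by
  simp [inj, ee_apply]
lemma inj_r (x : Eu n) (k : Fin 7) : inj n x (Fin.natAdd n k) = 0 := by
  simp only [inj, sum_apply, ContinuousLinearMap.smulRight_apply, WithLp.ofLp_sum, Finset.sum_apply]
  refine Finset.sum_eq_zero fun i _ => ?_
  have : Fin.natAdd n k ≠ Fin.castAdd 7 i := by
    intro h
    have := congrArg Fin.val h
    simp at this
    omega
  simp [ee_apply, this]

lemma prj_inj (x : Eu n) : prj n (inj n x) = x := by
  ext k; rw [prj_ap, inj_l]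
lemma prj_norm (x : Eu (n+7)) : ‖prj n x‖ ≤ ‖x‖ := by
  refine abs_le_of_sq_le_sq' ?_ (norm_nonneg _) |>.2
  rw [EuclideanSpace.norm_sq_eq, EuclideanSpace.norm_sq_eq, Fin.sum_univ_add]
  simp only [prj_ap]
  exact le_add_of_nonneg_right (Finset.sum_nonneg fun _ _ => sq_nonneg _)
lemma inj_norm (x : Eu n) : ‖inj n x‖ ≤ ‖x‖ := by
  refine abs_le_of_sq_le_sq' ?_ (norm_nonneg _) |>.2
  rw [EuclideanSpace.norm_sq_eq, EuclideanSpace.norm_sq_eq, Fin.sum_univ_add]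
  simp [inj_l, inj_r]
lemma prj_l (i : Fin n) : prj n (ee (Fin.castAdd 7 i)) = ee i := by
  ext k; rw [prj_ap, ee_apply, ee_apply]; simp
lemma prj_r (j : Fin 7) : prj n (ee (Fin.natAdd n j)) = 0 := by
  ext k; rw [prj_ap, ee_apply]
  have : Fin.castAdd 7 k ≠ Fin.natAdd n j := by
    intro h
    have := congrArg Fin.val h
    simp at this
    omega
  simp [this]

lemma sm_prj {v : Eu n → ℝ} (hv : Smooth v) : Smooth (fun x => v (prj n x)) := hv.comp (prj n).contDiff

lemma fd_prj {v : Eu n → ℝ} (hv : Smooth v) (x w : Eu (n+7)) :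
    fderiv ℝ (fun x => v (prj n x)) x w = fderiv ℝ v (prj n x) (prj n w) := by
  have := ((hv.diff (prj n x)).hasFDerivAt.comp x (prj n).hasFDerivAt).fderiv
  change fderiv ℝ (v ∘ (prj n)) x w = _
  rw [this]; rfl

lemma lap_prj {v : Eu n → ℝ} (hv : Smooth v) :
    laplacian (fun x => v (prj n x)) = fun x => laplacian v (prj n x) := by
  funext x
  rw [laplacian_eq' (sm_prj hv), laplacian_eq' hv]
  have h : ∀ w : Eu (n+7), fderiv ℝ (fun y => fderiv ℝ (fun x => v (prj n x)) y w) x w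
      = fderiv ℝ (fun y => fderiv ℝ v y (prj n w)) (prj n x) (prj n w) := by
    intro w
    simp only [fd_prj hv]
    exact fd_prj (v := fun y => fderiv ℝ v y (prj n w)) (hv.pd _) x w
  simp only [h]
  rw [Fin.sum_univ_add]
  simp [prj_l, prj_r]

lemma ell (n : ℕ) : ∃ C r : ℝ, 0 ≤ C ∧ 1 ≤ r ∧ ∀ (v : Eu n → ℝ) (K : ℝ), Smooth v → 0 ≤ K →
    (∀ y, ‖y‖ ≤ r → |v y| ≤ K) → (∀ y, ‖y‖ ≤ r → |laplacian (laplacian (laplacian v)) y| ≤ K) →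
    ∀ k ≤ 5, ‖iteratedFDeriv ℝ k v 0‖ ≤ C * K := by
  obtain ⟨C, r, hC, hr, h⟩ := ell7 (n := n+7) (by omega)
  refine ⟨C, r, hC, hr, fun v K hv hK h1 h2 k hk => ?_⟩
  have h3 := h (fun x => v (prj n x)) K (sm_prj hv) hK (fun y hy => h1 _ ((prj_norm y).trans hy)) (fun y hy => by
    rw [lap_prj hv, lap_prj (laplacian_smooth hv), lap_prj (laplacian_smooth (laplacian_smooth hv))]
    exact h2 _ ((prj_norm y).trans hy)) k hk
  refine ContinuousMultilinearMap.opNorm_le_bound (mul_nonneg hC hK) fun m => ?_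
  have e := (prj n).iteratedFDeriv_comp_right (i := k) hv 0 (by exact_mod_cast le_top)
  have e2 : iteratedFDeriv ℝ k (fun x => v (prj n x)) 0 (fun i => inj n (m i)) = iteratedFDeriv ℝ k v 0 m := by
    change iteratedFDeriv ℝ k (v ∘ (prj n)) 0 _ = _
    rw [e]
    simp [prj_inj]
  rw [← e2]
  refine (ContinuousMultilinearMap.le_opNorm _ _).trans ?_
  refine mul_le_mul h3 (Finset.prod_le_prod (fun _ _ => norm_nonneg _) fun i _ => inj_norm _)
    (Finset.prod_nonneg fun _ _ => norm_nonneg _) (mul_nonneg hC hK)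

end TH

namespace TH
variable {n : ℕ}

lemma Sol.lap_le {p : ℝ} (hp : 1 < p) {v : Eu n → ℝ} (hv : Sol p v) {B : ℝ} {x : Eu n} (h : |v x| ≤ B) :
    |laplacian (laplacian (laplacian v)) x| ≤ B ^ (p-1) * B := by
  rw [hv.eq, abs_neg, abs_mul, abs_of_nonneg (Real.rpow_nonneg (abs_nonneg _) _)]
  exact mul_le_mul (Real.rpow_le_rpow (abs_nonneg _) h (by linarith)) h (abs_nonneg _)
    (Real.rpow_nonneg ((abs_nonneg _).trans h) _)

lemma grad_half (n : ℕ) {p : ℝ} (hp : 1 < p) (B : ℝ) (hB : 0 ≤ B) : ∃ δ r1 : ℝ, 0 < δ ∧ 0 < r1 ∧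
    ∀ v : Eu n → ℝ, Sol p v → (∀ x, ‖x‖ ≤ r1 → |v x| ≤ B) → |v 0| = 1 → ∀ x, ‖x‖ ≤ δ → 1/2 ≤ |v x| := by
  obtain ⟨C, r, hC, hr, h⟩ := ell n
  have hBp : 0 ≤ B ^ (p-1) * B := mul_nonneg (Real.rpow_nonneg hB _) hB
  set K := B + B ^ (p-1) * B with hK
  have K0 : 0 ≤ K := add_nonneg hB hBp
  have CK : 0 ≤ C * K := mul_nonneg hC K0
  refine ⟨min 1 (1 / (2 * (C * K + 1))), r + 1, by positivity, by linarith, ?_⟩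
  intro v hv hb h0 x hx
  have hx1 : ‖x‖ ≤ 1 := hx.trans (min_le_left _ _)
  have hx2 : ‖x‖ ≤ 1 / (2 * (C * K + 1)) := hx.trans (min_le_right _ _)
  have hd : ∀ y ∈ Metric.closedBall (0 : Eu n) 1, ‖fderiv ℝ v y‖ ≤ C * K := by
    intro y hy
    have hy1 : ‖y‖ ≤ 1 := by simpa using hy
    have hbd : ∀ z, ‖z‖ ≤ r → |v (y + (1:ℝ) • z)| ≤ B := fun z hz => hb _ (by
      rw [one_smul]; linarith [norm_add_le y z])
    have h1 := h (sca y 1 v) K (sca_smooth y 1 hv.sm) K0 (fun z hz => (hbd z hz).trans (by linarith)) (fun z hz => by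
      have e : laplacian (laplacian (laplacian (sca y 1 v))) = sca y 1 (laplacian (laplacian (laplacian v))) := by
        have s1 := laplacian_smooth hv.sm
        have s2 := laplacian_smooth s1
        have l : ∀ g : Eu n → ℝ, Smooth g → laplacian (sca y 1 g) = sca y 1 (laplacian g) := fun g hg => by
          rw [lap_sca y 1 hg]; funext; simp
        rw [l _ hv.sm, l _ s1, l _ s2]
      rw [e]
      exact (hv.lap_le hp (hbd z hz)).trans (by linarith)) 1 (by norm_num)
    have e2 : ‖iteratedFDeriv ℝ 1 (sca y 1 v) 0‖ = ‖fderiv ℝ v y‖ := by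
      rw [norm_iteratedFDeriv_one]
      have := fderiv_sca y 1 hv.sm.diff 0
      rw [show sca y 1 v = fun z => v (y + (1:ℝ) • z) from rfl, this]
      simp
    rwa [e2] at h1
  have h2 := (convex_closedBall (0 : Eu n) 1).norm_image_sub_le_of_norm_fderiv_le (f := v)
    (fun y _ => hv.sm.diff y) hd (Metric.mem_closedBall_self zero_le_one) (by simpa using hx1 : x ∈ _)
  rw [sub_zero] at h2
  have h3 : C * K * ‖x‖ ≤ 1/2 := by
    have h4 : ‖x‖ * (2 * (C * K + 1)) ≤ 1 := by rwa [le_div_iff₀ (by positivity)] at hx2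
    nlinarith [norm_nonneg x]
  have h5 := abs_sub_abs_le_abs_sub (v 0) (v x)
  rw [abs_sub_comm, ← Real.norm_eq_abs (_ - _)] at h5
  linarith

lemma mm_pos {p : ℝ} (hp : 1 < p) : 0 < mm p := div_pos (by norm_num) (by linarith)

lemma decay0 {p : ℝ} (hp : 1 < p) (hQ : QL n p) : ∃ M : ℝ, 0 < M ∧ ∀ (u : Eu n → ℝ) (x0 : Eu n) (R : ℝ),
    0 < R → Sol p u → StabAt p u x0 R → |u x0| ≤ (M / R) ^ (mm p) := by
  have hm := mm_pos hp
  set m := mm p with hmdef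
  have hB : (0:ℝ) ≤ 2 ^ m := Real.rpow_nonneg (by norm_num) _
  obtain ⟨δ, r1, hδ, hr1, hG⟩ := grad_half n hp (2 ^ m) hB
  obtain ⟨R0, hR0, hQ⟩ := hQ (2 ^ m) δ hδ
  set R1 := max R0 r1 with hR1
  have hR1p : 0 < R1 := lt_max_of_lt_left hR0
  refine ⟨2 * R1, by positivity, fun u x0 R hR hu hs => ?_⟩
  by_cases hux : u x0 = 0
  · rw [hux, abs_zero]; positivity
  have hux' : 0 < |u x0| := abs_pos.2 hux
  let g : Eu n → ℝ := fun y => |u y| ^ (1/m) * (R - ‖y - x0‖)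
  have hg : Continuous g := by
    have h1 : Continuous fun y => |u y| ^ (1/m) :=
      (hu.sm.continuous.abs).rpow_const fun _ => Or.inr (by positivity)
    have h2 : Continuous fun y : Eu n => (R - ‖y - x0‖) := by fun_prop
    exact h1.mul h2
  obtain ⟨ys, hys, hmax⟩ := (isCompact_closedBall x0 R).exists_isMaxOn
    ⟨x0, Metric.mem_closedBall_self hR.le⟩ hg.continuousOn
  have g0 : g x0 = |u x0| ^ (1/m) * R := by simp [g]
  have h1 : |u x0| ^ (1/m) * R ≤ g ys := by
    rw [← g0]; exact hmax (Metric.mem_closedBall_self hR.le)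
  have hgp : 0 < g ys := lt_of_lt_of_le (by positivity) h1
  have hysR : ‖ys - x0‖ ≤ R := by simpa [dist_eq_norm] using hys
  set d := R - ‖ys - x0‖ with hd
  have hgys : g ys = |u ys| ^ (1/m) * d := rfl
  have hd0 : 0 < d := by
    rcases (show 0 ≤ d by linarith).eq_or_lt with h | h
    · rw [hgys, ← h, mul_zero] at hgp; exact absurd hgp (lt_irrefl _)
    · exact h
  have huy : 0 < |u ys| := by
    rcases (abs_nonneg (u ys)).eq_or_lt with h | h
    · rw [hgys, ← h, Real.zero_rpow (by positivity), zero_mul] at hgp; exact absurd hgp (lt_irrefl _)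
    · exact h
  set a := |u ys| ^ (1/m) with ha
  have ha0 : 0 < a := Real.rpow_pos_of_pos huy _
  have ham : a ^ m = |u ys| := by
    rw [ha, ← Real.rpow_mul huy.le, one_div_mul_cancel hm.ne', Real.rpow_one]
  set l := a⁻¹ with hl
  have hl0 : 0 < l := inv_pos.2 ha0
  have hlm : l ^ m = |u ys|⁻¹ := by rw [hl, Real.inv_rpow ha0.le, ham]
  have hfin : a * d < 2 * R1 := by
    by_contra hcon
    push Not at hcon
    have hrad : R1 ≤ a * d / 2 := by linarith
    have hv := resc hp hu ys hl0
    have hball : ∀ z : Eu n, ‖z‖ ≤ a * d / 2 → ‖ys + l • z - x0‖ ≤ R - d / 2 := by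
      intro z hz
      have : ‖l • z‖ ≤ d / 2 := by
        rw [norm_smul, Real.norm_eq_abs, abs_of_pos hl0]
        calc l * ‖z‖ ≤ l * (a * d / 2) := mul_le_mul_of_nonneg_left hz hl0.le
          _ = d / 2 := by rw [hl]; field_simp
      have h3 : ys + l • z - x0 = (ys - x0) + l • z := by abel
      rw [h3]
      linarith [norm_add_le (ys - x0) (l • z)]
    have hbd : ∀ z, ‖z‖ ≤ a * d / 2 → |l ^ m * u (ys + l • z)| ≤ 2 ^ m := by
      intro z hz
      set y := ys + l • z with hy
      have hyb := hball z hz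
      have h4 : g y ≤ g ys := hmax (show y ∈ Metric.closedBall x0 R by
        rw [Metric.mem_closedBall, dist_eq_norm]; linarith)
      have h5 : |u y| ^ (1/m) * (d/2) ≤ a * d := by
        refine le_trans ?_ (hgys ▸ h4)
        exact mul_le_mul_of_nonneg_left (by linarith) (Real.rpow_nonneg (abs_nonneg _) _)
      have h6 : |u y| ^ (1/m) ≤ 2 * a := by nlinarith
      have h7 : |u y| ≤ 2 ^ m * |u ys| := by
        have := Real.rpow_le_rpow (Real.rpow_nonneg (abs_nonneg _) _) h6 hm.le
        rwa [← Real.rpow_mul (abs_nonneg _), one_div_mul_cancel hm.ne', Real.rpow_one,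
          Real.mul_rpow (by norm_num) ha0.le, ham] at this
      rw [abs_mul, hlm, abs_of_pos (inv_pos.2 huy), inv_mul_le_iff₀ huy]
      linarith
    have hst : StabOn p (fun z => l ^ (mm p) * u (ys + l • z)) (a * d / 2) := by
      refine resc_stab hp ys hl0 ?_
      have e : l * (a * d / 2) = d / 2 := by rw [hl]; field_simp
      rw [e]
      intro φ h1 h2 h3
      refine hs φ h1 h2 (h3.trans (Metric.closedBall_subset_closedBall' ?_))
      rw [dist_eq_norm]; linarith
    refine hQ _ _ hv ((le_max_left _ _).trans hrad) hst hbd ?_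
    refine hG _ hv (fun z hz => hbd z (hz.trans ((le_max_right _ _).trans hrad))) ?_
    change |l ^ m * u (ys + l • 0)| = 1
    rw [smul_zero, add_zero, abs_mul, hlm, abs_of_pos (inv_pos.2 huy), inv_mul_cancel₀ huy.ne']
  have h8 : |u x0| ^ (1/m) ≤ 2 * R1 / R := by
    rw [le_div_iff₀ hR]; linarith [hgys]
  have := Real.rpow_le_rpow (Real.rpow_nonneg (abs_nonneg _) _) h8 hm.le
  rwa [← Real.rpow_mul (abs_nonneg _), one_div_mul_cancel hm.ne', Real.rpow_one] at this

lemma resc_iter {u : Eu n → ℝ} (hu : Smooth u) (x : Eu n) {s : ℝ} (hs : 0 < s) (c : ℝ) (hc : 0 < c) (k : ℕ) :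
    c * s^k * ‖iteratedFDeriv ℝ k u x‖ ≤ ‖iteratedFDeriv ℝ k (fun z => c * u (x + s • z)) 0‖ := by
  have hcs : 0 < c * s^k := by positivity
  rw [← le_div_iff₀' hcs]
  refine ContinuousMultilinearMap.opNorm_le_bound (div_nonneg (norm_nonneg _) hcs.le) fun m => ?_
  have hv : Smooth (fun z => c * u (x + s • z)) := contDiff_const.mul (sca_smooth x s hu)
  have e : iteratedFDeriv ℝ k (fun z => c * u (x + s • z)) 0 m = c * s^k * iteratedFDeriv ℝ k u x m := by
    rw [← DL_ofFn hv, ← DL_ofFn hu, show (fun z => c * u (x + s • z)) = fun z => c * sca x s u z from rfl,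
      DL_smul c (sca_smooth x s hu), DL_sca hu]
    simp [sca, mul_assoc]
  have h := ContinuousMultilinearMap.le_opNorm (iteratedFDeriv ℝ k (fun z => c * u (x + s • z)) 0) m
  rw [e, norm_mul, Real.norm_of_nonneg hcs.le] at h
  rw [div_mul_eq_mul_div, le_div_iff₀' hcs]
  exact h

theorem final (n : ℕ) (p : ℝ) (hp : 1 < p) (hQ : QL n p)
    (u : Eu n → ℝ) (hu : Sol p u) (Θ : Set (Eu n)) (hΘ : IsCompact Θ)
    (hstab : ∀ φ : Eu n → ℝ, Smooth φ → HasCompactSupport φ → tsupport φ ⊆ Θᶜ →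
      p * (∫ x, |u x| ^ (p - 1) * φ x ^ 2) ≤ ∫ x, ‖gradient (laplacian φ) x‖ ^ 2) :
    ∃ C : ℝ, 0 < C ∧ ∃ R₀ : ℝ, 0 < R₀ ∧ ∀ x : Eu n, R₀ ≤ ‖x‖ →
        ∑ k ∈ Finset.range 6, ‖x‖ ^ (6 / (p - 1) + (k : ℝ)) * ‖iteratedFDeriv ℝ k u x‖ ≤ C := by
  obtain ⟨M, hM, hdec⟩ := decay0 hp hQ
  obtain ⟨C, r, hC, hr, hell⟩ := ell n
  obtain ⟨ρ0, hρ0⟩ := hΘ.isBounded.subset_closedBall 0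
  have hm := mm_pos hp
  set K1 := (2 * M / r) ^ (mm p) with hK1
  have r0 : 0 < r := by linarith
  have K10 : 0 ≤ K1 := Real.rpow_nonneg (by positivity) _
  set K := K1 + K1 ^ (p-1) * K1 with hK
  have hKp : 0 ≤ K1 ^ (p-1) * K1 := mul_nonneg (Real.rpow_nonneg K10 _) K10
  have K0 : 0 ≤ K := add_nonneg K10 hKp
  refine ⟨(∑ k ∈ Finset.range 6, (4 * r) ^ (6 / (p - 1) + (k : ℝ)) * (C * K)) + 1, ?_, 2 * |ρ0| + 2, by positivity, ?_⟩
  · have : 0 ≤ ∑ k ∈ Finset.range 6, (4 * r) ^ (6 / (p - 1) + (k : ℝ)) * (C * K) :=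
      Finset.sum_nonneg fun k _ => by positivity
    linarith
  intro x hx
  have hx0 : 0 < ‖x‖ := by linarith [abs_nonneg ρ0]
  have hρx : ρ0 < ‖x‖ / 2 := by linarith [le_abs_self ρ0]
  have hux : ∀ y, ‖y - x‖ ≤ ‖x‖ / 4 → |u y| ≤ (8 * M / ‖x‖) ^ mm p := by
    intro y hy
    have h1 := hdec u y (‖x‖/8) (by positivity) hu (by
      intro φ h1 h2 h3
      refine hstab φ h1 h2 fun z hz hzΘ => ?_
      have a1 := h3 hz
      have a2 := hρ0 hzΘ
      rw [Metric.mem_closedBall, dist_eq_norm] at a1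
      rw [Metric.mem_closedBall, dist_zero_right] at a2
      have a3 : ‖x‖ ≤ ‖z‖ + ‖z - y‖ + ‖y - x‖ := by
        have : x = z - (z - y) - (y - x) := by abel
        calc ‖x‖ = ‖z - (z - y) - (y - x)‖ := by rw [← this]
          _ ≤ _ := (norm_sub_le _ _).trans (by gcongr; exact norm_sub_le _ _)
      linarith)
    have e : M / (‖x‖/8) = 8 * M / ‖x‖ := by field_simp
    rwa [e] at h1
  set s := ‖x‖ / (4 * r) with hs
  have hs0 : 0 < s := by positivity
  have hv := resc hp hu x hs0
  have hb : ∀ z, ‖z‖ ≤ r → |s ^ mm p * u (x + s • z)| ≤ K1 := by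
    intro z hz
    have h1 := hux (x + s • z) (by
      rw [add_sub_cancel_left, norm_smul, Real.norm_eq_abs, abs_of_pos hs0]
      calc s * ‖z‖ ≤ s * r := mul_le_mul_of_nonneg_left hz hs0.le
        _ = ‖x‖ / 4 := by rw [hs]; field_simp)
    rw [abs_mul, abs_of_pos (Real.rpow_pos_of_pos hs0 _)]
    calc s ^ mm p * |u (x + s • z)| ≤ s ^ mm p * (8 * M / ‖x‖) ^ mm p :=
          mul_le_mul_of_nonneg_left h1 (Real.rpow_nonneg hs0.le _)
      _ = K1 := by
          rw [← Real.mul_rpow hs0.le (by positivity), hK1]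
          congr 1
          rw [hs]; field_simp; norm_num
  have hk : ∀ k ≤ 5, ‖iteratedFDeriv ℝ k (fun z => s ^ mm p * u (x + s • z)) 0‖ ≤ C * K :=
    hell _ K hv.sm K0 (fun y hy => (hb y hy).trans (by linarith))
      (fun y hy => (hv.lap_le hp (hb y hy)).trans (by linarith))
  refine le_add_of_le_of_nonneg (Finset.sum_le_sum fun k hkr => ?_) zero_le_one
  have h1 := (resc_iter hu.sm x hs0 (s ^ mm p) (Real.rpow_pos_of_pos hs0 _) k).trans
    (hk k (by have := Finset.mem_range.1 hkr; omega))
  have e : ‖x‖ ^ (6 / (p - 1) + (k : ℝ)) = (4*r) ^ (6 / (p - 1) + (k : ℝ)) * (s ^ mm p * s ^ k) := by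
    rw [← Real.rpow_natCast s k, ← Real.rpow_add hs0, mm, ← Real.mul_rpow (by positivity) hs0.le]
    congr 1
    rw [hs]; field_simp
  rw [e, mul_assoc]
  exact mul_le_mul_of_nonneg_left h1 (by positivity)

end TH

/-- **Corollary 6.1.** Under the hypotheses of Lemma 6.1, there are `C > 0` and `R₀ > 0` such
that for all `|x| ≥ R₀`, `∑_{k ≤ 5} |x|^{6/(p-1)+k} ‖∇ᵏu(x)‖ ≤ C`, where `∇ᵏu` denotes the
`k`-th iterated (Fréchet) derivative of `u`. -/
theorem triharmonic_finiteMorse_derivative_decay (n : ℕ) (hn : 1 ≤ n) (p : ℝ) (hp : 1 < p)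
    (hpc : 15 ≤ n → p < pc n)
    (u : EuclideanSpace ℝ (Fin n) → ℝ) (hu : ContDiff ℝ (⊤ : ℕ∞) u)
    (heq : ∀ x, laplacian (laplacian (laplacian u)) x = -(|u x| ^ (p - 1) * u x))
    (Θ : Set (EuclideanSpace ℝ (Fin n))) (hΘ : IsCompact Θ)
    (hstab : ∀ φ : EuclideanSpace ℝ (Fin n) → ℝ, ContDiff ℝ (⊤ : ℕ∞) φ →
      HasCompactSupport φ → tsupport φ ⊆ Θᶜ →
      p * (∫ x, |u x| ^ (p - 1) * φ x ^ 2) ≤ ∫ x, ‖gradient (laplacian φ) x‖ ^ 2) :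
    ∃ C : ℝ, 0 < C ∧ ∃ R₀ : ℝ, 0 < R₀ ∧
      ∀ x : EuclideanSpace ℝ (Fin n), R₀ ≤ ‖x‖ →
        ∑ k ∈ Finset.range 6,
          ‖x‖ ^ (6 / (p - 1) + (k : ℝ)) * ‖iteratedFDeriv ℝ k u x‖ ≤ C := by
  exact TH.final n p hp (TH.QL_main hn p hp hpc) u ⟨hu, heq⟩ Θ hΘ hstab
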